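/- Fix real numbers A, B ≥ 1. There is a constant C = C(A,B) > 0 such that uniformly for all real x ≥ 3, all nonzero integers a with 0 < |a| ≤ x/(log x)^{A+B+1}, all real M with 1 ≤ M ≤ (log x)^A, and all real R with 2M ≤ R ≤ x^{1/2}, one has | (1/(x/(2M))) · Σ_{x/(2M) < q ≤ x/M} ( ψ*(x;q,a) − ρ_R*(x;q,a) ) | ≤ C/(log x)^B, where q runs over integers. -/

import Mathlib

open Finset Real

/-- Vaughan's function `F_R(n) = ∑_{r ≤ R} μ(r)² μ((r,n)) φ((r,n)) / φ(r)`. -/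
noncomputable def FR (R : ℝ) (n : ℤ) : ℝ :=
  ∑ r ∈ Finset.Icc 1 ⌊R⌋₊,
    (ArithmeticFunction.moebius r : ℝ) ^ 2 *
      (ArithmeticFunction.moebius (Int.gcd (r : ℤ) n) : ℝ) *
      (Nat.totient (Int.gcd (r : ℤ) n) : ℝ) / (Nat.totient r : ℝ)

/-- `ρ_R^*(x;q,a) = ∑_{n ≤ x, n ≡ a (q), n > a} F_R(n)`. -/
noncomputable def rhoStar (R x : ℝ) (q : ℕ) (a : ℤ) : ℝ :=
  ∑ n ∈ (Finset.Icc 1 ⌊x⌋₊).filter (fun n : ℕ => a < (n : ℤ) ∧ (q : ℤ) ∣ (n : ℤ) - a),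
    FR R n

/-- `ψ^*(x;q,a) = ∑_{n ≤ x, n ≡ a (q), n > a} Λ(n)`. -/
noncomputable def psiStar (x : ℝ) (q : ℕ) (a : ℤ) : ℝ :=
  ∑ n ∈ (Finset.Icc 1 ⌊x⌋₊).filter (fun n : ℕ => a < (n : ℤ) ∧ (q : ℤ) ∣ (n : ℤ) - a),
    ArithmeticFunction.vonMangoldt n

section

open Complex Filter Topology MeasureTheory Set

/-- The discrepancy `∑_{X < k ≤ u} a k - κ (u - X)` for `u > X`, extended by zero. -/
noncomputable def discrepancy (a : ℕ → ℂ) (κ : ℂ) (X : ℕ) (u : ℝ) : ℂ :=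
  if (X : ℝ) < u then ∑ k ∈ Finset.Ioc X ⌊u⌋₊, a k - κ * (u - X) else 0

lemma measurable_discrepancy (a : ℕ → ℂ) (κ : ℂ) (X : ℕ) : Measurable (discrepancy a κ X) := by
  unfold discrepancy
  refine Measurable.ite measurableSet_Ioi ?_ measurable_const
  refine Measurable.sub ?_ (by fun_prop)
  exact (measurable_from_nat (f := fun n => ∑ k ∈ Finset.Ioc X n, a k)).comp Nat.measurable_floor

lemma norm_discrepancy_le {a : ℕ → ℂ} {κ : ℂ} {X : ℕ} {Q : ℝ} (hQ0 : 0 ≤ Q)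
    (hκ : ‖κ‖ ≤ 1)
    (hQ : ∀ n ≥ X, ‖∑ k ∈ Finset.Ioc X n, a k - κ * (n - X)‖ ≤ Q) (u : ℝ) :
    ‖discrepancy a κ X u‖ ≤ Q + 1 := by
  unfold discrepancy
  split_ifs with h
  · have h0 : (0 : ℝ) ≤ u := (Nat.cast_nonneg X).trans h.le
    have h1 : X ≤ ⌊u⌋₊ := Nat.le_floor h.le
    have h2 : ∑ k ∈ Finset.Ioc X ⌊u⌋₊, a k - κ * (u - X)
        = (∑ k ∈ Finset.Ioc X ⌊u⌋₊, a k - κ * (⌊u⌋₊ - X)) - κ * ((u - ⌊u⌋₊ : ℝ) : ℂ) := by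
      push_cast; ring
    rw [h2]
    refine (norm_sub_le _ _).trans (add_le_add (hQ _ h1) ?_)
    rw [norm_mul, Complex.norm_real, Real.norm_eq_abs, abs_of_nonneg
      (sub_nonneg.2 (Nat.floor_le h0))]
    have := Nat.lt_floor_add_one u
    calc ‖κ‖ * (u - ⌊u⌋₊) ≤ 1 * 1 := by
          gcongr
          · exact sub_nonneg.2 (Nat.floor_le h0)
          · linarith
      _ = 1 := by norm_num
  · simp; linarith

section
variable {a : ℕ → ℂ} {κ : ℂ} {X : ℕ} {Q : ℝ}

lemma locallyIntegrableOn_discrepancy (hQ0 : 0 ≤ Q) (hκ : ‖κ‖ ≤ 1)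
    (hQ : ∀ n ≥ X, ‖∑ k ∈ Finset.Ioc X n, a k - κ * (n - X)‖ ≤ Q) :
    LocallyIntegrableOn (discrepancy a κ X) (Ioi 0) := by
  apply LocallyIntegrable.locallyIntegrableOn
  refine (locallyIntegrable_const (Q + 1)).mono
    (measurable_discrepancy a κ X).aestronglyMeasurable ?_
  refine .of_forall fun u => ?_
  rw [Real.norm_eq_abs, abs_of_nonneg (by linarith)]
  exact norm_discrepancy_le hQ0 hκ hQ u

lemma discrepancy_isBigO_top (hQ0 : 0 ≤ Q) (hκ : ‖κ‖ ≤ 1)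
    (hQ : ∀ n ≥ X, ‖∑ k ∈ Finset.Ioc X n, a k - κ * (n - X)‖ ≤ Q) :
    discrepancy a κ X =O[atTop] (fun u : ℝ => u ^ (-(0 : ℝ))) := by
  refine Asymptotics.IsBigO.of_bound (Q + 1) (.of_forall fun u => ?_)
  simpa using norm_discrepancy_le hQ0 hκ hQ u

lemma discrepancy_isBigO_zero (hX : 1 ≤ X) (b : ℝ) :
    discrepancy a κ X =O[𝓝[>] 0] (fun u : ℝ => u ^ (-b)) := by
  refine (Asymptotics.isBigO_zero _ _).congr' ?_ .rfl
  have : Set.Iio (1 : ℝ) ∈ 𝓝[>] (0 : ℝ) := mem_nhdsWithin_of_mem_nhds (Iio_mem_nhds one_pos)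
  filter_upwards [this] with u hu
  have : ¬ ((X : ℝ) < u) := by
    have : (1 : ℝ) ≤ X := by exact_mod_cast hX
    simp only [Set.mem_Iio] at hu
    linarith
  simp [discrepancy, this]

lemma mellinConvergent_discrepancy (hX : 1 ≤ X) (hQ0 : 0 ≤ Q) (hκ : ‖κ‖ ≤ 1)
    (hQ : ∀ n ≥ X, ‖∑ k ∈ Finset.Ioc X n, a k - κ * (n - X)‖ ≤ Q) {s : ℂ} (hs : 0 < s.re) :
    MellinConvergent (discrepancy a κ X) (-s) :=
  mellinConvergent_of_isBigO_rpow (locallyIntegrableOn_discrepancy hQ0 hκ hQ)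
    (discrepancy_isBigO_top hQ0 hκ hQ) (by simpa using hs)
    (discrepancy_isBigO_zero hX (-s.re - 1)) (by simp)

lemma differentiableAt_mellin_discrepancy (hX : 1 ≤ X) (hQ0 : 0 ≤ Q) (hκ : ‖κ‖ ≤ 1)
    (hQ : ∀ n ≥ X, ‖∑ k ∈ Finset.Ioc X n, a k - κ * (n - X)‖ ≤ Q) {s : ℂ} (hs : 0 < s.re) :
    DifferentiableAt ℂ (fun s => mellin (discrepancy a κ X) (-s)) s := by
  have := mellin_differentiableAt_of_isBigO_rpow (s := -s)
    (locallyIntegrableOn_discrepancy hQ0 hκ hQ)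
    (discrepancy_isBigO_top hQ0 hκ hQ) (by simpa using hs)
    (discrepancy_isBigO_zero hX (-s.re - 1)) (by simp)
  exact this.comp s differentiableAt_id.neg

lemma mellin_discrepancy_eq (s : ℂ) :
    mellin (discrepancy a κ X) s
      = ∫ t in Ioi (X : ℝ), (t : ℂ) ^ (s - 1) * discrepancy a κ X t := by
  rw [mellin]
  simp only [smul_eq_mul]
  refine (setIntegral_eq_of_subset_of_forall_sdiff_eq_zero measurableSet_Ioi
    (Set.Ioi_subset_Ioi (Nat.cast_nonneg X)) ?_)
  rintro t ⟨-, ht⟩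
  have : ¬ ((X : ℝ) < t) := ht
  simp [discrepancy, this]

lemma norm_mellin_discrepancy_le (hX : 1 ≤ X) (hQ0 : 0 ≤ Q) (hκ : ‖κ‖ ≤ 1)
    (hQ : ∀ n ≥ X, ‖∑ k ∈ Finset.Ioc X n, a k - κ * (n - X)‖ ≤ Q) {s : ℂ} (hs : 0 < s.re) :
    ‖mellin (discrepancy a κ X) (-s)‖ ≤ (Q + 1) * ((X : ℝ) ^ (-s.re) / s.re) := by
  have hX' : (0 : ℝ) < X := by exact_mod_cast hX
  rw [mellin_discrepancy_eq]
  have hlt : -s.re - 1 < -1 := by linarith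
  calc _ ≤ ∫ t in Ioi (X : ℝ), (Q + 1) * t ^ (-s.re - 1) := by
        refine norm_integral_le_of_norm_le
          ((integrableOn_Ioi_rpow_of_lt hlt hX').const_mul _) ?_
        refine (ae_restrict_iff' measurableSet_Ioi).2 (.of_forall fun t ht => ?_)
        have ht0 : 0 < t := hX'.trans ht
        rw [norm_mul, Complex.norm_cpow_eq_rpow_re_of_pos ht0, mul_comm]
        have : (-s - 1 : ℂ).re = -s.re - 1 := by simp
        rw [this]
        gcongr
        exact norm_discrepancy_le hQ0 hκ hQ t
    _ = _ := by
        rw [integral_const_mul, integral_Ioi_rpow_of_lt hlt hX']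
        congr 1
        have : -s.re - 1 + 1 = -s.re := by ring
        rw [this, neg_div_neg_eq]

lemma LSeries_eq_sum_add_mellin (hX : 1 ≤ X) (hQ0 : 0 ≤ Q) (hκ : ‖κ‖ ≤ 1)
    (hQ : ∀ n ≥ X, ‖∑ k ∈ Finset.Ioc X n, a k - κ * (n - X)‖ ≤ Q) (ha : ∀ n, ‖a n‖ ≤ 1)
    {s : ℂ} (hs : 1 < s.re) :
    LSeries a s = ∑ n ∈ Finset.Icc 1 X, a n * (n : ℂ) ^ (-s) +
      κ * ((X : ℂ) ^ (1 - s) / (s - 1)) + s * mellin (discrepancy a κ X) (-s) := by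
  have hX' : (0 : ℝ) < X := by exact_mod_cast hX
  have hs0 : s ≠ 0 := by rintro rfl; simp at hs; linarith
  have hs1 : s - 1 ≠ 0 := by
    intro h; rw [sub_eq_zero] at h; rw [h] at hs; simp at hs
  set f : ℕ → ℂ := fun n => if X < n then a n else 0 with hf
  set g : ℕ → ℂ := fun n => if X < n then 0 else a n with hg
  have hfS : LSeriesSummable f s := by
    refine LSeriesSummable_of_bounded_of_one_lt_re (m := 1) (fun n _ => ?_) hs
    simp only [hf]; split_ifs
    · exact ha n
    · simp
  have hgS : LSeriesSummable g s := by
    refine LSeriesSummable_of_bounded_of_one_lt_re (m := 1) (fun n _ => ?_) hs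
    simp only [hg]; split_ifs
    · simp
    · exact ha n
  have hsplit : a = g + f := by
    ext n; simp only [hf, hg, Pi.add_apply]; split_ifs <;> simp
  have hgval : LSeries g s = ∑ n ∈ Finset.Icc 1 X, a n * (n : ℂ) ^ (-s) := by
    rw [LSeries, tsum_eq_sum (s := Finset.Icc 1 X)]
    · refine Finset.sum_congr rfl fun n hn => ?_
      rw [Finset.mem_Icc] at hn
      rw [LSeries.term_of_ne_zero (by lia), cpow_neg, div_eq_mul_inv]
      simp [hg, not_lt.2 hn.2]
    · intro n hn
      rcases Nat.eq_zero_or_pos n with rfl | h0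
      · simp
      · have : X < n := by
          simp only [Finset.mem_Icc, not_and, not_le] at hn; exact hn h0
        rw [LSeries.term_of_ne_zero h0.ne']
        simp [hg, this]
  have hsum : ∀ t : ℝ, (X : ℝ) < t →
      ∑ k ∈ Finset.Icc 1 ⌊t⌋₊, f k = discrepancy a κ X t + κ * (t - X) := by
    intro t ht
    simp only [discrepancy, ht, if_true, sub_add_cancel, hf]
    rw [← Finset.sum_filter]
    refine Finset.sum_congr ?_ fun _ _ => rfl
    ext k; simp only [Finset.mem_filter, Finset.mem_Icc, Finset.mem_Ioc]; lia
  have hsum0 : ∀ t : ℝ, t ≤ X → ∑ k ∈ Finset.Icc 1 ⌊t⌋₊, f k = 0 := by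
    intro t ht
    refine Finset.sum_eq_zero fun k hk => ?_
    have : ⌊t⌋₊ ≤ X := Nat.floor_le_of_le ht
    rw [Finset.mem_Icc] at hk
    simp [hf, not_lt.2 (hk.2.trans this)]
  have hfval : LSeries f s = κ * ((X : ℂ) ^ (1 - s) / (s - 1)) +
      s * mellin (discrepancy a κ X) (-s) := by
    rw [LSeries_eq_mul_integral f zero_le_one hs hfS]
    · have h1 : ∫ t in Ioi (1 : ℝ), (∑ k ∈ Finset.Icc 1 ⌊t⌋₊, f k) * (t : ℂ) ^ (-(s + 1))
          = ∫ t in Ioi (X : ℝ), ((t : ℂ) ^ (-s - 1) * discrepancy a κ X t +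
            κ * ((t : ℂ) ^ (-s) - X * (t : ℂ) ^ (-s - 1))) := by
        rw [setIntegral_eq_of_subset_of_forall_sdiff_eq_zero (s := Ioi (X : ℝ)) measurableSet_Ioi
          (Set.Ioi_subset_Ioi (by exact_mod_cast hX))]
        · refine setIntegral_congr_fun measurableSet_Ioi fun t ht => ?_
          rw [hsum t ht, neg_add']
          have ht0 : (t : ℂ) ≠ 0 := by exact_mod_cast (hX'.trans ht).ne'
          have : (t : ℂ) ^ (-s) = (t : ℂ) ^ (-s - 1) * t := by
            rw [cpow_sub _ _ ht0, cpow_one, div_mul_cancel₀ _ ht0]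
          rw [this]; ring
        · rintro t ⟨-, ht⟩
          rw [hsum0 t (not_lt.1 ht), zero_mul]
      have i1 : IntegrableOn (fun t : ℝ => (t : ℂ) ^ (-s)) (Ioi (X : ℝ)) :=
        integrableOn_Ioi_cpow_of_lt (by simpa using hs) hX'
      have i2 : IntegrableOn (fun t : ℝ => (t : ℂ) ^ (-s - 1)) (Ioi (X : ℝ)) :=
        integrableOn_Ioi_cpow_of_lt (by simp; linarith) hX'
      have i3 : IntegrableOn (fun t : ℝ => (t : ℂ) ^ (-s - 1) * discrepancy a κ X t)
          (Ioi (X : ℝ)) := by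
        have := mellinConvergent_discrepancy hX hQ0 hκ hQ (s := s) (by linarith)
        exact IntegrableOn.mono_set this (Set.Ioi_subset_Ioi hX'.le)
      have i4 : IntegrableOn (fun t : ℝ => (X : ℂ) * (t : ℂ) ^ (-s - 1)) (Ioi (X : ℝ)) :=
        i2.const_mul _
      have i5 : IntegrableOn (fun t : ℝ => κ * ((t : ℂ) ^ (-s) - X * (t : ℂ) ^ (-s - 1)))
          (Ioi (X : ℝ)) := (i1.sub i4).const_mul _
      rw [h1, integral_add i3 i5, integral_const_mul,
        integral_sub i1 i4, integral_const_mul, ← mellin_discrepancy_eq,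
        integral_Ioi_cpow_of_lt (by simpa using hs) hX',
        integral_Ioi_cpow_of_lt (by simp; linarith) hX']
      have e1 : -s - 1 + 1 = -s := by ring
      have e2 : -s + 1 = -(s - 1) := by ring
      have e3 : ((X : ℝ) : ℂ) ^ (-(s - 1)) = (X : ℂ) * (X : ℂ) ^ (-s) := by
        have : ((X : ℕ) : ℂ) ≠ 0 := by exact_mod_cast hX'.ne'
        rw [neg_sub, sub_eq_add_neg, ofReal_natCast, cpow_add _ _ this, cpow_one]
      have e4 : (X : ℂ) ^ (1 - s) = (X : ℂ) * (X : ℂ) ^ (-s) := by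
        rw [← e3, neg_sub, ofReal_natCast]
      rw [e1, e2, e3, e4, ofReal_natCast]
      field_simp
      ring
    · refine Asymptotics.IsBigO.of_bound 1 (.of_forall fun n => ?_)
      rw [Real.rpow_one, one_mul, RCLike.norm_natCast]
      calc _ ≤ ∑ k ∈ Finset.Icc 1 n, ‖f k‖ := norm_sum_le _ _
        _ ≤ ∑ k ∈ Finset.Icc 1 n, (1 : ℝ) := by
            refine Finset.sum_le_sum fun k _ => ?_
            simp only [hf]; split_ifs
            · exact ha k
            · simp
        _ = n := by simp
  conv_lhs => rw [hsplit]
  rw [LSeries_add hgS hfS, hgval, hfval]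
  ring

end

end

section

open Complex Filter Topology MeasureTheory Set

lemma sum_rpow_sub_one_le {ε : ℝ} (hε : 0 < ε) (hε1 : ε ≤ 1) (X : ℕ) :
    ∑ n ∈ Finset.Icc 1 X, (n : ℝ) ^ (ε - 1) ≤ (X : ℝ) ^ ε / ε := by
  induction X with
  | zero => simp; positivity
  | succ X ih =>
    rw [Finset.sum_Icc_succ_top (by lia)]
    have hy : (0 : ℝ) < ((X + 1 : ℕ) : ℝ) := by positivity
    have key : (X : ℝ) ^ ε ≤ ((X + 1 : ℕ) : ℝ) ^ ε - ε * ((X + 1 : ℕ) : ℝ) ^ (ε - 1) := by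
      set y : ℝ := ((X + 1 : ℕ) : ℝ) with hyd
      have hX : (X : ℝ) = y * (1 + -(1 / y)) := by
        rw [mul_add, mul_neg, mul_one_div_cancel hy.ne']; rw [hyd]; push_cast; ring
      have h1y : 1 / y ≤ 1 := by
        rw [div_le_one hy, hyd]; push_cast; linarith [(Nat.cast_nonneg X : (0 : ℝ) ≤ X)]
      rw [hX, Real.mul_rpow hy.le (by linarith), Real.rpow_sub_one hy.ne']
      have := rpow_one_add_le_one_add_mul_self (s := -(1 / y)) (by linarith) hε.le hε1
      calc y ^ ε * (1 + -(1 / y)) ^ ε ≤ y ^ ε * (1 + ε * -(1 / y)) := by gcongr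
        _ = _ := by ring
    rw [le_div_iff₀ hε] at ih ⊢
    linarith [add_mul (∑ n ∈ Finset.Icc 1 X, (n : ℝ) ^ (ε - 1)) (((X + 1 : ℕ) : ℝ) ^ (ε - 1)) ε]

section
variable {a : ℕ → ℂ} {κ : ℂ} {Q : ℝ} {F p r : ℂ → ℂ}

lemma continuation_eq_sum_add_mellin {X : ℕ} (hX : 1 ≤ X) (hQ0 : 0 ≤ Q) (hκ : ‖κ‖ ≤ 1)
    (hQ : ∀ n ≥ X, ‖∑ k ∈ Finset.Ioc X n, a k - κ * (n - X)‖ ≤ Q) (ha : ∀ n, ‖a n‖ ≤ 1)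
    (hF : Differentiable ℂ F) (hp : Differentiable ℂ p) (hr : Differentiable ℂ r)
    (hFp : ∀ s : ℂ, 1 < s.re → F s = p s * LSeries a s)
    (hpr : ∀ s, κ * p s = r s * (s - 1)) {s : ℂ} (hs : 0 < s.re) :
    F s = p s * ∑ n ∈ Finset.Icc 1 X, a n * (n : ℂ) ^ (-s) + r s * (X : ℂ) ^ (1 - s)
      + p s * (s * mellin (discrepancy a κ X) (-s)) := by
  have hX' : (X : ℂ) ≠ 0 := by exact_mod_cast (by lia : X ≠ 0)
  set G : ℂ → ℂ := fun s => p s * ∑ n ∈ Finset.Icc 1 X, a n * (n : ℂ) ^ (-s)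
      + r s * (X : ℂ) ^ (1 - s) + p s * (s * mellin (discrepancy a κ X) (-s)) with hG
  have hopen : IsOpen {s : ℂ | 0 < s.re} := isOpen_lt continuous_const continuous_re
  have hconv : Convex ℝ {s : ℂ | 0 < s.re} := convex_halfSpace_re_gt 0
  have hGd : DifferentiableOn ℂ G {s : ℂ | 0 < s.re} := by
    intro z hz
    refine DifferentiableAt.differentiableWithinAt ?_
    have h1 : DifferentiableAt ℂ (fun s : ℂ => ∑ n ∈ Finset.Icc 1 X, a n * (n : ℂ) ^ (-s)) z := by
      refine DifferentiableAt.fun_sum fun n hn => ?_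
      rw [Finset.mem_Icc] at hn
      refine (DifferentiableAt.const_cpow (by fun_prop) (Or.inl ?_)).const_mul _
      exact_mod_cast (by lia : n ≠ 0)
    have h2 : DifferentiableAt ℂ (fun s : ℂ => (X : ℂ) ^ (1 - s)) z :=
      DifferentiableAt.const_cpow (by fun_prop) (Or.inl hX')
    have h3 := differentiableAt_mellin_discrepancy hX hQ0 hκ hQ hz
    exact (((hp z).mul h1).add ((hr z).mul h2)).add ((hp z).mul (differentiableAt_id.mul h3))
  have heq : EqOn F G {s : ℂ | 0 < s.re} := by
    refine AnalyticOnNhd.eqOn_of_preconnected_of_eventuallyEq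
      (hF.differentiableOn.analyticOnNhd hopen) (hGd.analyticOnNhd hopen)
      hconv.isPreconnected (z₀ := 2) (by simp) ?_
    have : {s : ℂ | 1 < s.re} ∈ 𝓝 (2 : ℂ) :=
      (isOpen_lt continuous_const continuous_re).mem_nhds (by simp)
    filter_upwards [this] with z hz
    have hz1 : z - 1 ≠ 0 := by
      intro h; rw [sub_eq_zero] at h; rw [h] at hz; simp at hz
    rw [hFp z hz, LSeries_eq_sum_add_mellin hX hQ0 hκ hQ ha hz]
    have : p z * (κ * ((X : ℂ) ^ (1 - z) / (z - 1))) = r z * (X : ℂ) ^ (1 - z) := by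
      calc _ = (κ * p z) * ((X : ℂ) ^ (1 - z) / (z - 1)) := by ring
        _ = _ := by rw [hpr]; field_simp
    simp only [hG]; rw [← this]; ring
  exact heq hs

lemma norm_continuation_le {ε : ℝ} (hε : 0 < ε) (hε1 : ε ≤ 1 / 2) (hQ1 : 1 ≤ Q) (hκ : ‖κ‖ ≤ 1)
    (hQ : ∀ X n : ℕ, X ≤ n → ‖∑ k ∈ Finset.Ioc X n, a k - κ * (n - X)‖ ≤ Q)
    (ha : ∀ n, ‖a n‖ ≤ 1)
    (hF : Differentiable ℂ F) (hp : Differentiable ℂ p) (hr : Differentiable ℂ r)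
    (hFp : ∀ s : ℂ, 1 < s.re → F s = p s * LSeries a s)
    (hpr : ∀ s, κ * p s = r s * (s - 1)) {s : ℂ} (hs : 1 - ε ≤ s.re) :
    ‖F s‖ ≤ 2 * (1 / ε + 4) * (‖p s‖ + ‖r s‖) * (Q * (‖s‖ + 2)) ^ ε := by
  set T : ℝ := Q * (‖s‖ + 2) with hT
  have hT2 : 2 ≤ T := by nlinarith [norm_nonneg s]
  set X : ℕ := ⌈T⌉₊ with hXdef
  have hTX : T ≤ X := Nat.le_ceil T
  have hXT : (X : ℝ) ≤ 2 * T := by linarith [Nat.ceil_lt_add_one (show 0 ≤ T by linarith)]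
  have hX1 : (1 : ℝ) ≤ X := by linarith
  have hX : 1 ≤ X := by exact_mod_cast hX1
  have hX0 : (0 : ℝ) < X := by linarith
  have hσ : 0 < s.re := by linarith
  rw [continuation_eq_sum_add_mellin hX (by linarith) hκ (fun n hn => hQ X n hn) ha hF hp hr
    hFp hpr hσ]
  have b1 : ‖∑ n ∈ Finset.Icc 1 X, a n * (n : ℂ) ^ (-s)‖ ≤ (X : ℝ) ^ ε / ε := by
    refine (norm_sum_le _ _).trans (le_trans ?_ (sum_rpow_sub_one_le hε (by linarith) X))
    refine Finset.sum_le_sum fun n hn => ?_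
    rw [Finset.mem_Icc] at hn
    have hn1 : (1 : ℝ) ≤ n := by exact_mod_cast hn.1
    rw [norm_mul, norm_natCast_cpow_of_pos (by lia)]
    calc _ ≤ 1 * (n : ℝ) ^ (-s).re := by gcongr; exact ha n
      _ ≤ (n : ℝ) ^ (ε - 1) := by
        rw [one_mul]
        exact Real.rpow_le_rpow_of_exponent_le hn1 (by simp; linarith)
  have b2 : ‖(X : ℂ) ^ (1 - s)‖ ≤ (X : ℝ) ^ ε := by
    rw [norm_natCast_cpow_of_pos (by lia)]
    exact Real.rpow_le_rpow_of_exponent_le hX1 (by simp; linarith)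
  have b3 : ‖s * mellin (discrepancy a κ X) (-s)‖ ≤ 4 * (X : ℝ) ^ ε := by
    have h := norm_mellin_discrepancy_le hX (by linarith) hκ (fun n hn => hQ X n hn) hσ
    have h2 : (X : ℝ) ^ (-s.re) / s.re ≤ 2 * ((X : ℝ) ^ ε / X) := by
      rw [← Real.rpow_sub_one hX0.ne', div_le_iff₀ hσ]
      have h3 : (X : ℝ) ^ (-s.re) ≤ (X : ℝ) ^ (ε - 1) :=
        Real.rpow_le_rpow_of_exponent_le hX1 (by linarith)
      have h4 : 0 ≤ (X : ℝ) ^ (ε - 1) := by positivity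
      nlinarith
    rw [norm_mul]
    calc _ ≤ ‖s‖ * ((Q + 1) * (2 * ((X : ℝ) ^ ε / X))) := by
          gcongr
          exact h.trans (by gcongr)
      _ ≤ (‖s‖ + 2) * ((Q + Q) * (2 * ((X : ℝ) ^ ε / X))) := by
          gcongr; linarith
      _ = 4 * T * ((X : ℝ) ^ ε / X) := by rw [hT]; ring
      _ ≤ 4 * X * ((X : ℝ) ^ ε / X) := by gcongr
      _ = _ := by field_simp
  have b4 : (X : ℝ) ^ ε ≤ 2 * T ^ ε := by
    calc (X : ℝ) ^ ε ≤ (2 * T) ^ ε := by gcongr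
      _ = 2 ^ ε * T ^ ε := Real.mul_rpow (by norm_num) (by linarith)
      _ ≤ 2 * T ^ ε := by
        gcongr
        calc (2 : ℝ) ^ ε ≤ 2 ^ (1 : ℝ) := by
              apply Real.rpow_le_rpow_of_exponent_le <;> linarith
          _ = 2 := by norm_num
  have hε' : 0 < 1 / ε := by positivity
  have hXε : 0 ≤ (X : ℝ) ^ ε := by positivity
  calc _ ≤ ‖p s‖ * ((X : ℝ) ^ ε / ε) + ‖r s‖ * (X : ℝ) ^ ε + ‖p s‖ * (4 * (X : ℝ) ^ ε) := by
        refine (norm_add₃_le).trans ?_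
        rw [norm_mul, norm_mul (r s), norm_mul (p s)]
        gcongr
    _ = (‖p s‖ * (1 / ε + 4) + ‖r s‖ * 1) * (X : ℝ) ^ ε := by ring
    _ ≤ (‖p s‖ * (1 / ε + 4) + ‖r s‖ * (1 / ε + 4)) * (2 * T ^ ε) := by
        gcongr; linarith
    _ = _ := by ring

end

lemma norm_sum_Ioc_sub_mean_le {N : ℕ} [NeZero N] (Φ : ZMod N → ℂ) (hΦ : ∀ j, ‖Φ j‖ ≤ 1)
    {X n : ℕ} (hn : X ≤ n) :
    ‖∑ k ∈ Finset.Ioc X n, Φ k - (∑ j, Φ j) / N * (n - X)‖ ≤ 2 * N := by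
  have hN : (0 : ℝ) < N := by exact_mod_cast Nat.pos_of_ne_zero (NeZero.ne N)
  have hNc : (N : ℂ) ≠ 0 := by exact_mod_cast NeZero.ne N
  have hmean : ‖(∑ j, Φ j) / N‖ ≤ 1 := by
    rw [norm_div, RCLike.norm_natCast, div_le_one hN]
    calc _ ≤ ∑ j : ZMod N, ‖Φ j‖ := norm_sum_le _ _
      _ ≤ ∑ j : ZMod N, (1 : ℝ) := Finset.sum_le_sum fun j _ => hΦ j
      _ = N := by simp [ZMod.card]
  set κ := (∑ j, Φ j) / N with hκ
  have hper : ∀ X : ℕ, ∑ i ∈ Finset.range N, (Φ ((X + 1 + i : ℕ) : ZMod N) - κ) = 0 := by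
    intro X
    rw [Finset.sum_sub_distrib, Finset.sum_const, Finset.card_range, nsmul_eq_mul, hκ,
      mul_div_cancel₀ _ hNc, sub_eq_zero]
    refine Finset.sum_bij (fun i _ => ((X + 1 + i : ℕ) : ZMod N)) (by simp) ?_ ?_ (by simp)
    · intro i hi j hj h
      simp only [Finset.mem_range] at hi hj
      rw [ZMod.natCast_eq_natCast_iff] at h
      have := Nat.ModEq.add_left_cancel' _ h
      rwa [Nat.ModEq, Nat.mod_eq_of_lt hi, Nat.mod_eq_of_lt hj] at this
    · intro b _
      refine ⟨(b - ((X + 1 : ℕ) : ZMod N)).val, by simpa using ZMod.val_lt _, ?_⟩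
      push_cast
      rw [ZMod.natCast_zmod_val]; ring
  have main : ∀ m X : ℕ, ‖∑ i ∈ Finset.range m, (Φ ((X + 1 + i : ℕ) : ZMod N) - κ)‖ ≤ 2 * N := by
    intro m
    induction m using Nat.strong_induction_on with
    | _ m ih =>
      intro X
      rcases lt_or_ge m N with hm | hm
      · calc _ ≤ ∑ i ∈ Finset.range m, ‖Φ ((X + 1 + i : ℕ) : ZMod N) - κ‖ := norm_sum_le _ _
          _ ≤ ∑ i ∈ Finset.range m, (2 : ℝ) := by
              refine Finset.sum_le_sum fun i _ => (norm_sub_le _ _).trans ?_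
              linarith [hΦ ((X + 1 + i : ℕ) : ZMod N)]
          _ = 2 * m := by simp [mul_comm]
          _ ≤ 2 * N := by gcongr
      · obtain ⟨d, rfl⟩ := Nat.exists_eq_add_of_le hm
        rw [Finset.sum_range_add, hper, zero_add]
        have := ih d (by have := NeZero.pos N; lia) (X + N)
        convert this using 5
        congr 1; ring
  obtain ⟨d, rfl⟩ := Nat.exists_eq_add_of_le hn
  have : ∑ k ∈ Finset.Ioc X (X + d), Φ k - κ * (((X + d : ℕ) : ℂ) - X)
      = ∑ i ∈ Finset.range d, (Φ ((X + 1 + i : ℕ) : ZMod N) - κ) := by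
    rw [Finset.sum_sub_distrib, Finset.sum_const, Finset.card_range, nsmul_eq_mul]
    congr 1
    · rw [← Finset.Ico_add_one_add_one_eq_Ioc, Finset.sum_Ico_eq_sum_range]
      congr 2; lia
    · push_cast; ring
  rw [this]
  exact main d X

open DirichletCharacter in
theorem exists_norm_LFunction_le {ε : ℝ} (hε : 0 < ε) (hε1 : ε ≤ 1 / 2) :
    ∃ C : ℝ, 0 < C ∧ ∀ (q : ℕ) [NeZero q] (χ : DirichletCharacter ℂ q), χ ≠ 1 →
      ∀ s : ℂ, 1 - ε ≤ s.re → ‖LFunction χ s‖ ≤ C * (q * (‖s‖ + 2)) ^ ε := by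
  refine ⟨2 * (1 / ε + 4) * 2, by positivity, fun q _ χ hχ s hs => ?_⟩
  have hq : (1 : ℝ) ≤ q := by exact_mod_cast NeZero.one_le
  have h := norm_continuation_le (a := fun n => χ n) (κ := 0) (Q := 2 * q) (F := LFunction χ)
    (p := fun _ => 1) (r := fun _ => 0) hε hε1 (by linarith) (by simp) (fun X n hn => by
      have := norm_sum_Ioc_sub_mean_le (fun j => χ j) (fun j => χ.norm_le_one j) hn
      rwa [χ.sum_eq_zero_of_ne_one hχ, zero_div] at this)
    (fun n => χ.norm_le_one n) (differentiable_LFunction hχ) (by fun_prop) (by fun_prop)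
    (fun s hs => by rw [LFunction_eq_LSeries _ hs, one_mul]) (by simp) hs
  refine h.trans ?_
  simp only [norm_one, norm_zero, add_zero, mul_one]
  rw [mul_assoc (2 : ℝ) (q : ℝ), Real.mul_rpow (by norm_num) (by positivity), ← mul_assoc]
  gcongr
  calc (2 : ℝ) ^ ε ≤ 2 ^ (1 : ℝ) := by
        apply Real.rpow_le_rpow_of_exponent_le <;> linarith
    _ = 2 := by norm_num

open DirichletCharacter in
theorem exists_norm_LFunctionTrivChar₁_le {ε : ℝ} (hε : 0 < ε) (hε1 : ε ≤ 1 / 2) :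
    ∃ C : ℝ, 0 < C ∧ ∀ (q : ℕ) [NeZero q],
      ∀ s : ℂ, 1 - ε ≤ s.re →
        ‖LFunctionTrivChar₁ q s‖ ≤ C * (‖s - 1‖ + 1) * (q * (‖s‖ + 2)) ^ ε := by
  refine ⟨2 * (1 / ε + 4) * 2, by positivity, fun q _ s hs => ?_⟩
  have hq : (1 : ℝ) ≤ q := by exact_mod_cast NeZero.one_le
  set κ : ℂ := (∑ j : ZMod q, (1 : DirichletCharacter ℂ q) j) / q with hκ
  have hκ1 : ‖κ‖ ≤ 1 := by
    rw [hκ, norm_div, RCLike.norm_natCast, div_le_one (by linarith)]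
    calc _ ≤ ∑ j : ZMod q, ‖(1 : DirichletCharacter ℂ q) j‖ := norm_sum_le _ _
      _ ≤ ∑ j : ZMod q, (1 : ℝ) := Finset.sum_le_sum fun j _ => DirichletCharacter.norm_le_one _ j
      _ = q := by simp [ZMod.card]
  have h := norm_continuation_le (a := fun n => (1 : DirichletCharacter ℂ q) n) (κ := κ)
    (Q := 2 * q) (F := LFunctionTrivChar₁ q)
    (p := fun s => s - 1) (r := fun _ => κ) hε hε1 (by linarith) hκ1 (fun X n hn =>
      norm_sum_Ioc_sub_mean_le (fun j => (1 : DirichletCharacter ℂ q) j)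
        (fun j => DirichletCharacter.norm_le_one _ j) hn)
    (fun n => DirichletCharacter.norm_le_one (1 : DirichletCharacter ℂ q) (n : ZMod q))
          (differentiable_LFunctionTrivChar₁ q)
    (by fun_prop) (by fun_prop)
    (fun s hs => by
      have hs1 : s ≠ 1 := by rintro rfl; simp at hs
      rw [LFunctionTrivChar₁, Function.update_of_ne hs1, LFunctionTrivChar,
        LFunction_eq_LSeries _ hs]) (by simp) hs
  refine h.trans ?_
  calc _ ≤ 2 * (1 / ε + 4) * (‖s - 1‖ + 1) * (2 * (q * (‖s‖ + 2)) ^ ε) := by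
        rw [mul_assoc (2 : ℝ) (q : ℝ), Real.mul_rpow (by norm_num) (by positivity)]
        gcongr
        calc (2 : ℝ) ^ ε ≤ 2 ^ (1 : ℝ) := by
              apply Real.rpow_le_rpow_of_exponent_le <;> linarith
          _ = 2 := by norm_num
    _ = _ := by ring

end

section

open Complex Filter Topology MeasureTheory Set Metric
open scoped ComplexOrder

lemma iteratedDeriv_inv_sub_one_two (m : ℕ) :
    iteratedDeriv m (fun s : ℂ => (s - 1)⁻¹) 2 = (-1) ^ m * m.factorial := by
  have := congrFun (iter_deriv_inv_linear_sub m (1 : ℂ) 1) 2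
  simp only [one_mul, one_pow, mul_one] at this
  rw [iteratedDeriv_eq_iterate, this]
  norm_num

/-- Estermann's lower bound for a Dirichlet series with nonnegative coefficients and a simple
pole at `1`, just to the left of the pole. -/
theorem estermann_inequality {a : ℕ → ℂ} {F : ℂ → ℂ} {B : ℝ} (ha : 0 ≤ a) (ha1 : a 1 = 1)
    (hsum : LSeries.abscissaOfAbsConv a < (2 : ℂ).re) (hF : Differentiable ℂ F)
    (hFa : ∀ s : ℂ, 1 < s.re → F s = (s - 1) * LSeries a s)
    (hB : 1 ≤ B) (hFB : ∀ s : ℂ, ‖s - 2‖ ≤ 3 / 2 → ‖F s‖ ≤ B)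
    {α : ℝ} (hα : 7 / 8 ≤ α) (hα1 : α < 1) :
    1 / 2 - 8 * ‖F 1‖ * (32 * B) ^ (4 * (1 - α)) / (1 - α) ≤ (F α / (α - 1)).re := by
  set G : ℂ → ℂ := dslope F 1 with hG
  have hGd : Differentiable ℂ G := by
    rw [← differentiableOn_univ] at hF ⊢
    exact (differentiableOn_dslope univ_mem).2 hF
  have hGs : ∀ s : ℂ, s ≠ 1 → G s = (s - 1)⁻¹ * F s - F 1 * (s - 1)⁻¹ := by
    intro s hs
    rw [hG, dslope_of_ne _ hs, slope_def_field]; ring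
  set g : ℕ → ℂ := fun m => (m.factorial : ℂ)⁻¹ * ((-1) ^ m * iteratedDeriv m G 2) with hg
  set b : ℕ → ℂ := fun m => (m.factorial : ℂ)⁻¹ * ((-1) ^ m * iteratedDeriv m (LSeries a) 2) with hb
  have hb0 : ∀ m, 0 ≤ (b m).re := by
    intro m
    have h1 : (0 : ℂ) ≤ (-1) ^ m * iteratedDeriv m (LSeries a) ((2 : ℝ) : ℂ) :=
      LSeries.iteratedDeriv_alternating ha (by simpa using hsum) m
    have h2 : (0 : ℂ) ≤ (m.factorial : ℂ)⁻¹ := by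
      rw [← ofReal_natCast, ← ofReal_inv]; exact_mod_cast by positivity
    have := (Complex.le_def.1 (mul_nonneg h2 h1)).1
    rwa [zero_re, ofReal_ofNat] at this
  have hb1 : 1 ≤ (b 0).re := by
    have hs : LSeriesSummable a 2 := LSeriesSummable_of_abscissaOfAbsConv_lt_re hsum
    have h2 : a 1 ≤ LSeries a ((2 : ℝ) : ℂ) := by
      have := (show Summable (LSeries.term a ((2 : ℝ) : ℂ)) by rwa [ofReal_ofNat]).le_tsum 1
        (fun n _ => LSeries.term_nonneg (ha n) 2)
      rwa [LSeries.term_of_ne_zero one_ne_zero, Nat.cast_one, one_cpow, div_one] at this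
    simpa [hb, ha1] using (Complex.le_def.1 h2).1
  have hgb : ∀ m, g m = b m - F 1 := by
    intro m
    have hev : G =ᶠ[𝓝 2] fun s => LSeries a s - F 1 * (s - 1)⁻¹ := by
      have : {s : ℂ | 1 < s.re} ∈ 𝓝 (2 : ℂ) :=
        (isOpen_lt continuous_const continuous_re).mem_nhds (by simp)
      filter_upwards [this] with z hz
      have hz1 : z ≠ 1 := by rintro rfl; simp at hz
      rw [hGs z hz1, hFa z hz, inv_mul_cancel_left₀ (sub_ne_zero.2 hz1)]
    have e1 : ContDiffAt ℂ m (LSeries a) 2 :=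
      (LSeries_analyticOnNhd a 2 hsum).contDiffAt
    have e2 : ContDiffAt ℂ m (fun s : ℂ => (s - 1)⁻¹) 2 := by
      refine ContDiffAt.inv (by fun_prop) (by norm_num)
    have e3 : iteratedDeriv m G 2 = iteratedDeriv m (LSeries a) 2 -
          F 1 * ((-1) ^ m * m.factorial) := by
      rw [hev.iteratedDeriv_eq, iteratedDeriv_fun_sub e1 (contDiffAt_const.mul e2),
        iteratedDeriv_const_mul_field, iteratedDeriv_inv_sub_one_two]
    have e4 : ((-1 : ℂ) ^ m) * (-1) ^ m = 1 := by rw [← mul_pow]; simp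
    have e5 : (m.factorial : ℂ) ≠ 0 := by exact_mod_cast m.factorial_ne_zero
    simp only [hg, hb, e3]
    rw [mul_sub, mul_sub]
    congr 1
    calc _ = ((m.factorial : ℂ)⁻¹ * m.factorial) * ((-1) ^ m * (-1) ^ m) * F 1 := by ring
      _ = _ := by rw [e4, inv_mul_cancel₀ e5]; ring
  have hgbound : ∀ m, ‖g m‖ ≤ 4 * B * (2 / 3) ^ m := by
    intro m
    have hsph : ∀ z ∈ sphere (2 : ℂ) (3 / 2), ‖G z‖ ≤ 4 * B := by
      intro z hz
      have hz' : ‖z - 2‖ = 3 / 2 := by simpa [dist_eq_norm] using hz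
      have hz1 : 1 / 2 ≤ ‖z - 1‖ := by
        have h := norm_sub_le (z - 1) 1
        have e : z - 1 - 1 = z - 2 := by ring
        rw [e, hz', norm_one] at h; linarith
      have hzne : z ≠ 1 := by rintro rfl; norm_num at hz1
      have h1 := hFB z hz'.le
      have h2 := hFB 1 (by norm_num)
      have h3 : ‖(z - 1)⁻¹‖ ≤ 2 := by
        rw [norm_inv]; exact inv_le_of_inv_le₀ (by norm_num) (by linarith)
      rw [hGs z hzne]
      calc _ ≤ ‖(z - 1)⁻¹‖ * ‖F z‖ + ‖F 1‖ * ‖(z - 1)⁻¹‖ := by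
            refine (norm_sub_le _ _).trans ?_; rw [norm_mul, norm_mul]
        _ ≤ 2 * B + B * 2 := by gcongr
        _ = _ := by ring
    have := norm_iteratedDeriv_le_of_forall_mem_sphere_norm_le m (by norm_num : (0 : ℝ) < 3 / 2)
      hGd.diffContOnCl hsph
    have hfac : (0 : ℝ) < m.factorial := by exact_mod_cast m.factorial_pos
    simp only [hg]
    rw [norm_mul, norm_mul, norm_pow, norm_neg, norm_one, one_pow, one_mul, norm_inv,
      RCLike.norm_natCast, inv_mul_le_iff₀ hfac]
    refine this.trans (le_of_eq ?_)
    have e : (2 / 3 : ℝ) = (3 / 2)⁻¹ := by norm_num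
    rw [e, inv_pow, div_eq_mul_inv, mul_assoc]
  have hsumG : HasSum (fun m => g m * (2 - α : ℝ) ^ m) (G α) := by
    have := hasSum_taylorSeries_of_entire hGd 2 (α : ℂ)
    have he : (fun m => g m * ((2 - α : ℝ) : ℂ) ^ m) = fun n : ℕ =>
        (n.factorial : ℂ)⁻¹ • ((α : ℂ) - 2) ^ n • iteratedDeriv n G 2 := by
      ext m
      simp only [hg, smul_eq_mul]
      have : (α : ℂ) - 2 = -1 * (2 - α : ℝ) := by push_cast; ring
      rw [this, mul_pow]; ring
    rwa [he]

  obtain ⟨M, hM1, hM2⟩ : ∃ M : ℕ, 16 * B * (3 / 4) ^ M ≤ 1 / 2 ∧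
      (M : ℝ) ≤ Real.log (32 * B) / Real.log (4 / 3) + 1 := by
    have hlog : 0 < Real.log (4 / 3) := Real.log_pos (by norm_num)
    have hlogB : 0 ≤ Real.log (32 * B) := Real.log_nonneg (by linarith)
    refine ⟨⌈Real.log (32 * B) / Real.log (4 / 3)⌉₊, ?_, (Nat.ceil_lt_add_one (by positivity)).le⟩
    have h1 := Nat.le_ceil (Real.log (32 * B) / Real.log (4 / 3))
    set K := ⌈Real.log (32 * B) / Real.log (4 / 3)⌉₊
    rw [div_le_iff₀ hlog, ← Real.log_pow, Real.log_le_log_iff (by linarith) (by positivity)] at h1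
    have h2 : ((3 : ℝ) / 4) ^ K * (4 / 3) ^ K = 1 := by rw [← mul_pow]; norm_num
    have h3 : (0 : ℝ) < (3 / 4) ^ K := by positivity
    nlinarith
  have hα0 : 0 < 1 - α := by linarith
  set u : ℝ := 2 - α with hu
  have hu1 : 1 < u := by linarith
  have hu98 : u ≤ 9 / 8 := by linarith
  have htail : ‖∑' m, g (m + M) * (u : ℂ) ^ (m + M)‖ ≤ 1 / 2 := by
    have hs : HasSum (fun m : ℕ => 4 * B * (3 / 4 : ℝ) ^ M * (3 / 4 : ℝ) ^ m)
        (4 * B * (3 / 4) ^ M * (1 - 3 / 4)⁻¹) :=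
      (hasSum_geometric_of_lt_one (by norm_num) (by norm_num)).mul_left _
    refine (tsum_of_norm_bounded hs fun m => ?_).trans ?_
    · rw [norm_mul, norm_pow, Complex.norm_real, Real.norm_eq_abs, abs_of_pos (by linarith)]
      calc _ ≤ 4 * B * (2 / 3) ^ (m + M) * (9 / 8) ^ (m + M) := by
            gcongr; exact hgbound _
        _ = 4 * B * (3 / 4) ^ (m + M) := by rw [mul_assoc, ← mul_pow]; norm_num
        _ = _ := by ring
    · norm_num; linarith
  have hkey : F α / (α - 1) = ∑ m ∈ Finset.range M, b m * (u : ℂ) ^ m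
      - F 1 * ((u : ℂ) ^ M / (1 - α)) + ∑' m, g (m + M) * (u : ℂ) ^ (m + M) := by
    have h1 := hsumG.summable.sum_add_tsum_nat_add M
    rw [hsumG.tsum_eq] at h1
    have hα1' : (α : ℂ) ≠ 1 := by exact_mod_cast hα1.ne
    rw [hGs α hα1'] at h1
    have h2 : ∑ m ∈ Finset.range M, g m * (u : ℂ) ^ m = ∑ m ∈ Finset.range M, b m * (u : ℂ) ^ m
        - F 1 * (((u : ℂ) ^ M - 1) / (1 - α)) := by
      have h3 := geom_sum_eq (x := (u : ℂ)) (by exact_mod_cast hu1.ne') M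
      have h4 : (u : ℂ) - 1 = 1 - α := by rw [hu]; push_cast; ring
      rw [h4] at h3
      rw [← h3, Finset.mul_sum, ← Finset.sum_sub_distrib]
      refine Finset.sum_congr rfl fun m _ => ?_
      rw [hgb]; ring
    rw [h2] at h1
    have h5 : (α : ℂ) - 1 ≠ 0 := sub_ne_zero.2 hα1'
    have h6 : (1 : ℂ) - α ≠ 0 := sub_ne_zero.2 hα1'.symm
    have h7 : F α / (α - 1) = ((α : ℂ) - 1)⁻¹ * F α := by ring
    rw [h7]
    have h8 : ((α : ℂ) - 1)⁻¹ = -(1 - (α : ℂ))⁻¹ := by rw [← inv_neg, neg_sub]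
    have h9 := h1.symm
    rw [sub_eq_iff_eq_add] at h9
    rw [h9, h8]; ring
  have huM : u ^ M ≤ 8 * (32 * B) ^ (4 * (1 - α)) := by
    have hlog : 1 / 4 ≤ Real.log (4 / 3) := by
      have := Real.one_sub_inv_le_log_of_pos (show (0 : ℝ) < 4 / 3 by norm_num)
      norm_num at this ⊢; linarith
    have hlogB : 0 ≤ Real.log (32 * B) := Real.log_nonneg (by linarith)
    have h1 : (M : ℝ) ≤ 4 * Real.log (32 * B) + 1 := by
      refine hM2.trans ?_
      gcongr
      rw [div_le_iff₀ (by linarith)]; nlinarith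
    calc u ^ M ≤ (Real.exp (1 - α)) ^ M := by
          gcongr; linarith [Real.add_one_le_exp (1 - α)]
      _ = Real.exp (M * (1 - α)) := by rw [← Real.exp_nat_mul]
      _ ≤ Real.exp ((4 * Real.log (32 * B) + 1) * (1 - α)) := by gcongr
      _ = Real.exp (1 - α) * Real.exp (Real.log (32 * B) * (4 * (1 - α))) := by
          rw [← Real.exp_add]; ring_nf
      _ = Real.exp (1 - α) * (32 * B) ^ (4 * (1 - α)) := by
          rw [Real.rpow_def_of_pos (by linarith)]
      _ ≤ _ := by
          gcongr
          calc Real.exp (1 - α) ≤ Real.exp 1 := by gcongr; linarith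
            _ ≤ 8 := by linarith [Real.exp_one_lt_d9]
  have hsumb : 1 / 1 ≤ (∑ m ∈ Finset.range M, b m * (u : ℂ) ^ m).re := by
    have hMpos : 0 < M := by
      rcases Nat.eq_zero_or_pos M with rfl | h
      · norm_num at hM1; linarith
      · exact h
    have hre : ∀ m, (b m * (u : ℂ) ^ m).re = (b m).re * u ^ m := by
      intro m; rw [← ofReal_pow, re_mul_ofReal]
    rw [re_sum]
    have h0 : (b 0 * (u : ℂ) ^ 0).re ≤ _ := Finset.single_le_sum (s := Finset.range M)
      (f := fun m => (b m * (u : ℂ) ^ m).re)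
      (fun m _ => by rw [hre]; exact mul_nonneg (hb0 m) (by positivity))
      (Finset.mem_range.2 hMpos)
    rw [pow_zero, mul_one] at h0
    linarith
  rw [hkey, add_re, sub_re]
  have h1 : (F 1 * ((u : ℂ) ^ M / (1 - α))).re
        ≤ 8 * ‖F 1‖ * (32 * B) ^ (4 * (1 - α)) / (1 - α) := by
    refine (re_le_norm _).trans ?_
    have : (u : ℂ) ^ M / (1 - α) = ((u ^ M / (1 - α) : ℝ) : ℂ) := by push_cast; rfl
    rw [norm_mul, this, Complex.norm_real, Real.norm_eq_abs, abs_of_pos (by positivity)]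
    calc _ ≤ ‖F 1‖ * (8 * (32 * B) ^ (4 * (1 - α)) / (1 - α)) := by gcongr
      _ = _ := by ring
  have h2 := (abs_le.1 ((abs_re_le_norm _).trans htail)).1
  linarith

end

section

open Complex Filter Topology MeasureTheory Set Metric
open scoped ComplexOrder
open DirichletCharacter

lemma LSeries_zetaMul {q : ℕ} [NeZero q] (χ : DirichletCharacter ℂ q) {s : ℂ} (hs : 1 < s.re) :
    LSeries χ.zetaMul s = riemannZeta s * LFunction χ s := by
  rw [zetaMul, ← ArithmeticFunction.coe_mul, LSeries_convolution']
  · rw [χ.LFunction_eq_LSeries hs]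
    congr 1
    · simp_rw [← ArithmeticFunction.LSeries_zeta_eq_riemannZeta hs,
          ← ArithmeticFunction.natCoe_apply]
    · exact LSeries_congr (fun h => (χ.apply_eq_toArithmeticFunction_apply h).symm) s
  · exact ArithmeticFunction.LSeriesSummable_zeta_iff.mpr hs
  · exact (LSeriesSummable_congr _ fun h ↦ (χ.apply_eq_toArithmeticFunction_apply h).symm).mpr <|
      ZMod.LSeriesSummable_of_one_lt_re χ hs

lemma LFunctionTrivChar₁_one_of_ne {s : ℂ} (hs : s ≠ 1) :
    LFunctionTrivChar₁ 1 s = (s - 1) * riemannZeta s := by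
  rw [LFunctionTrivChar₁, Function.update_of_ne hs, LFunctionTrivChar, LFunction_modOne_eq]

lemma zetaMul_one {q : ℕ} (χ : DirichletCharacter ℂ q) : χ.zetaMul 1 = 1 :=
  χ.isMultiplicative_zetaMul.map_one

lemma exists_norm_LFunction_closedBall_le :
    ∃ C : ℝ, 1 ≤ C ∧ (∀ (q : ℕ) [NeZero q] (χ : DirichletCharacter ℂ q), χ ≠ 1 →
      ∀ s : ℂ, ‖s - 2‖ ≤ 3 / 2 → ‖LFunction χ s‖ ≤ C * (q : ℝ) ^ (1 / 2 : ℝ)) ∧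
      ∀ s : ℂ, ‖s - 2‖ ≤ 3 / 2 → ‖LFunctionTrivChar₁ 1 s‖ ≤ C := by
  obtain ⟨C₁, hC₁, h₁⟩ := exists_norm_LFunction_le (ε := 1 / 2) (by norm_num) le_rfl
  obtain ⟨C₂, hC₂, h₂⟩ := exists_norm_LFunctionTrivChar₁_le (ε := 1 / 2) (by norm_num) le_rfl
  have key : ∀ s : ℂ, ‖s - 2‖ ≤ 3 / 2 → 1 - 1 / 2 ≤ s.re ∧ ‖s‖ + 2 ≤ 11 / 2 ∧ ‖s - 1‖ ≤ 5 / 2 := by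
    intro s hs
    have hre := (abs_le.mp ((abs_re_le_norm (s - 2)).trans hs)).1
    have h2 : ‖(2 : ℂ)‖ = 2 := by simp
    have h3 : ‖s‖ ≤ ‖s - 2‖ + ‖(2 : ℂ)‖ := by simpa using norm_add_le (s - 2) 2
    have h4 : ‖s - 1‖ ≤ ‖s - 2‖ + ‖(1 : ℂ)‖ := by
      have := norm_add_le (s - 2) 1
      rwa [show s - 2 + 1 = s - 1 by ring] at this
    simp only [sub_re, re_ofNat] at hre
    rw [norm_one] at h4
    refine ⟨by linarith, by linarith, by linarith⟩
  set D : ℝ := (11 / 2 : ℝ) ^ (1 / 2 : ℝ)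
  have hD : 0 ≤ D := by positivity
  refine ⟨1 + C₁ * D + C₂ * (7 / 2) * D, by nlinarith [mul_nonneg hC₁.le hD, mul_nonneg hC₂.le hD],
    fun q _ χ hχ s hs => ?_, fun s hs => ?_⟩
  · obtain ⟨hr, hn, -⟩ := key s hs
    calc _ ≤ C₁ * (q * (‖s‖ + 2)) ^ (1 / 2 : ℝ) := h₁ q χ hχ s hr
      _ ≤ C₁ * (q * (11 / 2)) ^ (1 / 2 : ℝ) := by gcongr
      _ = C₁ * D * (q : ℝ) ^ (1 / 2 : ℝ) := by
        rw [Real.mul_rpow (by positivity) (by norm_num)]; ring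
      _ ≤ _ := by
        gcongr
        nlinarith [mul_nonneg hC₁.le hD, mul_nonneg hC₂.le hD]
  · obtain ⟨hr, hn, hn1⟩ := key s hs
    calc _ ≤ C₂ * (‖s - 1‖ + 1) * ((1 : ℕ) * (‖s‖ + 2)) ^ (1 / 2 : ℝ) := h₂ 1 s hr
      _ ≤ C₂ * (5 / 2 + 1) * ((1 : ℕ) * (11 / 2)) ^ (1 / 2 : ℝ) := by gcongr
      _ = C₂ * (7 / 2) * D := by simp only [Nat.cast_one, one_mul, D]; norm_num
      _ ≤ _ := by nlinarith [mul_nonneg hC₁.le hD, mul_nonneg hC₂.le hD]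

lemma abscissa_lt_two {a : ℕ → ℂ} (h : ∀ s : ℂ, 1 < s.re → LSeriesSummable a s) :
    LSeries.abscissaOfAbsConv a < (2 : ℂ).re := by
  have := (h (3 / 2 : ℝ) (by simp; norm_num)).abscissaOfAbsConv_le
  refine this.trans_lt ?_
  simp only [ofReal_re, re_ofNat]
  exact_mod_cast (by norm_num : (3 / 2 : ℝ) < 2)

theorem exists_estermann_single :
    ∃ C : ℝ, 1 ≤ C ∧ ∀ (q : ℕ) [NeZero q] (χ : DirichletCharacter ℂ q), χ ^ 2 = 1 → χ ≠ 1 →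
      ∀ α : ℝ, 7 / 8 ≤ α → α < 1 →
        1 / 2 - C * ‖LFunction χ 1‖ * (C * q) ^ (4 * (1 - α)) / (1 - α) ≤
          (LFunctionTrivChar₁ 1 α * LFunction χ α / (α - 1)).re := by
  obtain ⟨C, hC, h₁, h₂⟩ := exists_norm_LFunction_closedBall_le
  refine ⟨32 * (C * C), by nlinarith, fun q _ χ hχ2 hχ α hα hα1 => ?_⟩
  have hq : (1 : ℝ) ≤ q := by exact_mod_cast NeZero.one_le
  have hq2 : (q : ℝ) ^ (1 / 2 : ℝ) ≤ q := by
    calc (q : ℝ) ^ (1 / 2 : ℝ) ≤ (q : ℝ) ^ (1 : ℝ) :=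
        Real.rpow_le_rpow_of_exponent_le hq (by norm_num)
      _ = q := Real.rpow_one _
  have h := estermann_inequality (a := χ.zetaMul)
    (F := fun s => LFunctionTrivChar₁ 1 s * LFunction χ s) (B := C * C * q)
    (fun n => χ.zetaMul_nonneg hχ2 n) (zetaMul_one χ)
    (abscissa_lt_two fun s hs => χ.LSeriesSummable_zetaMul hs)
    ((differentiable_LFunctionTrivChar₁ 1).mul (differentiable_LFunction hχ))
    (fun s hs => by
      have hs1 : s ≠ 1 := by rintro rfl; simp at hs
      rw [LSeries_zetaMul χ hs, LFunctionTrivChar₁_one_of_ne hs1]; ring)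
    (by nlinarith [mul_le_mul hC hC zero_le_one (by linarith)]) (fun s hs => by
      rw [norm_mul]
      calc _ ≤ C * (C * (q : ℝ) ^ (1 / 2 : ℝ)) :=
            mul_le_mul (h₂ s hs) (h₁ q χ hχ s hs) (norm_nonneg _) (by linarith)
        _ ≤ C * (C * q) := by gcongr
        _ = _ := by ring) hα hα1
  refine le_trans ?_ h
  have hZ : LFunctionTrivChar₁ 1 1 = 1 := by simp
  simp only [hZ, one_mul]
  have h1 : 0 < 1 - α := by linarith
  rw [show 32 * (C * C * (q : ℝ)) = 32 * (C * C) * q by ring]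
  gcongr
  nlinarith

/-- The product of two Dirichlet characters of possibly different levels. -/
noncomputable def pairMul {q₁ q₂ : ℕ} (χ₁ : DirichletCharacter ℂ q₁)
      (χ₂ : DirichletCharacter ℂ q₂) :
    DirichletCharacter ℂ (q₁ * q₂) :=
  changeLevel (dvd_mul_right q₁ q₂) χ₁ * changeLevel (dvd_mul_left q₂ q₁) χ₂

lemma pairMul_apply {q₁ q₂ : ℕ} (χ₁ : DirichletCharacter ℂ q₁)
    (χ₂ : DirichletCharacter ℂ q₂) (n : ℕ) : pairMul χ₁ χ₂ n = χ₁ n * χ₂ n := by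
  rw [pairMul, MulChar.mul_apply]
  by_cases h : n.Coprime (q₁ * q₂)
  · have hu := (ZMod.unitOfCoprime n h)
    have h1 := changeLevel_eq_cast_of_dvd χ₁ (dvd_mul_right q₁ q₂) (ZMod.unitOfCoprime n h)
    have h2 := changeLevel_eq_cast_of_dvd χ₂ (dvd_mul_left q₂ q₁) (ZMod.unitOfCoprime n h)
    simp only [ZMod.coe_unitOfCoprime] at h1 h2
    rw [h1, h2, ZMod.cast_natCast (dvd_mul_right q₁ q₂), ZMod.cast_natCast (dvd_mul_left q₂ q₁)]
  · have hn : ¬ IsUnit (n : ZMod (q₁ * q₂)) := by rwa [ZMod.isUnit_iff_coprime]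
    rw [MulChar.map_nonunit _ hn, zero_mul]
    rw [Nat.coprime_mul_iff_right, not_and_or] at h
    rcases h with h | h
    · rw [MulChar.map_nonunit χ₁ (by rwa [ZMod.isUnit_iff_coprime]), zero_mul]
    · rw [MulChar.map_nonunit χ₂ (by rwa [ZMod.isUnit_iff_coprime]), mul_zero]

/-- The coefficients of `ζ(s) L(s, χ₁) L(s, χ₂) L(s, χ₁χ₂)`. -/
noncomputable def pairCoeff {q₁ q₂ : ℕ} (χ₁ : DirichletCharacter ℂ q₁)
    (χ₂ : DirichletCharacter ℂ q₂) : ArithmeticFunction ℂ :=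
  χ₁.zetaMul * (toArithmeticFunction (χ₂ ·) * toArithmeticFunction (pairMul χ₁ χ₂ ·))

section pair
variable {q₁ q₂ : ℕ} (χ₁ : DirichletCharacter ℂ q₁) (χ₂ : DirichletCharacter ℂ q₂)

lemma isMultiplicative_pairCoeff : (pairCoeff χ₁ χ₂).IsMultiplicative :=
  χ₁.isMultiplicative_zetaMul.mul ((isMultiplicative_toArithmeticFunction χ₂).mul
    (isMultiplicative_toArithmeticFunction _))

lemma toArithmeticFunction_mul_pairMul (n : ℕ) :
    (toArithmeticFunction (χ₂ ·) * toArithmeticFunction (pairMul χ₁ χ₂ ·)) n =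
      χ₂ n * χ₁.zetaMul n := by
  rw [zetaMul, ArithmeticFunction.mul_apply, ArithmeticFunction.mul_apply, Finset.mul_sum]
  refine Finset.sum_congr rfl fun p hp => ?_
  obtain ⟨hp, hn⟩ := Nat.mem_divisorsAntidiagonal.mp hp
  have h1 : p.1 ≠ 0 := by rintro h; simp [h] at hp; exact hn hp.symm
  have h2 : p.2 ≠ 0 := by rintro h; simp [h] at hp; exact hn hp.symm
  rw [← hp]
  simp [toArithmeticFunction, h1, h2, pairMul_apply]
  ring

lemma pairCoeff_comm : pairCoeff χ₁ χ₂ = pairCoeff χ₂ χ₁ := by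
  have : toArithmeticFunction (fun n : ℕ => pairMul χ₁ χ₂ n) =
      toArithmeticFunction (fun n : ℕ => pairMul χ₂ χ₁ n) :=
    toArithmeticFunction_congr fun _ => by rw [pairMul_apply, pairMul_apply, mul_comm]
  simp only [pairCoeff, zetaMul, this]
  ring

variable {χ₁ χ₂}

lemma pairCoeff_prime_pow_nonneg_of_nonneg (h₁ : χ₁ ^ 2 = 1) {p : ℕ} (hp : p.Prime)
    (h : ∀ j, 0 ≤ χ₂ p ^ j * χ₁.zetaMul (p ^ j)) (k : ℕ) : 0 ≤ pairCoeff χ₁ χ₂ (p ^ k) := by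
  rw [pairCoeff, ArithmeticFunction.mul_apply]
  refine Finset.sum_nonneg fun x hx => ?_
  obtain ⟨hx, -⟩ := Nat.mem_divisorsAntidiagonal.mp hx
  obtain ⟨j, -, hj⟩ := (Nat.dvd_prime_pow hp).mp (⟨x.1, by rw [← hx, mul_comm]⟩ : x.2 ∣ p ^ k)
  rw [toArithmeticFunction_mul_pairMul, hj]
  refine mul_nonneg (χ₁.zetaMul_nonneg h₁ _) ?_
  simpa using h j

lemma pairCoeff_prime_pow_nonneg (h₁ : χ₁ ^ 2 = 1) (h₂ : χ₂ ^ 2 = 1) {p : ℕ} (hp : p.Prime)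
    (k : ℕ) : 0 ≤ pairCoeff χ₁ χ₂ (p ^ k) := by
  have key : ∀ {q₁ q₂ : ℕ} {χ₁ : DirichletCharacter ℂ q₁} {χ₂ : DirichletCharacter ℂ q₂},
      χ₁ ^ 2 = 1 → 0 ≤ χ₂ p → 0 ≤ pairCoeff χ₁ χ₂ (p ^ k) := fun h1 h =>
    pairCoeff_prime_pow_nonneg_of_nonneg h1 hp
      (fun j => mul_nonneg (pow_nonneg h j) (zetaMul_nonneg h1 _)) k
  rcases MulChar.isQuadratic_iff_sq_eq_one.mpr h₂ p with h | h | h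
  · exact key h₁ (by rw [h])
  · exact key h₁ (by rw [h]; exact zero_le_one)
  rcases MulChar.isQuadratic_iff_sq_eq_one.mpr h₁ p with h' | h' | h'
  · rw [pairCoeff_comm]; exact key h₂ (by rw [h'])
  · rw [pairCoeff_comm]; exact key h₂ (by rw [h']; exact zero_le_one)
  refine pairCoeff_prime_pow_nonneg_of_nonneg h₁ hp (fun j => ?_) k
  rcases Nat.even_or_odd j with hj | hj
  · rw [h, hj.neg_one_pow, one_mul]
    exact zetaMul_nonneg h₁ _
  · refine le_of_eq ?_
    symm
    rw [mul_eq_zero]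
    right
    rw [zetaMul, ArithmeticFunction.coe_zeta_mul_apply, Nat.sum_divisors_prime_pow hp]
    have : ∀ i ∈ Finset.range (j + 1), toArithmeticFunction (fun n : ℕ => χ₁ n)
          (p ^ i) = (-1) ^ i := by
      intro i _
      simp [toArithmeticFunction, hp.ne_zero, h']
    rw [Finset.sum_congr rfl this, neg_one_geom_sum]
    simp [hj.add_one]

lemma pairCoeff_nonneg (h₁ : χ₁ ^ 2 = 1) (h₂ : χ₂ ^ 2 = 1) (n : ℕ) : 0 ≤ pairCoeff χ₁ χ₂ n := by
  rcases eq_or_ne n 0 with rfl | hn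
  · simp
  · rw [(isMultiplicative_pairCoeff χ₁ χ₂).multiplicative_factorization _ hn]
    exact Finset.prod_nonneg fun p hp =>
      pairCoeff_prime_pow_nonneg h₁ h₂ (Nat.prime_of_mem_primeFactors hp) _

lemma LSeriesSummable_toArithmeticFunction {q : ℕ} (χ : DirichletCharacter ℂ q) {s : ℂ}
    (hs : 1 < s.re) : LSeriesSummable (toArithmeticFunction (χ ·)) s := by
  refine LSeriesSummable_of_bounded_of_one_lt_re (m := 1) (fun n hn ↦ ?_) hs
  simpa only [toArithmeticFunction, ArithmeticFunction.coe_mk, hn, ↓reduceIte] using norm_le_one χ _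

lemma LSeriesSummable_pairCoeff {s : ℂ} (hs : 1 < s.re) :
    LSeriesSummable (pairCoeff χ₁ χ₂) s :=
  ArithmeticFunction.LSeriesSummable_mul (χ₁.LSeriesSummable_zetaMul hs)
    (ArithmeticFunction.LSeriesSummable_mul (LSeriesSummable_toArithmeticFunction χ₂ hs)
      (LSeriesSummable_toArithmeticFunction _ hs))

lemma LSeries_toArithmeticFunction {q : ℕ} [NeZero q] (χ : DirichletCharacter ℂ q) {s : ℂ}
    (hs : 1 < s.re) : LSeries (toArithmeticFunction (χ ·)) s = LFunction χ s := by
  rw [LFunction_eq_LSeries _ hs]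
  exact LSeries_congr (fun h => (χ.apply_eq_toArithmeticFunction_apply h).symm) s

lemma LSeries_pairCoeff [NeZero q₁] [NeZero q₂] {s : ℂ} (hs : 1 < s.re) :
    LSeries (pairCoeff χ₁ χ₂) s =
      riemannZeta s * LFunction χ₁ s * (LFunction χ₂ s * LFunction (pairMul χ₁ χ₂) s) := by
  rw [pairCoeff, ArithmeticFunction.LSeries_mul' (χ₁.LSeriesSummable_zetaMul hs)
    (ArithmeticFunction.LSeriesSummable_mul (LSeriesSummable_toArithmeticFunction χ₂ hs)
      (LSeriesSummable_toArithmeticFunction _ hs)),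
    ArithmeticFunction.LSeries_mul' (LSeriesSummable_toArithmeticFunction χ₂ hs)
      (LSeriesSummable_toArithmeticFunction _ hs), LSeries_zetaMul _ hs,
    LSeries_toArithmeticFunction _ hs, LSeries_toArithmeticFunction _ hs]

end pair

theorem exists_estermann_pair :
    ∃ C : ℝ, 1 ≤ C ∧ ∀ (q₁ q₂ : ℕ) [NeZero q₁] [NeZero q₂] (χ₁ : DirichletCharacter ℂ q₁)
      (χ₂ : DirichletCharacter ℂ q₂), χ₁ ^ 2 = 1 → χ₁ ≠ 1 → χ₂ ^ 2 = 1 → χ₂ ≠ 1 →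
      pairMul χ₁ χ₂ ≠ 1 → ∀ β : ℝ, 7 / 8 ≤ β → β < 1 → LFunction χ₁ β = 0 →
        1 / 2 ≤ C * (‖LFunction χ₁ 1‖ * ‖LFunction χ₂ 1‖ * ‖LFunction (pairMul χ₁ χ₂) 1‖) *
            (C * (q₁ * q₂)) ^ (4 * (1 - β)) / (1 - β) := by
  obtain ⟨C, hC, h₁, h₂⟩ := exists_norm_LFunction_closedBall_le
  refine ⟨32 * (C * C * C * C), by nlinarith [one_le_pow₀ (n := 4) hC],
    fun q₁ q₂ _ _ χ₁ χ₂ h1 h1' h2 h2' h12 β hβ hβ1 h0 => ?_⟩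
  have hC4 : 1 ≤ C * C * C * C := by nlinarith [one_le_pow₀ (n := 4) hC]
  have hq1 : (1 : ℝ) ≤ q₁ := by exact_mod_cast NeZero.one_le
  have hq2 : (1 : ℝ) ≤ q₂ := by exact_mod_cast NeZero.one_le
  have h := estermann_inequality (a := pairCoeff χ₁ χ₂)
    (F := fun s => LFunctionTrivChar₁ 1 s * LFunction χ₁ s *
      (LFunction χ₂ s * LFunction (pairMul χ₁ χ₂) s)) (B := C * C * C * C * (q₁ * q₂))
    (fun n => pairCoeff_nonneg h1 h2 n) (isMultiplicative_pairCoeff χ₁ χ₂).map_one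
    (abscissa_lt_two fun s hs => LSeriesSummable_pairCoeff hs)
    (((differentiable_LFunctionTrivChar₁ 1).mul (differentiable_LFunction h1')).mul
      ((differentiable_LFunction h2').mul (differentiable_LFunction h12)))
    (fun s hs => by
      have hs1 : s ≠ 1 := by rintro rfl; simp at hs
      rw [LSeries_pairCoeff hs, LFunctionTrivChar₁_one_of_ne hs1]; ring)
    (by nlinarith [mul_le_mul hq1 hq2 zero_le_one (by linarith)]) (fun s hs => by
      rw [norm_mul, norm_mul, norm_mul]
      calc _ ≤ C * (C * (q₁ : ℝ) ^ (1 / 2 : ℝ)) *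
            ((C * (q₂ : ℝ) ^ (1 / 2 : ℝ)) * (C * ((q₁ * q₂ : ℕ) : ℝ) ^ (1 / 2 : ℝ))) := by
              gcongr
              exacts [h₂ s hs, h₁ q₁ χ₁ h1' s hs, h₁ q₂ χ₂ h2' s hs, h₁ _ _ h12 s hs]
        _ = C * C * C * C * (((q₁ : ℝ) ^ (1 / 2 : ℝ) * (q₁ : ℝ) ^ (1 / 2 : ℝ)) *
            ((q₂ : ℝ) ^ (1 / 2 : ℝ) * (q₂ : ℝ) ^ (1 / 2 : ℝ))) := by
            push_cast
            rw [Real.mul_rpow (by positivity) (by positivity)]; ring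
        _ = _ := by
            rw [← Real.rpow_add (by linarith), ← Real.rpow_add (by linarith)]; norm_num) hβ hβ1
  have hZ : LFunctionTrivChar₁ 1 1 = 1 := by simp
  simp only [h0, hZ, one_mul, mul_zero, zero_mul, zero_div, zero_re, norm_mul] at h
  have h3 := sub_nonpos.mp h
  refine h3.trans ?_
  have h1 : 0 < 1 - β := by linarith
  rw [show 32 * (C * C * C * C * ((q₁ : ℝ) * q₂)) = 32 * (C * C * C * C) * (q₁ * q₂) by ring,
    mul_assoc ‖LFunction χ₁ 1‖]
  gcongr
  nlinarith

end

section

open Complex Filter Topology MeasureTheory Set Metric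
open scoped ComplexOrder
open DirichletCharacter

lemma conj_conj_eq_of_real {F : ℂ → ℂ} (hF : Differentiable ℂ F)
    (hr : ∀ x : ℝ, 1 < x → (F x).im = 0) (x : ℝ) : (F x).im = 0 := by
  have hG : Differentiable ℂ (fun s => starRingEnd ℂ (F (starRingEnd ℂ s))) := fun s => by
    have := (hF (starRingEnd ℂ s)).conj_conj
    simpa [Function.comp_def] using this
  have h := (hG.differentiableOn.analyticOnNhd isOpen_univ).eq_of_frequently_eq
    (hF.differentiableOn.analyticOnNhd isOpen_univ) (z₀ := 2) (by
      have ht : Tendsto (fun n : ℕ => ((2 + 1 / ((n : ℝ) + 1) : ℝ) : ℂ)) atTop (𝓝[≠] 2) := by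
        refine tendsto_nhdsWithin_iff.mpr ⟨?_, Eventually.of_forall fun n => ?_⟩
        · have := (tendsto_one_div_add_atTop_nhds_zero_nat (𝕜 := ℝ)).const_add 2
          rw [add_zero] at this
          exact_mod_cast (continuous_ofReal.tendsto _).comp this
        · have : (0 : ℝ) < 1 / ((n : ℝ) + 1) := by positivity
          simp only [mem_compl_iff, mem_singleton_iff]
          intro h
          have := congrArg re h
          simp only [ofReal_re, re_ofNat] at this
          linarith
      refine ht.frequently (Frequently.of_forall fun n => ?_)
      rw [conj_ofReal]
      exact conj_eq_iff_im.mpr (hr _ (by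
        have : (0 : ℝ) < 1 / ((n : ℝ) + 1) := by positivity
        linarith)))
  have := congrFun h x
  simp only [conj_ofReal] at this
  exact conj_eq_iff_im.mp this

lemma LFunctionTrivChar₁_one_ne_zero_of_one_le_re {s : ℂ} (hs : 1 ≤ s.re) :
    LFunctionTrivChar₁ 1 s ≠ 0 := by
  by_cases h : s = 1
  · rw [h]; exact LFunctionTrivChar₁_apply_one_ne_zero 1
  · rw [LFunctionTrivChar₁_one_of_ne h]
    exact mul_ne_zero (sub_ne_zero.mpr h) (riemannZeta_ne_zero_of_one_le_re hs)

lemma re_zeta_mul_LFunction_nonneg {q : ℕ} [NeZero q] {χ : DirichletCharacter ℂ q} (hχ2 : χ ^ 2 = 1)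
    (hχ : χ ≠ 1) {α : ℝ} (hα : α < 1)
    (h0 : ∀ σ : ℝ, α < σ → σ < 1 → LFunctionTrivChar₁ 1 σ ≠ 0 ∧ LFunction χ σ ≠ 0) :
    0 ≤ (LFunctionTrivChar₁ 1 α * LFunction χ α).re := by
  set F : ℂ → ℂ := fun s => LFunctionTrivChar₁ 1 s * LFunction χ s with hFdef
  have hF : Differentiable ℂ F :=
    (differentiable_LFunctionTrivChar₁ 1).mul (differentiable_LFunction hχ)
  have hpos : ∀ x : ℝ, 1 < x → 0 < F x := by
    intro x hx
    have hx1 : (x : ℂ) ≠ 1 := by exact_mod_cast hx.ne'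
    have h1 : F x = ((x - 1 : ℝ) : ℂ) * LSeries χ.zetaMul x := by
      rw [LSeries_zetaMul χ (by simpa using hx)]
      simp only [F]
      rw [LFunctionTrivChar₁_one_of_ne hx1]
      push_cast; ring
    rw [h1]
    refine mul_pos (by exact_mod_cast sub_pos.mpr hx) ?_
    refine LSeries.positive (fun n => χ.zetaMul_nonneg hχ2 n)
          (by rw [zetaMul_one]; exact zero_lt_one) ?_
    have := (χ.LSeriesSummable_zetaMul (s := ((1 + x) / 2 : ℝ))
          (by simp; linarith)).abscissaOfAbsConv_le
    refine this.trans_lt ?_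
    rw [ofReal_re]
    exact_mod_cast (by linarith : (1 + x) / 2 < x)
  have him : ∀ x : ℝ, (F x).im = 0 := conj_conj_eq_of_real hF fun x hx =>
    (Complex.pos_iff.mp (hpos x hx)).2.symm
  by_contra! hneg
  have hcont : ContinuousOn (fun x : ℝ => (F x).re) (Icc α 2) :=
    (continuous_re.comp (hF.continuous.comp continuous_ofReal)).continuousOn
  have hmem : (0 : ℝ) ∈ Ioo (F α).re (F ((2 : ℝ) : ℂ)).re :=
    ⟨hneg, (Complex.pos_iff.mp (hpos 2 (by norm_num))).1⟩
  obtain ⟨σ, hσ, hσ0⟩ := intermediate_value_Ioo (by linarith : α ≤ 2) hcont hmem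
  have hz : F σ = 0 := Complex.ext hσ0 (him σ)
  rcases mul_eq_zero.mp hz with h | h
  · rcases lt_or_ge σ 1 with h1 | h1
    · exact (h0 σ hσ.1 h1).1 h
    · exact LFunctionTrivChar₁_one_ne_zero_of_one_le_re (by simpa using h1) h
  · rcases lt_or_ge σ 1 with h1 | h1
    · exact (h0 σ hσ.1 h1).2 h
    · exact LFunction_ne_zero_of_one_le_re χ (.inl hχ) (by simpa using h1) h

lemma LFunction_eq_zero_of_pairMul_eq_one {q₁ q₂ : ℕ} [NeZero q₁] [NeZero q₂]
    {χ₁ : DirichletCharacter ℂ q₁} {χ₂ : DirichletCharacter ℂ q₂} (h₁ : χ₁ ^ 2 = 1)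
    (h : pairMul χ₁ χ₂ = 1) {β : ℝ} (hβ : 0 < β) (hβ1 : β ≠ 1) (h0 : LFunction χ₁ β = 0) :
    LFunction χ₂ β = 0 := by
  have hc : changeLevel (dvd_mul_left q₂ q₁) χ₂ = changeLevel (dvd_mul_right q₁ q₂) χ₁ := by
    have h2 : changeLevel (dvd_mul_right q₁ q₂) χ₁ * changeLevel (dvd_mul_right q₁ q₂) χ₁ = 1 := by
      rw [← map_mul, ← sq, h₁, map_one]
    rw [pairMul] at h
    calc _ = changeLevel (dvd_mul_right q₁ q₂) χ₁ * (changeLevel (dvd_mul_right q₁ q₂) χ₁ *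
          changeLevel (dvd_mul_left q₂ q₁) χ₂) := by rw [← mul_assoc, h2, one_mul]
      _ = _ := by rw [h, mul_one]
  have hb : (β : ℂ) ≠ 1 := by exact_mod_cast hβ1
  have e1 := LFunction_changeLevel (dvd_mul_right q₁ q₂) χ₁ (s := β) (.inr hb)
  have e2 := LFunction_changeLevel (dvd_mul_left q₂ q₁) χ₂ (s := β) (.inr hb)
  rw [hc, e1, h0, zero_mul] at e2
  refine (mul_eq_zero.mp e2.symm).resolve_right (Finset.prod_ne_zero_iff.mpr fun p hp hz => ?_)
  have hp1 := (Nat.prime_of_mem_primeFactors hp).one_lt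
  have h3 : ‖χ₂ p * (p : ℂ) ^ (-(β : ℂ))‖ < 1 := by
    rw [norm_mul, norm_natCast_cpow_of_pos (by omega), neg_re, ofReal_re]
    calc _ ≤ 1 * (p : ℝ) ^ (-β) := by gcongr; exact χ₂.norm_le_one _
      _ < 1 := by
        rw [one_mul]
        exact Real.rpow_lt_one_of_one_lt_of_neg (by exact_mod_cast hp1) (by linarith)
  rw [← sub_eq_zero.mp hz, norm_one] at h3
  exact lt_irrefl _ h3

lemma le_of_half_le {K L Q ε : ℝ} (hK : 0 ≤ K) (hL : 0 ≤ L) (hQ : 1 ≤ Q)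
    (h : 1 / 2 ≤ K * L * Q ^ ε) : 1 / (2 * (K + 1)) * Q ^ (-ε) ≤ L := by
  have hQ' : 0 < Q ^ ε := by positivity
  rw [Real.rpow_neg (by linarith), ← div_eq_mul_inv, div_le_iff₀ hQ', div_le_iff₀ (by positivity)]
  nlinarith [mul_nonneg hL hQ'.le]

/-- **Siegel's theorem**: an ineffective lower bound for `L(1, χ)`, `χ` quadratic. -/
theorem siegel {ε : ℝ} (hε : 0 < ε) : ∃ c : ℝ, 0 < c ∧ ∀ (q : ℕ) [NeZero q]
    (χ : DirichletCharacter ℂ q), χ ^ 2 = 1 → χ ≠ 1 → c * (q : ℝ) ^ (-ε) ≤ ‖LFunction χ 1‖ := by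
  obtain ⟨C, hC, hsingle⟩ := exists_estermann_single
  obtain ⟨C₂, hC₂, hpair⟩ := exists_estermann_pair
  have hZ : ∃ δ₀ : ℝ, 0 < δ₀ ∧ ∀ σ : ℝ, |σ - 1| < δ₀ → LFunctionTrivChar₁ 1 σ ≠ 0 := by
    have hc : ContinuousAt (fun σ : ℝ => LFunctionTrivChar₁ 1 σ) 1 :=
      ((differentiable_LFunctionTrivChar₁ 1).continuous.comp continuous_ofReal).continuousAt
    have := hc.eventually_ne (y := 0) (by
      simp only [ofReal_one]; exact LFunctionTrivChar₁_apply_one_ne_zero 1)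
    obtain ⟨δ, hδ, h⟩ := Metric.eventually_nhds_iff.mp this
    exact ⟨δ, hδ, fun σ hσ => h (by rwa [Real.dist_eq])⟩
  obtain ⟨δ₀, hδ₀, hZ⟩ := hZ
  set δ : ℝ := min (min (1 / 8) (ε / 8)) δ₀ with hδdef
  have hδ : 0 < δ := by positivity
  have hδ8 : δ ≤ 1 / 8 := (min_le_left _ _).trans (min_le_left _ _)
  have hδε : δ ≤ ε / 8 := (min_le_left _ _).trans (min_le_right _ _)
  have hδδ : δ ≤ δ₀ := min_le_right _ _
  have hpow : ∀ {D Q e : ℝ}, 1 ≤ D → 1 ≤ Q → e ≤ ε / 2 →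
      (D * Q) ^ e ≤ D ^ (ε / 2) * Q ^ (ε / 2) := by
    intro D Q e hD hQ he
    rw [← Real.mul_rpow (by linarith) (by linarith)]
    exact Real.rpow_le_rpow_of_exponent_le (by nlinarith) he
  have hpow2 : ∀ {D Q e : ℝ}, 1 ≤ D → 1 ≤ Q → e ≤ ε / 2 → (D * Q) ^ e ≤ D ^ (ε / 2) * Q ^ ε := by
    intro D Q e hD hQ he
    refine (hpow hD hQ he).trans ?_
    gcongr
    linarith
  by_cases hA : ∃ (q₁ : ℕ) (_ : NeZero q₁) (χ₁ : DirichletCharacter ℂ q₁) (β : ℝ),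
      χ₁ ^ 2 = 1 ∧ χ₁ ≠ 1 ∧ 1 - δ < β ∧ β < 1 ∧ LFunction χ₁ β = 0
  · obtain ⟨q₁, _, χ₁, β, h₁, h₁', hβ, hβ1, h0⟩ := hA
    have hb : 0 < 1 - β := by linarith
    have hq₁ : (1 : ℝ) ≤ q₁ := by exact_mod_cast NeZero.one_le
    set ε' : ℝ := min (ε / 2) (1 / 2) with hε'
    obtain ⟨C₃, hC₃, h₃⟩ := exists_norm_LFunction_le (ε := ε') (by positivity) (min_le_right _ _)
    set K₁ : ℝ := C * C ^ (ε / 2) / (1 - β)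
    set K₂ : ℝ := C₂ * ‖LFunction χ₁ 1‖ * (C₃ * (3 * q₁) ^ (ε / 2)) * (C₂ * q₁) ^ (ε / 2) / (1 - β)
    have hK₁ : 0 ≤ K₁ := by positivity
    have hK₂ : 0 ≤ K₂ := by positivity
    refine ⟨1 / (2 * (K₁ + K₂ + 1)), by positivity, fun q _ χ hχ2 hχ => ?_⟩
    have hq : (1 : ℝ) ≤ q := by exact_mod_cast NeZero.one_le
    refine le_of_half_le (by positivity) (norm_nonneg _) hq ?_
    by_cases hz : LFunction χ β = 0
    · have h := hsingle q χ hχ2 hχ β (by linarith) hβ1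
      rw [hz, mul_zero, zero_div, zero_re, sub_nonpos] at h
      refine h.trans ?_
      calc _ ≤ C * ‖LFunction χ 1‖ * (C ^ (ε / 2) * q ^ ε) / (1 - β) := by
            gcongr
            exact hpow2 hC hq (by linarith)
        _ = K₁ * ‖LFunction χ 1‖ * q ^ ε := by simp only [K₁]; ring
        _ ≤ _ := by gcongr; linarith
    · have h12 : pairMul χ₁ χ ≠ 1 := fun h12 =>
        hz (LFunction_eq_zero_of_pairMul_eq_one h₁ h12 (by linarith) hβ1.ne h0)
      have h := hpair q₁ q χ₁ χ h₁ h₁' hχ2 hχ h12 β (by linarith) hβ1 h0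
      refine h.trans ?_
      have hL := h₃ (q₁ * q) (pairMul χ₁ χ) h12 1 (by
        simp only [one_re]
        have : 0 < ε' := by positivity
        linarith)
      have e1 : (((q₁ * q : ℕ) : ℝ) * (‖(1 : ℂ)‖ + 2)) ^ ε' ≤ (3 * q₁) ^ (ε / 2) * q ^ (ε / 2) := by
        rw [norm_one]
        push_cast
        rw [show (q₁ * q * (1 + 2) : ℝ) = (3 * q₁) * q by ring]
        exact hpow (by linarith) hq (min_le_left _ _)
      have e2 : (C₂ * (q₁ * q)) ^ (4 * (1 - β)) ≤ (C₂ * q₁) ^ (ε / 2) * q ^ (ε / 2) := by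
        rw [← mul_assoc]
        exact hpow (by nlinarith) hq (by linarith)
      calc _ ≤ C₂ * (‖LFunction χ₁ 1‖ * ‖LFunction χ 1‖ *
            (C₃ * ((3 * q₁) ^ (ε / 2) * q ^ (ε / 2)))) *
            ((C₂ * q₁) ^ (ε / 2) * q ^ (ε / 2)) / (1 - β) := by
            gcongr
            exact hL.trans (by gcongr)
        _ = K₂ * ‖LFunction χ 1‖ * (q ^ (ε / 2) * q ^ (ε / 2)) := by simp only [K₂]; ring
        _ = K₂ * ‖LFunction χ 1‖ * q ^ ε := by
            rw [← Real.rpow_add (by linarith), add_halves]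
        _ ≤ _ := by gcongr; linarith
  · push Not at hA
    set K₁ : ℝ := C * C ^ (ε / 2) / (δ / 2)
    have hK₁ : 0 ≤ K₁ := by positivity
    refine ⟨1 / (2 * (K₁ + 1)), by positivity, fun q _ χ hχ2 hχ => ?_⟩
    have hq : (1 : ℝ) ≤ q := by exact_mod_cast NeZero.one_le
    refine le_of_half_le hK₁ (norm_nonneg _) hq ?_
    have h := hsingle q χ hχ2 hχ (1 - δ / 2) (by linarith) (by linarith)
    have hre := re_zeta_mul_LFunction_nonneg hχ2 hχ (α := 1 - δ / 2) (by linarith) fun σ h1 h2 =>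
      ⟨hZ σ (by rw [abs_sub_lt_iff]; constructor <;> linarith),
        hA q inferInstance χ σ hχ2 hχ (by linarith) h2⟩
    rw [show ((1 - δ / 2 : ℝ) : ℂ) - 1 = ((-(δ / 2) : ℝ) : ℂ) by push_cast; ring,
          div_ofReal_re] at h
    have h2 := h.trans (div_nonpos_of_nonneg_of_nonpos hre (by linarith))
    rw [sub_nonpos] at h2
    refine h2.trans ?_
    rw [show 1 - (1 - δ / 2) = δ / 2 by ring]
    calc _ ≤ C * ‖LFunction χ 1‖ * (C ^ (ε / 2) * q ^ ε) / (δ / 2) := by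
          gcongr
          exact hpow2 hC hq (by linarith)
      _ = K₁ * ‖LFunction χ 1‖ * q ^ ε := by simp only [K₁]; ring

end

section

open Complex Filter Topology MeasureTheory Set Metric
open DirichletCharacter

/-- The Dirichlet `L`-function, with its pole removed when the character is trivial. -/
noncomputable def regularL {q : ℕ} [NeZero q] (χ : DirichletCharacter ℂ q) (s : ℂ) : ℂ :=
  open Classical in if χ = 1 then LFunctionTrivChar₁ q s / (s + 1) else LFunction χ s

section regularL
variable {q : ℕ} [NeZero q]

lemma regularL_one (s : ℂ) :
    regularL (1 : DirichletCharacter ℂ q) s = LFunctionTrivChar₁ q s / (s + 1) := by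
  simp [regularL]

lemma regularL_of_ne {χ : DirichletCharacter ℂ q} (hχ : χ ≠ 1) (s : ℂ) :
    regularL χ s = LFunction χ s := by simp [regularL, hχ]

lemma add_one_ne_zero_of_re {s : ℂ} (hs : 0 < s.re) : s + 1 ≠ 0 := fun h => by
  have := congrArg re h
  simp at this
  linarith

lemma differentiableAt_regularL (χ : DirichletCharacter ℂ q) {s : ℂ} (hs : 0 < s.re) :
    DifferentiableAt ℂ (regularL χ) s := by
  by_cases h : χ = 1
  · subst h
    have : regularL (1 : DirichletCharacter ℂ q) = fun s => LFunctionTrivChar₁ q s / (s + 1) :=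
      funext regularL_one
    rw [this]
    exact (differentiable_LFunctionTrivChar₁ q s).div (by fun_prop) (add_one_ne_zero_of_re hs)
  · have : regularL χ = LFunction χ := funext (regularL_of_ne h)
    rw [this]
    exact differentiable_LFunction h s

lemma norm_LFunction_mul_div_le (χ : DirichletCharacter ℂ q) {s : ℂ} (hs : 1 < s.re) :
    ‖LFunction χ s‖ * (‖s - 1‖ / (‖s - 1‖ + 2)) ≤ ‖regularL χ s‖ := by
  by_cases h : χ = 1
  · subst h
    have hs1 : s ≠ 1 := by rintro rfl; simp at hs
    rw [regularL_one, LFunctionTrivChar₁, Function.update_of_ne hs1, norm_div, norm_mul, mul_comm,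
      div_mul_eq_mul_div]
    have h1 : 0 < ‖s + 1‖ := norm_pos_iff.mpr (add_one_ne_zero_of_re (by linarith))
    have h2 : ‖s + 1‖ ≤ ‖s - 1‖ + 2 := by
      have := norm_add_le (s - 1) 2
      rw [show s - 1 + 2 = s + 1 by ring] at this
      simpa using this
    gcongr
  · rw [regularL_of_ne h]
    exact mul_le_of_le_one_right (norm_nonneg _)
      (div_le_one_of_le₀ (by linarith) (by positivity))

lemma norm_LFunction_le (χ : DirichletCharacter ℂ q) {s : ℂ} (hs : 1 < s.re) :
    ‖LFunction χ s‖ ≤ ‖regularL χ s‖ * (1 + 2 / ‖s - 1‖) := by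
  have hs1 : s ≠ 1 := by rintro rfl; simp at hs
  have h0 : 0 < ‖s - 1‖ := norm_pos_iff.mpr (sub_ne_zero.mpr hs1)
  have h := norm_LFunction_mul_div_le χ hs
  have : ‖LFunction χ s‖ = ‖LFunction χ s‖ * (‖s - 1‖ / (‖s - 1‖ + 2)) * (1 + 2 / ‖s - 1‖) := by
    field_simp
  rw [this]
  gcongr

end regularL

lemma rpow_le_two_mul {t t' ε : ℝ} (ht' : 0 ≤ t') (h : t' ≤ 2 * t) (hε : 0 < ε) (hε1 : ε ≤ 1) :
    t' ^ ε ≤ 2 * t ^ ε := by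
  have ht : 0 ≤ t := by linarith
  calc t' ^ ε ≤ (2 * t) ^ ε := by gcongr
    _ = 2 ^ ε * t ^ ε := Real.mul_rpow (by norm_num) ht
    _ ≤ 2 ^ (1 : ℝ) * t ^ ε := by
        gcongr
        norm_num
    _ = _ := by rw [Real.rpow_one]

theorem exists_norm_regularL_le {ε : ℝ} (hε : 0 < ε) (hε1 : ε ≤ 1 / 2) :
    ∃ C : ℝ, 0 < C ∧ ∀ (q : ℕ) [NeZero q] (χ : DirichletCharacter ℂ q),
      ∀ s : ℂ, 1 - ε ≤ s.re → ‖regularL χ s‖ ≤ C * (q * (‖s‖ + 2)) ^ ε := by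
  obtain ⟨C₁, hC₁, h₁⟩ := exists_norm_LFunction_le hε hε1
  obtain ⟨C₂, hC₂, h₂⟩ := exists_norm_LFunctionTrivChar₁_le hε hε1
  refine ⟨C₁ + 3 * C₂, by positivity, fun q _ χ s hs => ?_⟩
  by_cases h : χ = 1
  · subst h
    have h1 : 1 ≤ ‖s + 1‖ := by
      have := re_le_norm (s + 1)
      simp only [add_re, one_re] at this
      linarith
    have h2 : ‖s - 1‖ ≤ ‖s + 1‖ + 2 := by
      have := norm_sub_le (s + 1) 2
      rw [show s + 1 - 2 = s - 1 by ring] at this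
      simpa using this
    rw [regularL_one, norm_div, div_le_iff₀ (by linarith)]
    calc _ ≤ C₂ * (‖s - 1‖ + 1) * (q * (‖s‖ + 2)) ^ ε := h₂ q s hs
      _ ≤ C₂ * (3 * ‖s + 1‖) * (q * (‖s‖ + 2)) ^ ε := by
        gcongr
        have h4 : 3 / 2 ≤ ‖s + 1‖ := by
          have := re_le_norm (s + 1)
          simp only [add_re, one_re] at this
          linarith
        linarith
      _ = 3 * C₂ * (q * (‖s‖ + 2)) ^ ε * ‖s + 1‖ := by ring
      _ ≤ _ := by gcongr; linarith
  · rw [regularL_of_ne h]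
    refine (h₁ q χ h s hs).trans ?_
    gcongr
    linarith

theorem exists_norm_deriv_regularL_le {ε : ℝ} (hε : 0 < ε) (hε1 : ε ≤ 1 / 2) :
    ∃ C : ℝ, 0 < C ∧ ∀ (q : ℕ) [NeZero q] (χ : DirichletCharacter ℂ q),
      ∀ s : ℂ, 1 - ε / 2 ≤ s.re → ‖deriv (regularL χ) s‖ ≤ C * (q * (‖s‖ + 2)) ^ ε := by
  obtain ⟨C, hC, h⟩ := exists_norm_regularL_le hε hε1
  refine ⟨C * 2 / (ε / 2), by positivity, fun q _ χ s hs => ?_⟩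
  have key : ∀ z ∈ closedBall s (ε / 2), 1 - ε ≤ z.re ∧ ‖z‖ ≤ ‖s‖ + 1 := by
    intro z hz
    rw [mem_closedBall, dist_eq_norm] at hz
    have h1 := (abs_le.mp ((abs_re_le_norm (z - s)).trans hz)).1
    have h2 := norm_le_norm_add_norm_sub s z
    rw [sub_re] at h1
    rw [norm_sub_rev] at h2
    exact ⟨by linarith, by linarith⟩
  have := norm_deriv_le_of_forall_mem_sphere_norm_le (f := regularL χ) (c := s) (R := ε / 2)
    (C := C * (2 * (q * (‖s‖ + 2)) ^ ε)) (by positivity) ?_ ?_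
  · refine this.trans (le_of_eq ?_)
    ring
  · refine DifferentiableOn.diffContOnCl fun z hz => ?_
    rw [closure_ball _ (by positivity)] at hz
    exact (differentiableAt_regularL χ (by linarith [(key z hz).1])).differentiableWithinAt
  · intro z hz
    obtain ⟨h1, h2⟩ := key z (sphere_subset_closedBall hz)
    refine (h q χ z h1).trans ?_
    gcongr
    refine rpow_le_two_mul (by positivity) ?_ hε (by linarith)
    have hq : (0 : ℝ) ≤ q := by positivity
    nlinarith [norm_nonneg s]

lemma prod_one_sub_inv_ge (S : Finset ℕ) (hS : ∀ p ∈ S, 2 ≤ p) :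
    1 / ((S.card : ℝ) + 1) ≤ ∏ p ∈ S, (1 - (p : ℝ)⁻¹) := by
  have hcard : ∀ (S : Finset ℕ) (M : ℕ), (∀ p ∈ S, 2 ≤ p) → (∀ p ∈ S, p < M) → 2 ≤ M →
      S.card + 2 ≤ M := by
    intro S M h1 h2 hM
    have : S ⊆ Finset.Ico 2 M := fun p hp => Finset.mem_Ico.mpr ⟨h1 p hp, h2 p hp⟩
    have := Finset.card_le_card this
    rw [Nat.card_Ico] at this
    omega
  induction S using Finset.induction_on_max with
  | empty => simp
  | insert M S hM ih =>
    have hMS : M ∉ S := fun h => lt_irrefl _ (hM M h)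
    have hS' : ∀ p ∈ S, 2 ≤ p := fun p hp => hS p (Finset.mem_insert_of_mem hp)
    have hM2 : 2 ≤ M := hS M (Finset.mem_insert_self _ _)
    have hc := hcard S M hS' hM hM2
    have hc' : (S.card : ℝ) + 2 ≤ M := by exact_mod_cast hc
    rw [Finset.prod_insert hMS, Finset.card_insert_of_notMem hMS]
    push_cast
    have h1 : (M : ℝ)⁻¹ ≤ ((S.card : ℝ) + 2)⁻¹ := by gcongr
    have h2 : (S.card + 1 : ℝ) / (S.card + 2) ≤ 1 - (M : ℝ)⁻¹ := by
      have : (S.card + 1 : ℝ) / (S.card + 2) = 1 - ((S.card : ℝ) + 2)⁻¹ := by field_simp; ring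
      linarith
    calc 1 / ((S.card : ℝ) + 1 + 1) = (S.card + 1 : ℝ) / (S.card + 2) * (1 / (S.card + 1)) := by
          field_simp; ring
      _ ≤ _ := mul_le_mul h2 (ih hS') (by positivity) (le_trans (by positivity) h2)

lemma natCast_le_two_pow_mul {q : ℕ} (hq : q ≠ 0) : 2 ^ q.primeFactors.card ≤ q := by
  calc 2 ^ q.primeFactors.card = ∏ p ∈ q.primeFactors, 2 := by simp
    _ ≤ ∏ p ∈ q.primeFactors, p :=
      Finset.prod_le_prod' fun p hp => (Nat.prime_of_mem_primeFactors hp).two_le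
    _ ≤ q := Nat.le_of_dvd (Nat.pos_of_ne_zero hq) (Nat.prod_primeFactors_dvd q)

theorem exists_le_norm_regularL_one {ε : ℝ} (hε : 0 < ε) :
    ∃ c : ℝ, 0 < c ∧ ∀ (q : ℕ) [NeZero q] (χ : DirichletCharacter ℂ q), χ ^ 2 = 1 →
      c * (q : ℝ) ^ (-ε) ≤ ‖regularL χ 1‖ := by
  obtain ⟨c, hc, h⟩ := siegel hε
  have hl2 : 0 < Real.log 2 := Real.log_pos (by norm_num)
  have hω : ∀ q : ℕ, q ≠ 0 → (q.primeFactors.card : ℝ) + 1 ≤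
        (1 / (ε * Real.log 2) + 1) * (q : ℝ) ^ ε := by
    intro q hq
    have h1 : (1 : ℝ) ≤ q := by exact_mod_cast Nat.one_le_iff_ne_zero.mpr hq
    have h2 : (q.primeFactors.card : ℝ) * Real.log 2 ≤ Real.log q := by
      rw [← Real.log_pow]
      exact Real.log_le_log (by positivity) (by exact_mod_cast natCast_le_two_pow_mul hq)
    have h3 := Real.log_le_rpow_div (by linarith : (0 : ℝ) ≤ q) hε
    have h4 : (1 : ℝ) ≤ (q : ℝ) ^ ε := Real.one_le_rpow h1 hε.le
    have h5 : (q.primeFactors.card : ℝ) ≤ (q : ℝ) ^ ε / ε / Real.log 2 := by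
      rw [le_div_iff₀ hl2]; linarith
    calc _ ≤ (q : ℝ) ^ ε / ε / Real.log 2 + (q : ℝ) ^ ε := add_le_add h5 h4
      _ = _ := by field_simp
  set K := 1 / (ε * Real.log 2) + 1
  have hK : 0 < K := by positivity
  refine ⟨min c (1 / (2 * K)), by positivity, fun q _ χ hχ2 => ?_⟩
  have hq : (1 : ℝ) ≤ q := by exact_mod_cast NeZero.one_le
  by_cases hχ : χ = 1
  · subst hχ
    rw [regularL_one, LFunctionTrivChar₁, Function.update_self]
    have e : (∏ p ∈ q.primeFactors, (1 - (p : ℂ)⁻¹)) =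
        ((∏ p ∈ q.primeFactors, (1 - (p : ℝ)⁻¹) : ℝ) : ℂ) := by push_cast; rfl
    have h1 := prod_one_sub_inv_ge q.primeFactors
      fun p hp => (Nat.prime_of_mem_primeFactors hp).two_le
    have h2 : 0 ≤ ∏ p ∈ q.primeFactors, (1 - (p : ℝ)⁻¹) := le_trans (by positivity) h1
    rw [e, norm_div, norm_real, Real.norm_of_nonneg h2, show (1 : ℂ) + 1 = 2 by norm_num,
      Complex.norm_ofNat, le_div_iff₀ (by norm_num), Real.rpow_neg (by linarith)]
    calc _ ≤ 1 / (2 * K) * ((q : ℝ) ^ ε)⁻¹ * 2 := by gcongr; exact min_le_right _ _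
      _ = 1 / (K * (q : ℝ) ^ ε) := by field_simp
      _ ≤ 1 / ((q.primeFactors.card : ℝ) + 1) :=
        one_div_le_one_div_of_le (by positivity) (hω q (NeZero.ne q))
      _ ≤ _ := h1
  · rw [regularL_of_ne hχ]
    refine le_trans ?_ (h q χ hχ2 hχ)
    gcongr
    exact min_le_left _ _

end

section

open Complex Filter Topology MeasureTheory Set Metric
open DirichletCharacter

lemma norm_LFunction_le_three_mul {q : ℕ} [NeZero q] {χ : DirichletCharacter ℂ q} {d : ℝ}
    (hd : 0 < d) (hd1 : d ≤ 1) {s : ℂ} (hs : 1 < s.re) (h : χ ≠ 1 ∨ d ≤ ‖s - 1‖) :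
    ‖LFunction χ s‖ ≤ 3 * ‖regularL χ s‖ / d := by
  have h1 : 1 ≤ 3 / d := by rw [le_div_iff₀ hd]; linarith
  rw [mul_comm, mul_div_assoc]
  rcases h with h | h
  · rw [regularL_of_ne h]
    exact le_mul_of_one_le_right (norm_nonneg _) h1
  · refine (norm_LFunction_le χ hs).trans ?_
    gcongr
    calc 1 + 2 / ‖s - 1‖ ≤ 1 / d + 2 / d := by
          gcongr
          rw [le_div_iff₀ hd]; linarith
      _ = 3 / d := by ring

lemma norm_regularL_ge_of_far {q : ℕ} [NeZero q] {χ : DirichletCharacter ℂ q} {s : ℂ}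
    (hs : 1 < s.re) (hs2 : s.re ≤ 2) {K d : ℝ} (hK : 1 ≤ K) (hd : 0 < d) (hd1 : d ≤ 1)
    (hfar : χ ^ 2 ≠ 1 ∨ d ≤ ‖s - 1‖)
    (hU : ∀ (ψ : DirichletCharacter ℂ q) (z : ℂ), 1 < z.re → ‖z‖ + 2 ≤ 2 * (‖s‖ + 2) →
      ‖regularL ψ z‖ ≤ K)
    (hD : ∀ z : ℂ, 1 < z.re → ‖z‖ + 2 ≤ 2 * (‖s‖ + 2) → ‖deriv (regularL χ) z‖ ≤ K) :
    d ^ 5 / (2 ^ 4 * 3 ^ 8 * K ^ 8) ≤ ‖regularL χ s‖ := by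
  set η := d ^ 5 / (2 ^ 4 * 3 ^ 8 * K ^ 8) with hη
  have hη0 : 0 < η := by positivity
  have hη1 : η ≤ 1 := by
    rw [hη, div_le_one (by positivity)]
    nlinarith [one_le_pow₀ (n := 8) hK, pow_le_one₀ (n := 5) hd.le hd1]
  set x := max (s.re - 1) η with hx
  have hxη : η ≤ x := le_max_right _ _
  have hxs : s.re - 1 ≤ x := le_max_left _ _
  have hx0 : 0 < x := by linarith
  have hx1 : x ≤ 1 := max_le (by linarith) hη1
  have hxs' : x ≤ s.re - 1 + η := max_le (by linarith) (by linarith)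
  set y := s.im with hy
  have hprod := norm_LFunction_product_ge_one χ hx0 y
  set s₁ : ℂ := 1 + x + I * y with hs₁
  set s₂ : ℂ := 1 + x + 2 * I * y with hs₂
  have re0 : (1 + (x : ℂ)).re = 1 + x := by simp
  have re1 : s₁.re = 1 + x := by simp [hs₁]
  have re2 : s₂.re = 1 + x := by simp [hs₂]
  have im1 : s₁.im = y := by simp [hs₁]
  have im2 : s₂.im = 2 * y := by simp [hs₂]
  have hys : |y| ≤ ‖s‖ := abs_im_le_norm s
  have hss : s.re ≤ ‖s‖ := re_le_norm s
  have bd0 : ‖1 + (x : ℂ)‖ + 2 ≤ 2 * (‖s‖ + 2) := by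
    have : ‖1 + (x : ℂ)‖ = 1 + x := by
      rw [show 1 + (x : ℂ) = ((1 + x : ℝ) : ℂ) by push_cast; ring, norm_real,
        Real.norm_of_nonneg (by linarith)]
    linarith
  have bd2 : ‖s₂‖ + 2 ≤ 2 * (‖s‖ + 2) := by
    have := norm_le_abs_re_add_abs_im s₂
    rw [re2, im2, abs_of_pos (by linarith), abs_mul, abs_two] at this
    linarith
  have hdiff : s₁ - s = ((x - (s.re - 1) : ℝ) : ℂ) := by
    apply Complex.ext <;> simp [re1, im1, hy]
    ring
  have hnd : ‖s₁ - s‖ ≤ η := by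
    rw [hdiff, norm_real, Real.norm_of_nonneg (by linarith)]; linarith
  have bd1 : ‖s₁‖ + 2 ≤ 2 * (‖s‖ + 2) := by
    have := norm_le_norm_add_norm_sub s s₁
    rw [norm_sub_rev] at this
    linarith [norm_nonneg s]
  have hge : ∀ z : ℂ, |s.re - 1| ≤ |z.re - 1| → |y| ≤ |z.im| → ‖s - 1‖ ≤ ‖z - 1‖ := by
    intro z h1 h2
    rw [Complex.norm_def, Complex.norm_def]
    apply Real.sqrt_le_sqrt
    rw [normSq_apply, normSq_apply]
    simp only [sub_re, one_re, sub_im, one_im, sub_zero]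
    have := sq_le_sq.mpr h1
    have := sq_le_sq.mpr h2
    nlinarith
  have hge1 : ‖s - 1‖ ≤ ‖s₁ - 1‖ := hge s₁ (by
    rw [re1, abs_of_pos (by linarith), abs_of_pos (by linarith)]; linarith) (by rw [im1])
  have hge2 : ‖s - 1‖ ≤ ‖s₂ - 1‖ := hge s₂ (by
    rw [re2, abs_of_pos (by linarith), abs_of_pos (by linarith)]; linarith) (by
      rw [im2, abs_mul, abs_two]; linarith [abs_nonneg y])
  have L0 : ‖LFunctionTrivChar q (1 + x)‖ ≤ 3 * K / x := by
    refine (norm_LFunction_le_three_mul hx0 hx1 (by rw [re0]; linarith)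
          (.inr (by simp [abs_of_pos hx0]))).trans ?_
    gcongr
    exact hU 1 _ (by rw [re0]; linarith) bd0
  have L2 : ‖LFunction (χ ^ 2) s₂‖ ≤ 3 * K / d := by
    refine (norm_LFunction_le_three_mul hd hd1 (by rw [re2]; linarith)
      (hfar.imp_right fun h => h.trans hge2)).trans ?_
    gcongr
    exact hU _ _ (by rw [re2]; linarith) bd2
  have L1 : ‖LFunction χ s₁‖ ≤ 3 * ‖regularL χ s₁‖ / d := by
    refine norm_LFunction_le_three_mul hd hd1 (by rw [re1]; linarith) ?_
    refine hfar.imp (fun h h' => h (by rw [h', one_pow])) fun h => h.trans hge1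
  set w := ‖regularL χ s₁‖ with hw
  have hmain : 1 ≤ (3 * K / x) ^ 3 * (3 * w / d) ^ 4 * (3 * K / d) := by
    refine hprod.le.trans ?_
    rw [norm_mul, norm_mul, norm_pow, norm_pow]
    gcongr
  have hmain2 : η ^ 3 * d ^ 5 ≤ 3 ^ 8 * K ^ 4 * w ^ 4 := by
    have e : (3 * K / x) ^ 3 * (3 * w / d) ^ 4 * (3 * K / d) =
          3 ^ 8 * K ^ 4 * w ^ 4 / (x ^ 3 * d ^ 5) := by
      field_simp
    rw [e, le_div_iff₀ (by positivity), one_mul] at hmain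
    refine le_trans ?_ hmain
    gcongr
  have hw2 : 2 * K * η ≤ w := by
    have h8 : η * (2 ^ 4 * 3 ^ 8 * K ^ 8) = d ^ 5 := by
      rw [hη]; field_simp
    have : (2 * K * η) ^ 4 ≤ w ^ 4 := by
      have h9 : 3 ^ 8 * K ^ 4 * (2 * K * η) ^ 4 ≤ 3 ^ 8 * K ^ 4 * w ^ 4 := by
        refine le_trans (le_of_eq ?_) hmain2
        rw [← h8]; ring
      exact le_of_mul_le_mul_left h9 (by positivity)
    exact le_of_pow_le_pow_left₀ (by norm_num) (norm_nonneg _) this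
  have hseg : ‖regularL χ s₁ - regularL χ s‖ ≤ K * ‖s₁ - s‖ := by
    refine (convex_segment s s₁).norm_image_sub_le_of_norm_deriv_le (f := regularL χ)
      (fun z hz => ?_) (fun z hz => ?_) (left_mem_segment ℝ s s₁) (right_mem_segment ℝ s s₁)
    · have := (convex_halfSpace_re_gt 1).segment_subset (x := s) (y := s₁) hs (by
        simp only [mem_ofPred_eq, re1]; linarith) hz
      exact differentiableAt_regularL χ (zero_lt_one.trans this)
    · have := (convex_halfSpace_re_gt 1).segment_subset (x := s) (y := s₁) hs (by
        simp only [mem_ofPred_eq, re1]; linarith) hz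
      refine hD z this ?_
      have := (convex_closedBall (0 : ℂ) (2 * (‖s‖ + 2) - 2)).segment_subset (x := s) (y := s₁)
        (by rw [mem_closedBall_zero_iff]; linarith [norm_nonneg s])
        (by rw [mem_closedBall_zero_iff]; linarith) hz
      rw [mem_closedBall_zero_iff] at this
      linarith
  have h1 : w - ‖regularL χ s‖ ≤ K * η := (norm_sub_norm_le _ _).trans (hseg.trans (by gcongr))
  nlinarith

lemma norm_regularL_ge_of_near {q : ℕ} [NeZero q] {χ : DirichletCharacter ℂ q} {s : ℂ}
    (hs : 1 < s.re) {K c d : ℝ} (hK : 1 ≤ K)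
    (hc : c ≤ ‖regularL χ 1‖) (hd : K * d ≤ c / 2) (hnear : ‖s - 1‖ ≤ d)
    (hD : ∀ z : ℂ, 1 ≤ z.re → ‖z‖ + 2 ≤ 2 * (‖s‖ + 2) → ‖deriv (regularL χ) z‖ ≤ K) :
    c / 2 ≤ ‖regularL χ s‖ := by
  have hss : s.re ≤ ‖s‖ := re_le_norm s
  have hseg : ‖regularL χ 1 - regularL χ s‖ ≤ K * ‖1 - s‖ := by
    refine (convex_segment s 1).norm_image_sub_le_of_norm_deriv_le (f := regularL χ)
      (fun z hz => ?_) (fun z hz => ?_) (left_mem_segment ℝ s 1) (right_mem_segment ℝ s 1)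
    · have := (convex_halfSpace_re_ge 1).segment_subset (x := s) (y := 1) hs.le (by simp) hz
      exact differentiableAt_regularL χ (zero_lt_one.trans_le this)
    · have := (convex_halfSpace_re_ge 1).segment_subset (x := s) (y := 1) hs.le (by simp) hz
      refine hD z this ?_
      have := (convex_closedBall (0 : ℂ) ‖s‖).segment_subset (x := s) (y := 1)
        (by rw [mem_closedBall_zero_iff]) (by rw [mem_closedBall_zero_iff, norm_one]; linarith) hz
      rw [mem_closedBall_zero_iff] at this
      linarith [norm_nonneg s]
  have h1 : ‖regularL χ 1‖ - ‖regularL χ s‖ ≤ K * d := by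
    refine (norm_sub_norm_le _ _).trans (hseg.trans ?_)
    rw [norm_sub_rev]
    gcongr
  linarith

theorem exists_le_norm_regularL {ε : ℝ} (hε : 0 < ε) (hε1 : ε ≤ 1 / 2) :
    ∃ c : ℝ, 0 < c ∧ ∀ (q : ℕ) [NeZero q] (χ : DirichletCharacter ℂ q) (s : ℂ),
      1 < s.re → s.re ≤ 2 → c * (q * (‖s‖ + 2)) ^ (-ε) ≤ ‖regularL χ s‖ := by
  set e : ℝ := ε / 20 with he
  have he0 : 0 < e := by positivity
  have he1 : e ≤ 1 / 2 := by linarith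
  obtain ⟨C₁, hC₁, h₁⟩ := exists_norm_regularL_le he0 he1
  obtain ⟨C₂, hC₂, h₂⟩ := exists_norm_deriv_regularL_le he0 he1
  obtain ⟨c₀, hc₀, h₀⟩ := exists_le_norm_regularL_one he0
  set C : ℝ := 2 * C₁ + 2 * C₂ + 1 with hC
  have hC1 : 1 ≤ C := by linarith
  set c₁ : ℝ := min c₀ 1 with hc₁def
  have hc₁ : 0 < c₁ := by positivity
  have hc₁1 : c₁ ≤ 1 := min_le_right _ _
  set d₀ : ℝ := c₁ / (2 * C) with hd₀
  have hd₀0 : 0 < d₀ := by positivity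
  have hd₀1 : d₀ ≤ 1 := by rw [hd₀, div_le_one (by positivity)]; linarith
  refine ⟨min (c₁ / 2) (d₀ ^ 5 / (2 ^ 4 * 3 ^ 8 * C ^ 8)), by positivity,
    fun q _ χ s hs hs2 => ?_⟩
  have hq : (1 : ℝ) ≤ q := by exact_mod_cast NeZero.one_le
  set τ : ℝ := q * (‖s‖ + 2) with hτ
  have hqτ : (q : ℝ) ≤ τ := by nlinarith [norm_nonneg s]
  have hτ1 : 1 ≤ τ := hq.trans hqτ
  set T : ℝ := τ ^ e with hT
  have hT1 : 1 ≤ T := Real.one_le_rpow hτ1 he0.le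
  have hpw : ∀ z : ℂ, ‖z‖ + 2 ≤ 2 * (‖s‖ + 2) → (q * (‖z‖ + 2)) ^ e ≤ 2 * T := fun z hz =>
    rpow_le_two_mul (by positivity) (by nlinarith) he0 (by linarith)
  have hU : ∀ (ψ : DirichletCharacter ℂ q) (z : ℂ), 1 < z.re → ‖z‖ + 2 ≤ 2 * (‖s‖ + 2) →
      ‖regularL ψ z‖ ≤ C * T := fun ψ z hz hz2 => by
    refine (h₁ q ψ z (by linarith)).trans ?_
    have := mul_le_mul_of_nonneg_left (hpw z hz2) hC₁.le
    nlinarith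
  have hD : ∀ z : ℂ, 1 ≤ z.re → ‖z‖ + 2 ≤ 2 * (‖s‖ + 2) → ‖deriv (regularL χ) z‖ ≤ C * T :=
    fun z hz hz2 => by
      refine (h₂ q χ z (by linarith)).trans ?_
      have := mul_le_mul_of_nonneg_left (hpw z hz2) hC₂.le
      nlinarith
  have hTε : τ ^ (-ε) = (T ^ 20)⁻¹ := by
    rw [hT, ← Real.rpow_natCast, ← Real.rpow_mul (by linarith), ← Real.rpow_neg (by linarith)]
    congr 1
    rw [he]; push_cast; ring
  rw [hTε]
  set d : ℝ := d₀ / T ^ 2 with hd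
  have hd0 : 0 < d := by positivity
  have hd1 : d ≤ 1 := by
    rw [hd, div_le_one (by positivity)]
    exact hd₀1.trans (one_le_pow₀ hT1)
  by_cases hfar : χ ^ 2 ≠ 1 ∨ d ≤ ‖s - 1‖
  · refine le_trans ?_ (norm_regularL_ge_of_far hs hs2 (K := C * T) (by nlinarith) hd0 hd1 hfar hU
      fun z hz => hD z hz.le)
    calc _ ≤ (d₀ ^ 5 / (2 ^ 4 * 3 ^ 8 * C ^ 8)) * (T ^ 18)⁻¹ := by
          gcongr
          · exact min_le_right _ _
          · norm_num
      _ = _ := by rw [hd]; field_simp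
  · push Not at hfar
    refine le_trans ?_ (norm_regularL_ge_of_near hs (K := C * T) (c := c₁ / T)
          (d := d) (by nlinarith)
      ?_ ?_ hfar.2.le hD)
    · calc _ ≤ c₁ / 2 * (T ^ 1)⁻¹ := by
            gcongr
            · exact min_le_left _ _
            · norm_num
        _ = _ := by field_simp
    · refine le_trans ?_ (h₀ q χ hfar.1)
      rw [Real.rpow_neg (by linarith), div_eq_mul_inv]
      gcongr
      · exact min_le_left _ _
      · exact Real.rpow_le_rpow (by linarith) hqτ he0.le
    · rw [hd, hd₀]
      apply le_of_eq
      field_simp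

end

section

open Complex Filter Topology MeasureTheory Set Metric
open DirichletCharacter

lemma exists_norm_dslope_LFunctionTrivChar₁_le {ε : ℝ} (hε : 0 < ε) (hε1 : ε ≤ 1 / 2) :
    ∃ C : ℝ, 0 < C ∧ ∀ s : ℂ, 1 - ε ≤ s.re →
      ‖dslope (LFunctionTrivChar₁ 1) 1 s‖ ≤ C * (‖s‖ + 2) ^ ε := by
  obtain ⟨C₁, hC₁, h₁⟩ := exists_norm_LFunctionTrivChar₁_le hε hε1
  have hZ1 : LFunctionTrivChar₁ 1 1 = 1 := by simp
  have hcont : Continuous (dslope (LFunctionTrivChar₁ 1) 1) := by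
    rw [continuous_iff_continuousAt]
    intro s
    by_cases h : s = 1
    · rw [h, continuousAt_dslope_same]; exact differentiable_LFunctionTrivChar₁ 1 1
    · rw [continuousAt_dslope_of_ne h]; exact (differentiable_LFunctionTrivChar₁ 1 s).continuousAt
  obtain ⟨C₂, hC₂⟩ := (isCompact_closedBall (1 : ℂ) 1).exists_bound_of_continuousOn
        hcont.continuousOn
  have hC₂0 : 0 ≤ C₂ := (norm_nonneg _).trans (hC₂ 1 (by simp))
  refine ⟨C₁ * 2 + 1 + C₂, by positivity, fun s hs => ?_⟩
  have hτ : 1 ≤ (‖s‖ + 2) ^ ε := Real.one_le_rpow (by linarith [norm_nonneg s]) hε.le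
  by_cases hb : ‖s - 1‖ ≤ 1
  · calc _ ≤ C₂ := hC₂ s (by rwa [mem_closedBall, dist_eq_norm])
      _ ≤ (C₁ * 2 + 1 + C₂) * 1 := by linarith
      _ ≤ _ := by gcongr
  · push Not at hb
    have hs1 : s ≠ 1 := by rintro rfl; norm_num at hb
    rw [dslope_of_ne _ hs1, slope_def_field, hZ1, norm_div, div_le_iff₀ (by linarith)]
    have h := h₁ 1 s hs
    rw [Nat.cast_one, one_mul] at h
    calc _ ≤ ‖LFunctionTrivChar₁ 1 s‖ + 1 := by
          simpa using norm_sub_le (LFunctionTrivChar₁ 1 s) 1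
      _ ≤ C₁ * (‖s - 1‖ + 1) * (‖s‖ + 2) ^ ε + 1 := by gcongr
      _ ≤ C₁ * (‖s - 1‖ + ‖s - 1‖) * (‖s‖ + 2) ^ ε + ‖s - 1‖ * (‖s‖ + 2) ^ ε := by
          exact add_le_add (by gcongr) (by nlinarith)
      _ = (C₁ * 2 + 1) * (‖s‖ + 2) ^ ε * ‖s - 1‖ := by ring
      _ ≤ _ := mul_le_mul_of_nonneg_right
          (mul_le_mul_of_nonneg_right (by linarith) (by positivity)) (norm_nonneg _)

/-- The coefficients `χ(n) Λ(n)`, recentred when `χ` is trivial. -/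
noncomputable def centredCoeff {q : ℕ} (χ : DirichletCharacter ℂ q) (n : ℕ) : ℂ :=
  χ n * ArithmeticFunction.vonMangoldt n - open Classical in if χ = 1 then 1 else 0

/-- The analytic continuation of the Dirichlet series with coefficients `centredCoeff χ`. -/
noncomputable def centredSeries {q : ℕ} [NeZero q] (χ : DirichletCharacter ℂ q) (s : ℂ) : ℂ :=
  -logDeriv (regularL χ) s -
    open Classical in if χ = 1 then (s + 1)⁻¹ + dslope (LFunctionTrivChar₁ 1) 1 s else 0

section
variable {q : ℕ} [NeZero q]

lemma LSeriesSummable_centredCoeff (χ : DirichletCharacter ℂ q) {s : ℂ} (hs : 1 < s.re) :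
    LSeriesSummable (centredCoeff χ) s := by
  have h1 := LSeriesSummable_twist_vonMangoldt χ hs
  by_cases h : χ = 1
  · have : centredCoeff χ = ((fun n : ℕ => χ n) *
        fun n : ℕ => (ArithmeticFunction.vonMangoldt n : ℂ)) - 1 := by
      ext n; simp [centredCoeff, h]
    rw [this]
    exact h1.sub (LSeriesSummable_one_iff.mpr hs)
  · have : centredCoeff χ = ((fun n : ℕ => χ n) *
        fun n : ℕ => (ArithmeticFunction.vonMangoldt n : ℂ)) := by
      ext n; simp [centredCoeff, h]
    rwa [this]

lemma logDeriv_LFunction_one {s : ℂ} (hs : 1 < s.re) :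
    logDeriv (LFunction (1 : DirichletCharacter ℂ q)) s =
      logDeriv (regularL (1 : DirichletCharacter ℂ q)) s + (s + 1)⁻¹ - (s - 1)⁻¹ := by
  have hs1 : ∀ z : ℂ, 1 < z.re → z - 1 ≠ 0 := fun z hz h => by
    rw [sub_eq_zero.mp h] at hz; simp at hz
  have hW : regularL (1 : DirichletCharacter ℂ q) =ᶠ[𝓝 s]
      fun z => (z - 1) * LFunction (1 : DirichletCharacter ℂ q) z / (z + 1) := by
    filter_upwards [(isOpen_lt continuous_const continuous_re).mem_nhds hs] with z hz
    rw [regularL_one, LFunctionTrivChar₁, Function.update_of_ne (sub_ne_zero.mp (hs1 z hz))]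
  have hL : LFunction (1 : DirichletCharacter ℂ q) s ≠ 0 :=
    LFunction_ne_zero_of_one_le_re 1 (.inr (sub_ne_zero.mp (hs1 s hs))) hs.le
  have hLd : DifferentiableAt ℂ (LFunction (1 : DirichletCharacter ℂ q)) s :=
    differentiableAt_LFunction 1 s (.inl (sub_ne_zero.mp (hs1 s hs)))
  have hp := add_one_ne_zero_of_re (zero_lt_one.trans hs)
  have e : logDeriv (regularL (1 : DirichletCharacter ℂ q)) s =
      logDeriv (fun z => (z - 1) * LFunction (1 : DirichletCharacter ℂ q) z / (z + 1)) s := by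
    rw [logDeriv_apply, logDeriv_apply, hW.deriv_eq, hW.eq_of_nhds]
  rw [e, logDeriv_div (f := fun z => (z - 1) * LFunction (1 : DirichletCharacter ℂ q) z)
    (g := fun z => z + 1) s (mul_ne_zero (hs1 s hs) hL) hp
    (by fun_prop) (by fun_prop),
    logDeriv_mul (f := fun z => z - 1) s (hs1 s hs) hL (by fun_prop) hLd]
  simp only [logDeriv_apply, deriv_sub_const, deriv_add_const, deriv_id'']
  simp only [one_div]
  ring

lemma LSeries_centredCoeff (χ : DirichletCharacter ℂ q) {s : ℂ} (hs : 1 < s.re) :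
    LSeries (centredCoeff χ) s = centredSeries χ s := by
  have hs1 : s - 1 ≠ 0 := fun h => by rw [sub_eq_zero.mp h] at hs; simp at hs
  have h1 := LSeriesSummable_twist_vonMangoldt χ hs
  have h2 := LSeries_twist_vonMangoldt_eq χ hs
  have h3 : LSeries (fun n : ℕ => χ n) =ᶠ[𝓝 s] LFunction χ := by
    filter_upwards [(isOpen_lt continuous_const continuous_re).mem_nhds hs] with z hz
    rw [LFunction_eq_LSeries _ hz]
  rw [h3.deriv_eq, h3.eq_of_nhds, neg_div, ← logDeriv_apply] at h2
  by_cases h : χ = 1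
  · subst h
    have : centredCoeff (1 : DirichletCharacter ℂ q) =
        ((fun n : ℕ => (1 : DirichletCharacter ℂ q) n) *
              fun n : ℕ => (ArithmeticFunction.vonMangoldt n : ℂ)) - 1 := by
      ext n; simp [centredCoeff]
    rw [this, LSeries_sub h1 (LSeriesSummable_one_iff.mpr hs), h2, LSeries_one_eq_riemannZeta hs,
      logDeriv_LFunction_one hs, centredSeries, if_pos rfl,
      dslope_of_ne _ (sub_ne_zero.mp hs1), slope_def_field,
      LFunctionTrivChar₁_one_of_ne (sub_ne_zero.mp hs1)]
    have hZ1 : LFunctionTrivChar₁ 1 1 = 1 := by simp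
    rw [hZ1]
    field_simp
    ring
  · have : centredCoeff χ = ((fun n : ℕ => χ n) *
        fun n : ℕ => (ArithmeticFunction.vonMangoldt n : ℂ)) := by
      ext n; simp [centredCoeff, h]
    have hW : regularL χ = LFunction χ := funext (regularL_of_ne h)
    rw [this, h2, centredSeries, if_neg h, hW, sub_zero]

end

open ArithmeticFunction in
theorem exists_norm_iteratedDeriv_centredSeries_le (k : ℕ) :
    ∃ C : ℝ, 0 < C ∧ ∀ (q : ℕ) [NeZero q] (χ : DirichletCharacter ℂ q) (s : ℂ),
      1 < s.re → s.re ≤ 2 →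
        ‖iteratedDeriv k (centredSeries χ) s‖ ≤ C * (q * (‖s‖ + 2)) ^ (1 / 2 : ℝ) := by
  set ε : ℝ := 1 / (4 * (k + 1)) with hε
  have hε0 : 0 < ε := by positivity
  have hε1 : ε ≤ 1 / 2 := by
    rw [hε]
    apply one_div_le_one_div_of_le (by norm_num)
    have : (0 : ℝ) ≤ k := by positivity
    linarith
  obtain ⟨D, hD0, hD⟩ := exists_norm_deriv_regularL_le hε0 hε1
  obtain ⟨c, hc0, hc⟩ := exists_le_norm_regularL hε0 hε1
  obtain ⟨G, hG0, hG⟩ := exists_norm_dslope_LFunctionTrivChar₁_le hε0 hε1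
  set ρ : ℝ := min (ε / 2) (c / (4 * D)) with hρ
  have hρ0 : 0 < ρ := by positivity
  refine ⟨k.factorial * (4 * D / c + 1 + 2 * G) / ρ ^ k, by positivity, fun q _ χ s hs hs2 => ?_⟩
  have hq : (1 : ℝ) ≤ q := by exact_mod_cast NeZero.one_le
  set τ : ℝ := q * (‖s‖ + 2) with hτ
  have hτ1 : 1 ≤ τ := by nlinarith [norm_nonneg s]
  set T : ℝ := τ ^ ε with hT
  have hT1 : 1 ≤ T := Real.one_le_rpow hτ1 hε0.le
  have hTk : T ^ (2 * (k + 1)) = τ ^ (1 / 2 : ℝ) := by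
    rw [hT, ← Real.rpow_natCast, ← Real.rpow_mul (by linarith)]
    congr 1
    rw [hε]; push_cast; field_simp; norm_num
  have hpw : ∀ z : ℂ, ‖z‖ ≤ ‖s‖ + 1 → (q * (‖z‖ + 2)) ^ ε ≤ 2 * T := fun z hz =>
    rpow_le_two_mul (by positivity) (by nlinarith [norm_nonneg s]) hε0 (by linarith)
  set r : ℝ := ρ / T ^ 2 with hr
  have hr0 : 0 < r := by positivity
  have hrρ : r ≤ ρ := div_le_self hρ0.le (one_le_pow₀ hT1)
  have hball : ∀ z ∈ closedBall s r, 1 - ε / 2 ≤ z.re ∧ ‖z‖ ≤ ‖s‖ + 1 := by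
    intro z hz
    rw [mem_closedBall, dist_eq_norm] at hz
    have h1 := (abs_le.mp ((abs_re_le_norm (z - s)).trans hz)).1
    have h2 := norm_le_norm_add_norm_sub s z
    rw [sub_re] at h1
    rw [norm_sub_rev] at h2
    have h3 : ρ ≤ ε / 2 := min_le_left _ _
    exact ⟨by linarith, by linarith⟩
  have hderiv : ∀ z ∈ closedBall s r, ‖deriv (regularL χ) z‖ ≤ 2 * D * T := by
    intro z hz
    obtain ⟨h1, h2⟩ := hball z hz
    calc _ ≤ D * (q * (‖z‖ + 2)) ^ ε := hD q χ z h1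
      _ ≤ D * (2 * T) := by gcongr; exact hpw z h2
      _ = _ := by ring
  have hlow : ∀ z ∈ closedBall s r, c / (2 * T) ≤ ‖regularL χ z‖ := by
    intro z hz
    have h1 : ‖regularL χ s - regularL χ z‖ ≤ 2 * D * T * ‖s - z‖ :=
      (convex_closedBall s r).norm_image_sub_le_of_norm_deriv_le (f := regularL χ)
        (fun w hw => differentiableAt_regularL χ (by linarith [(hball w hw).1]))
        hderiv hz (mem_closedBall_self hr0.le)
    have h2 : ‖s - z‖ ≤ r := by rwa [mem_closedBall, dist_comm, dist_eq_norm] at hz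
    have h3 : 2 * D * T * ‖s - z‖ ≤ c / (2 * T) := by
      calc _ ≤ 2 * D * T * r := by gcongr
        _ ≤ 2 * D * T * ((c / (4 * D)) / T ^ 2) := by
            rw [hr]; gcongr; exact min_le_right _ _
        _ = _ := by field_simp; norm_num
    have h4 := hc q χ s hs hs2
    rw [Real.rpow_neg (by linarith), ← div_eq_mul_inv] at h4
    have h5 := norm_sub_norm_le (regularL χ s) (regularL χ z)
    have h6 : c / T = c / (2 * T) + c / (2 * T) := by field_simp; norm_num
    linarith
  have hne : ∀ z ∈ closedBall s r, regularL χ z ≠ 0 := fun z hz =>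
    norm_pos_iff.mp (lt_of_lt_of_le (by positivity) (hlow z hz))
  have hbound : ∀ z ∈ closedBall s r, ‖centredSeries χ z‖ ≤ (4 * D / c + 1 + 2 * G) * T ^ 2 := by
    intro z hz
    obtain ⟨h1, h2⟩ := hball z hz
    have e1 : ‖logDeriv (regularL χ) z‖ ≤ 4 * D / c * T ^ 2 := by
      rw [logDeriv_apply, norm_div, div_le_iff₀ (norm_pos_iff.mpr (hne z hz))]
      calc _ ≤ 2 * D * T := hderiv z hz
        _ = 4 * D / c * T ^ 2 * (c / (2 * T)) := by field_simp; norm_num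
        _ ≤ _ := by gcongr; exact hlow z hz
    have e2 : ‖(open Classical in if χ = 1 then
          (z + 1)⁻¹ + dslope (LFunctionTrivChar₁ 1) 1 z else 0 : ℂ)‖
        ≤ (1 + 2 * G) * T ^ 2 := by
      split_ifs
      · have e3 : ‖(z + 1)⁻¹‖ ≤ 1 := by
          rw [norm_inv]
          apply inv_le_one_of_one_le₀
          have := re_le_norm (z + 1)
          simp only [add_re, one_re] at this
          linarith
        have e4 : ‖dslope (LFunctionTrivChar₁ 1) 1 z‖ ≤ G * (2 * T) := by
          refine (hG z (by linarith)).trans ?_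
          gcongr
          refine le_trans ?_ (hpw z h2)
          gcongr
          nlinarith [norm_nonneg z]
        refine (norm_add_le _ _).trans ?_
        have e5 : T ≤ T ^ 2 := le_self_pow₀ hT1 two_ne_zero
        have e6 := mul_le_mul_of_nonneg_left e5 hG0.le
        linarith
      · rw [norm_zero]; positivity
    calc _ ≤ ‖logDeriv (regularL χ) z‖ + _ := by
          rw [centredSeries]
          refine (norm_sub_le _ _).trans ?_
          rw [norm_neg]
      _ ≤ 4 * D / c * T ^ 2 + (1 + 2 * G) * T ^ 2 := add_le_add e1 e2
      _ = _ := by ring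
  have hdiff : DiffContOnCl ℂ (centredSeries χ) (ball s r) := by
    refine DifferentiableOn.diffContOnCl_ball (U := {z | 0 < z.re ∧ regularL χ z ≠ 0}) ?_
      fun z hz => ⟨by linarith [(hball z hz).1], hne z hz⟩
    intro z hz
    have ho : IsOpen {z : ℂ | 0 < z.re} := isOpen_lt continuous_const continuous_re
    have hd : DifferentiableOn ℂ (regularL χ) {z : ℂ | 0 < z.re} := fun w hw =>
      (differentiableAt_regularL χ hw).differentiableWithinAt
    have hd' : DifferentiableAt ℂ (deriv (regularL χ)) z :=
      (hd.deriv ho).differentiableAt (ho.mem_nhds hz.1)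
    have h1 : DifferentiableAt ℂ (logDeriv (regularL χ)) z :=
      hd'.div (differentiableAt_regularL χ hz.1) hz.2
    have hds : Differentiable ℂ (dslope (LFunctionTrivChar₁ 1) 1) := by
      rw [← differentiableOn_univ]
      exact (differentiableOn_dslope univ_mem).mpr
            (differentiable_LFunctionTrivChar₁ 1).differentiableOn
    unfold centredSeries
    refine (h1.neg.sub ?_).differentiableWithinAt
    by_cases h : χ = 1
    · simp only [h, if_true]
      have hi : DifferentiableAt ℂ (fun w : ℂ => (w + 1)⁻¹) z :=
        (by fun_prop : DifferentiableAt ℂ (fun w : ℂ => w + 1) z).inv (add_one_ne_zero_of_re hz.1)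
      exact hi.add (hds z)
    · simp only [h, if_false]
      exact differentiableAt_const _
  refine (norm_iteratedDeriv_le_of_forall_mem_sphere_norm_le k hr0 hdiff
    fun z hz => hbound z (sphere_subset_closedBall hz)).trans (le_of_eq ?_)
  rw [← hTk, hr, div_pow]
  field_simp
  ring

theorem exists_norm_LSeries_logMul_centredCoeff_le (k : ℕ) :
    ∃ C : ℝ, 0 < C ∧ ∀ (q : ℕ) [NeZero q] (χ : DirichletCharacter ℂ q) (s : ℂ),
      1 < s.re → s.re ≤ 2 → ‖LSeries (LSeries.logMul^[k] (centredCoeff χ)) s‖ ≤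
        C * (q * (‖s‖ + 2)) ^ (1 / 2 : ℝ) := by
  obtain ⟨C, hC, h⟩ := exists_norm_iteratedDeriv_centredSeries_le k
  refine ⟨C, hC, fun q _ χ s hs hs2 => ?_⟩
  have habs : LSeries.abscissaOfAbsConv (centredCoeff χ) < s.re := by
    have := (LSeriesSummable_centredCoeff χ (s := ((1 + s.re) / 2 : ℝ))
      (by simp; linarith)).abscissaOfAbsConv_le
    refine this.trans_lt ?_
    rw [ofReal_re]
    exact_mod_cast (by linarith : (1 + s.re) / 2 < s.re)
  have he : LSeries (centredCoeff χ) =ᶠ[𝓝 s] centredSeries χ := by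
    filter_upwards [(isOpen_lt continuous_const continuous_re).mem_nhds hs] with z hz
    exact LSeries_centredCoeff χ hz
  have h1 := LSeries_iteratedDeriv k habs
  rw [he.iteratedDeriv_eq k] at h1
  have h2 := h q χ s hs hs2
  rw [h1, norm_mul] at h2
  simpa using h2

end

section

open Complex Filter Topology MeasureTheory Set

/-- The triangular cut-off `u ↦ 1 - u` on `(0, 1]`. -/
noncomputable def triangleCutoff (u : ℝ) : ℂ :=
  indicator (Ioc (0 : ℝ) 1) (fun _ => (1 : ℂ)) u -
    indicator (Ioc (0 : ℝ) 1) (fun t : ℝ => (t : ℂ) ^ (1 : ℂ)) u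

lemma triangleCutoff_of_le {u : ℝ} (hu : 0 < u) (hu1 : u ≤ 1) : triangleCutoff u = 1 - u := by
  simp [triangleCutoff, hu, hu1]

lemma triangleCutoff_of_lt {u : ℝ} (hu : 1 < u) : triangleCutoff u = 0 := by
  simp [triangleCutoff, hu]

lemma continuousAt_triangleCutoff {u : ℝ} (hu : 0 < u) : ContinuousAt triangleCutoff u := by
  have h : (fun v : ℝ => ((max (1 - v) 0 : ℝ) : ℂ)) =ᶠ[𝓝 u] triangleCutoff := by
    filter_upwards [lt_mem_nhds hu] with v hv
    rcases le_or_gt v 1 with h | h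
    · rw [triangleCutoff_of_le hv h, max_eq_left (by linarith)]; push_cast; ring
    · rw [triangleCutoff_of_lt h, max_eq_right (by linarith)]; simp
  refine ContinuousAt.congr ?_ h
  fun_prop

lemma hasMellin_triangleCutoff {s : ℂ} (hs : 0 < s.re) :
    HasMellin triangleCutoff s (1 / s - 1 / (s + 1)) := by
  have h1 := hasMellin_one_Ioc hs
  have h2 := hasMellin_cpow_Ioc 1 (s := s) (by simp; linarith)
  have h3 := hasMellin_sub h1.1 h2.1
  rwa [h1.2, h2.2] at h3

lemma norm_mellin_kernel_le {σ : ℝ} (hσ : 1 < σ) (y : ℝ) :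
    ‖(1 / (σ + y * I) - 1 / (σ + y * I + 1) : ℂ)‖ * (‖(σ + y * I : ℂ)‖ + 2) ^ (1 / 2 : ℝ) ≤
      8 * (1 + ‖y‖) ^ (-(3 / 2) : ℝ) := by
  set s : ℂ := σ + y * I with hs
  have hre : s.re = σ := by simp [hs]
  have him : s.im = y := by simp [hs]
  have h1 : 1 ≤ ‖s‖ := by
    have := re_le_norm s
    rw [hre] at this; linarith
  have hy : ‖y‖ ≤ ‖s‖ := by
    have := abs_im_le_norm s
    rwa [him] at this
  have hs0 : s ≠ 0 := norm_pos_iff.mp (by linarith)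
  have h2 : ‖s‖ ≤ ‖s + 1‖ := by
    rw [← sq_le_sq₀ (norm_nonneg _) (norm_nonneg _), ← normSq_eq_norm_sq, ← normSq_eq_norm_sq,
      normSq_apply, normSq_apply]
    simp only [add_re, add_im, one_re, one_im, hre, him]
    nlinarith
  have hs1 : s + 1 ≠ 0 := norm_pos_iff.mp (by linarith)
  have e : (1 / s - 1 / (s + 1) : ℂ) = 1 / (s * (s + 1)) := by field_simp; ring
  set Y : ℝ := 1 + ‖y‖ with hY
  have hY0 : 0 < Y := by positivity
  have hYs : Y / 2 ≤ ‖s‖ := by linarith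
  rw [e, norm_div, norm_one, norm_mul]
  have hpos : 0 < ‖s‖ := by linarith
  calc 1 / (‖s‖ * ‖s + 1‖) * (‖s‖ + 2) ^ (1 / 2 : ℝ)
      ≤ 1 / (‖s‖ * ‖s‖) * (4 * ‖s‖) ^ (1 / 2 : ℝ) := by gcongr; linarith
    _ = 2 * ‖s‖ ^ (-(3 / 2) : ℝ) := by
        rw [Real.mul_rpow (by norm_num) hpos.le, show (4 : ℝ) = 2 ^ (2 : ℝ) by norm_num,
          ← Real.rpow_mul (by norm_num), show (-(3 / 2) : ℝ) = 1 / 2 - 2 by norm_num,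
          Real.rpow_sub hpos, Real.rpow_two]
        norm_num
        field_simp
    _ ≤ 2 * (Y / 2) ^ (-(3 / 2) : ℝ) := by
        gcongr 2 * ?_
        exact Real.rpow_le_rpow_of_nonpos (by positivity) hYs (by norm_num)
    _ = 2 * 2 ^ (3 / 2 : ℝ) * Y ^ (-(3 / 2) : ℝ) := by
        rw [Real.div_rpow hY0.le (by norm_num),
              Real.rpow_neg (by norm_num : (0:ℝ) ≤ 2), div_inv_eq_mul]
        ring
    _ ≤ 2 * 2 ^ (2 : ℝ) * Y ^ (-(3 / 2) : ℝ) := by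
        gcongr <;> norm_num
    _ = _ := by norm_num

lemma integrable_kernel_bound : Integrable fun y : ℝ => (1 + ‖y‖) ^ (-(3 / 2) : ℝ) :=
  integrable_one_add_norm (by simp; norm_num)

lemma continuous_kernel {σ : ℝ} (hσ : 1 < σ) :
    Continuous fun y : ℝ => (1 / (σ + y * I) - 1 / (σ + y * I + 1) : ℂ) := by
  have h0 : ∀ y : ℝ, (σ + y * I : ℂ) ≠ 0 := fun y h => by
    have := congrArg re h; simp at this; linarith
  have h1 : ∀ y : ℝ, (σ + y * I + 1 : ℂ) ≠ 0 := fun y h => by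
    have := congrArg re h; simp at this; linarith
  exact ((by fun_prop : Continuous fun _ : ℝ => (1 : ℂ)).div (by fun_prop) h0).sub
    ((by fun_prop : Continuous fun _ : ℝ => (1 : ℂ)).div (by fun_prop) h1)

lemma norm_kernel_le {σ : ℝ} (hσ : 1 < σ) (y : ℝ) :
    ‖(1 / (σ + y * I) - 1 / (σ + y * I + 1) : ℂ)‖ ≤ 8 * (1 + ‖y‖) ^ (-(3 / 2) : ℝ) := by
  refine le_trans (le_mul_of_one_le_right (norm_nonneg _) ?_) (norm_mellin_kernel_le hσ y)
  exact Real.one_le_rpow (by linarith [norm_nonneg (σ + y * I : ℂ)]) (by norm_num)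

lemma integrable_kernel {σ : ℝ} (hσ : 1 < σ) :
    Integrable fun y : ℝ => (1 / (σ + y * I) - 1 / (σ + y * I + 1) : ℂ) :=
  (integrable_kernel_bound.const_mul 8).mono' (continuous_kernel hσ).aestronglyMeasurable
    (.of_forall (norm_kernel_le hσ))

lemma integral_cpow_mul_kernel {σ : ℝ} (hσ : 1 < σ) {u : ℝ} (hu : 0 < u) :
    ∫ y : ℝ, (u : ℂ) ^ (-(σ + y * I)) * (1 / (σ + y * I) - 1 / (σ + y * I + 1) : ℂ) =
      2 * Real.pi * triangleCutoff u := by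
  have hm : ∀ y : ℝ, mellin triangleCutoff (σ + y * I) =
      (1 / (σ + y * I) - 1 / (σ + y * I + 1) : ℂ) := fun y =>
    (hasMellin_triangleCutoff (by simp; linarith)).2
  have h := mellinInv_mellin_eq σ triangleCutoff hu
    (hasMellin_triangleCutoff (by simp; linarith)).1
    (by simpa only [VerticalIntegrable, hm] using integrable_kernel hσ)
    (continuousAt_triangleCutoff hu)
  rw [mellinInv] at h
  simp only [hm, smul_eq_mul] at h
  rw [← h]
  have : (Real.pi : ℂ) ≠ 0 := by exact_mod_cast Real.pi_ne_zero
  simp only [real_smul]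
  push_cast
  rw [← mul_assoc, mul_one_div_cancel (mul_ne_zero two_ne_zero this), one_mul]

theorem exists_norm_sum_mul_sub_le :
    ∃ K : ℝ, 0 < K ∧ ∀ (b : ℕ → ℂ) (B : ℝ), (∀ s : ℂ, 1 < s.re → LSeriesSummable b s) →
      (∀ s : ℂ, 1 < s.re → s.re ≤ 2 → ‖LSeries b s‖ ≤ B * (‖s‖ + 2) ^ (1 / 2 : ℝ)) →
      ∀ X : ℝ, 3 ≤ X → ∀ x ≤ X,
        ‖∑ n ∈ Finset.Icc 1 ⌊x⌋₊, b n * (x - n)‖ ≤ K * B * X ^ 2 := by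
  set J : ℝ := ∫ y : ℝ, (1 + ‖y‖) ^ (-(3 / 2) : ℝ) with hJ
  have hJ0 : 0 ≤ J := integral_nonneg fun y => by positivity
  refine ⟨Real.exp 1 * 8 * J + 1, by positivity, fun b B hb hB X hX x hx => ?_⟩
  have hX0 : 0 < X := by linarith
  have hB0 : 0 ≤ B := by
    have h := (norm_nonneg _).trans (hB 2 (by simp) (by simp))
    exact nonneg_of_mul_nonneg_left h (by positivity)
  rcases le_or_gt x 0 with hx0 | hx0
  · simp only [Nat.floor_of_nonpos hx0, Finset.Icc_eq_empty_of_lt zero_lt_one, Finset.sum_empty,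
      norm_zero]
    positivity
  have hxc : (x : ℂ) ≠ 0 := by exact_mod_cast hx0.ne'
  have hlog : 1 ≤ Real.log X := by
    rw [Real.le_log_iff_exp_le hX0]
    linarith [Real.exp_one_lt_d9]
  set σ : ℝ := 1 + 1 / Real.log X with hσ
  have hσ1 : 1 < σ := by rw [hσ]; linarith [one_div_pos.mpr (zero_lt_one.trans_le hlog)]
  have hσ2 : σ ≤ 2 := by rw [hσ]; linarith [(div_le_one (zero_lt_one.trans_le hlog)).mpr hlog]
  have hxσ : x ^ σ ≤ Real.exp 1 * X := by
    refine (Real.rpow_le_rpow hx0.le hx (by linarith)).trans (le_of_eq ?_)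
    rw [hσ, Real.rpow_add hX0, Real.rpow_one, Real.rpow_def_of_pos hX0,
      mul_one_div_cancel (by linarith)]
    ring
  set s : ℝ → ℂ := fun y => σ + y * I with hs
  have hre : ∀ y, (s y).re = σ := fun y => by simp [hs]
  set G : ℝ → ℂ := fun y => 1 / s y - 1 / (s y + 1) with hG
  have hGc : Continuous G := continuous_kernel hσ1
  have hsc : Continuous s := by simp only [hs]; fun_prop
  set F : ℕ → ℝ → ℂ := fun n y => LSeries.term b (s y) n * ((x : ℂ) ^ s y * G y) with hF
  have hnx : ∀ y, ‖(x : ℂ) ^ s y‖ = x ^ σ := fun y => by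
    rw [norm_cpow_eq_rpow_re_of_pos hx0, hre]
  have hnF : ∀ n y, ‖F n y‖ = ‖LSeries.term b (σ : ℂ) n‖ * (x ^ σ) * ‖G y‖ := by
    intro n y
    rw [hF]
    simp only [norm_mul, hnx, LSeries.norm_term_eq, hre, ofReal_re]
    ring
  have hFint : ∀ n, Integrable (F n) := by
    intro n
    refine ((integrable_kernel hσ1).norm.const_mul
      (‖LSeries.term b (σ : ℂ) n‖ * (x ^ σ))).mono' ?_ (.of_forall fun y => (hnF n y).le)
    refine Continuous.aestronglyMeasurable ?_
    have h1 : Continuous fun y => (x : ℂ) ^ s y := hsc.const_cpow (.inl hxc)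
    refine Continuous.mul ?_ (h1.mul hGc)
    rcases eq_or_ne n 0 with rfl | hn
    · simp only [LSeries.term_zero]; exact continuous_const
    · simp only [LSeries.term_of_ne_zero hn]
      exact continuous_const.div (hsc.const_cpow (.inl (by exact_mod_cast hn)))
        fun y => by simp [cpow_eq_zero_iff, hn]
  have hsum : Summable fun n => ∫ y, ‖F n y‖ := by
    simp_rw [hnF, integral_const_mul, mul_assoc]
    exact (hb σ (by simpa using hσ1)).norm.mul_right _
  have hval : ∀ n, ∫ y, F n y =
      if n ∈ Finset.Icc 1 ⌊x⌋₊ then 2 * Real.pi * (b n * (1 - n / x)) else 0 := by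
    intro n
    rcases eq_or_ne n 0 with rfl | hn
    · simp [hF]
    have hn0 : (0 : ℝ) < n := by exact_mod_cast Nat.pos_of_ne_zero hn
    have hnc : (n : ℂ) ≠ 0 := by exact_mod_cast hn
    have e : ∀ y, F n y = b n * (((n / x : ℝ) : ℂ) ^ (-s y) * G y) := by
      intro y
      rw [hF]
      simp only [LSeries.term_of_ne_zero hn]
      rw [div_eq_mul_inv (n : ℝ), ofReal_mul,
        mul_cpow_ofReal_nonneg hn0.le (inv_nonneg.mpr hx0.le), cpow_neg, cpow_neg, ofReal_inv,
        inv_cpow, ofReal_natCast]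
      · field_simp
      · rw [arg_ofReal_of_nonneg hx0.le]; exact Real.pi_ne_zero.symm
    simp_rw [e]
    rw [integral_const_mul, integral_cpow_mul_kernel hσ1 (div_pos hn0 hx0)]
    split_ifs with h
    · rw [triangleCutoff_of_le (div_pos hn0 hx0)
        ((div_le_one hx0).mpr ((Nat.le_floor_iff hx0.le).mp (Finset.mem_Icc.mp h).2))]
      push_cast; ring
    · rw [triangleCutoff_of_lt, mul_zero, mul_zero]
      rw [one_lt_div hx0, ← Nat.floor_lt hx0.le]
      by_contra hc
      exact h (Finset.mem_Icc.mpr ⟨Nat.one_le_iff_ne_zero.mpr hn, by omega⟩)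
  have key := (hasSum_integral_of_summable_integral_norm hFint hsum).tsum_eq
  simp_rw [hval] at key
  rw [tsum_eq_sum (s := Finset.Icc 1 ⌊x⌋₊) (fun n hn => if_neg hn)] at key
  rw [Finset.sum_congr rfl (fun n hn => if_pos hn), ← Finset.mul_sum] at key
  have key2 : ∀ y, ∑' n, F n y = LSeries b (s y) * ((x : ℂ) ^ s y * G y) := fun y => by
    simp only [hF]; rw [tsum_mul_right, LSeries]
  simp_rw [key2] at key
  have hbd : ‖∫ y, LSeries b (s y) * ((x : ℂ) ^ s y * G y)‖ ≤ B * (x ^ σ) * 8 * J := by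
    rw [hJ, ← integral_const_mul]
    refine norm_integral_le_of_norm_le (integrable_kernel_bound.const_mul _)
          (.of_forall fun y => ?_)
    rw [norm_mul, norm_mul, hnx]
    calc _ ≤ (B * (‖s y‖ + 2) ^ (1 / 2 : ℝ)) * (x ^ σ * ‖G y‖) := by
          gcongr; exact hB _ (by rw [hre]; exact hσ1) (by rw [hre]; exact hσ2)
      _ = B * (x ^ σ) * (‖G y‖ * (‖s y‖ + 2) ^ (1 / 2 : ℝ)) := by ring
      _ ≤ B * (x ^ σ) * (8 * (1 + ‖y‖) ^ (-(3 / 2) : ℝ)) := by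
          exact mul_le_mul_of_nonneg_left (norm_mellin_kernel_le hσ1 y) (by positivity)
      _ = _ := by ring
  rw [← key, norm_mul] at hbd
  have hpi : 1 ≤ ‖(2 * Real.pi : ℂ)‖ := by
    rw [norm_mul, norm_real, Real.norm_of_nonneg Real.pi_pos.le]
    simp; linarith [Real.pi_gt_three]
  have e : ∑ n ∈ Finset.Icc 1 ⌊x⌋₊, b n * ((x : ℂ) - n) =
      x * ∑ n ∈ Finset.Icc 1 ⌊x⌋₊, b n * (1 - n / x) := by
    rw [Finset.mul_sum]
    refine Finset.sum_congr rfl fun n _ => ?_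
    field_simp
  rw [e, norm_mul, norm_real, Real.norm_of_nonneg hx0.le]
  set N := ‖∑ n ∈ Finset.Icc 1 ⌊x⌋₊, b n * (1 - n / (x : ℂ))‖
  have hN : N ≤ B * (x ^ σ) * 8 * J :=
    (le_mul_of_one_le_left (norm_nonneg _) hpi).trans hbd
  calc x * N ≤ X * (B * (Real.exp 1 * X) * 8 * J) := by
        gcongr
        exact hN.trans (by gcongr)
    _ = (Real.exp 1 * 8 * J) * B * X ^ 2 := by ring
    _ ≤ _ := by gcongr; linarith

end

section

open Complex Filter Topology

lemma iterate_logMul_apply (k : ℕ) (f : ℕ → ℂ) (n : ℕ) :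
    LSeries.logMul^[k] f n = Complex.log n ^ k * f n := by
  induction k with
  | zero => simp
  | succ k ih => rw [Function.iterate_succ_apply', LSeries.logMul, ih, pow_succ]; ring

/-- `φ(q) Λ(n) - 1` if `n ≡ a (mod q)`, and `-1` otherwise. -/
noncomputable def progressionCoeff {q : ℕ} (a : ZMod q) (n : ℕ) : ℝ :=
  (if a = n then (q.totient : ℝ) * ArithmeticFunction.vonMangoldt n else 0) - 1

lemma sum_char_mul_centredCoeff {q : ℕ} [NeZero q] {a : ZMod q} (ha : IsUnit a) (n : ℕ) :
    ∑ χ : DirichletCharacter ℂ q, χ a⁻¹ * centredCoeff χ n = (progressionCoeff a n : ℝ) := by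
  have h := DirichletCharacter.sum_char_inv_mul_char_eq ℂ ha (n : ZMod q)
  have hu : (1 : DirichletCharacter ℂ q) a⁻¹ = 1 := by
    obtain ⟨u, rfl⟩ := ha
    rw [ZMod.inv_coe_unit]
    exact MulChar.one_apply_coe _
  simp only [centredCoeff, mul_sub, Finset.sum_sub_distrib, ← mul_assoc, ← Finset.sum_mul, h,
    mul_ite, mul_one, mul_zero, Finset.sum_ite_eq', Finset.mem_univ, if_true, hu, progressionCoeff]
  push_cast
  split_ifs <;> simp

theorem exists_abs_sum_progressionCoeff_mul_log_pow_mul_sub_le (k : ℕ) :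
    ∃ C : ℝ, 0 < C ∧ ∀ (q : ℕ) [NeZero q] (a : ZMod q), IsUnit a → ∀ X : ℝ, 3 ≤ X → ∀ x ≤ X,
      |∑ n ∈ Finset.Icc 1 ⌊x⌋₊, progressionCoeff a n * Real.log n ^ k * (x - n)| ≤
        C * q ^ 2 * X ^ 2 := by
  obtain ⟨C, hC, h⟩ := exists_norm_LSeries_logMul_centredCoeff_le k
  obtain ⟨K, hK, hKb⟩ := exists_norm_sum_mul_sub_le
  refine ⟨K * C, by positivity, fun q _ a ha X hX x hx => ?_⟩
  have hq : (1 : ℝ) ≤ q := by exact_mod_cast NeZero.one_le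
  have hχ : ∀ χ : DirichletCharacter ℂ q,
      ‖∑ n ∈ Finset.Icc 1 ⌊x⌋₊, LSeries.logMul^[k] (centredCoeff χ) n * (x - n)‖ ≤
        K * (C * q) * X ^ 2 := by
    intro χ
    refine hKb _ _ (fun s hs => ?_) (fun s hs hs2 => ?_) X hX x hx
    · apply LSeriesSummable_of_abscissaOfAbsConv_lt_re
      rw [LSeries.absicssaOfAbsConv_logPowMul]
      have := (LSeriesSummable_centredCoeff χ (s := ((1 + s.re) / 2 : ℝ))
        (by simp; linarith)).abscissaOfAbsConv_le
      refine this.trans_lt ?_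
      rw [ofReal_re]
      exact_mod_cast (by linarith : (1 + s.re) / 2 < s.re)
    · refine (h q χ s hs hs2).trans ?_
      rw [Real.mul_rpow (by positivity) (by positivity), mul_assoc]
      gcongr
      calc (q : ℝ) ^ (1 / 2 : ℝ) ≤ (q : ℝ) ^ (1 : ℝ) :=
            Real.rpow_le_rpow_of_exponent_le hq (by norm_num)
        _ = q := Real.rpow_one _
  have e : ((∑ n ∈ Finset.Icc 1 ⌊x⌋₊, progressionCoeff a n * Real.log n ^ k * (x - n) : ℝ) : ℂ) =
      ∑ χ : DirichletCharacter ℂ q, χ a⁻¹ *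
        ∑ n ∈ Finset.Icc 1 ⌊x⌋₊, LSeries.logMul^[k] (centredCoeff χ) n * (x - n) := by
    simp_rw [Finset.mul_sum]
    rw [Finset.sum_comm]
    push_cast
    refine Finset.sum_congr rfl fun n _ => ?_
    rw [← sum_char_mul_centredCoeff ha, Finset.sum_mul, Finset.sum_mul]
    refine Finset.sum_congr rfl fun χ _ => ?_
    rw [iterate_logMul_apply]
    ring
  rw [← Real.norm_eq_abs, ← norm_real, e]
  refine (norm_sum_le_of_le (n := fun _ => K * (C * q) * X ^ 2) Finset.univ fun χ _ => ?_).trans ?_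
  · rw [norm_mul]
    exact (mul_le_of_le_one_left (norm_nonneg _) (DirichletCharacter.norm_le_one χ _)).trans (hχ χ)
  · rw [Finset.sum_const, nsmul_eq_mul, Finset.card_univ, ← Nat.card_eq_fintype_card,
      DirichletCharacter.card_eq_totient_of_hasEnoughRootsOfUnity]
    have : (q.totient : ℝ) ≤ q := by exact_mod_cast Nat.totient_le q
    calc _ ≤ q * (K * (C * q) * X ^ 2) := by gcongr
      _ = _ := by ring

lemma abs_sum_le_of_smoothed {a : ℕ → ℝ} {Q l X h : ℝ} (hl0 : 0 ≤ l) (hh : 0 < h) (hhX : h ≤ X)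
    (hl : ∀ n : ℕ, 1 ≤ n → n ≤ 2 * X → -l ≤ a n)
    (hD : ∀ z ≤ 2 * X, |∑ n ∈ Finset.Icc 1 ⌊z⌋₊, a n * (z - n)| ≤ Q) {Y : ℕ} (hY : Y ≤ X) :
    |∑ n ∈ Finset.Icc 1 Y, a n| ≤ 2 * Q / h + (h + 1) * l := by
  set E := ∑ n ∈ Finset.Icc 1 Y, a n with hE
  have hsplit : ∀ {u v : ℕ} (g : ℕ → ℝ), u ≤ v → ∑ n ∈ Finset.Icc 1 v, g n =
      ∑ n ∈ Finset.Icc 1 u, g n + ∑ n ∈ Finset.Ioc u v, g n := by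
    intro u v g huv
    have h1 : Finset.Icc 1 v = Finset.Ioc 0 v := rfl
    have h2 : Finset.Icc 1 u = Finset.Ioc 0 u := rfl
    rw [h1, h2, ← Finset.sum_Ioc_consecutive _ (Nat.zero_le u) huv]
  have hDY := abs_le.mp (hD Y (by linarith))
  rw [Nat.floor_natCast] at hDY
  have hY0 : (0 : ℝ) ≤ Y := by positivity
  have up : E * h ≤ 2 * Q + h * l * h := by
    have h1 := abs_le.mp (hD (Y + h) (by linarith))
    have hf : (⌊h⌋₊ : ℝ) ≤ h := Nat.floor_le hh.le
    rw [add_comm (Y : ℝ) h, Nat.floor_add_natCast hh.le, hsplit _ (Nat.le_add_left Y _)] at h1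
    have h2 : -(h * (l * h)) ≤ ∑ n ∈ Finset.Ioc Y (⌊h⌋₊ + Y), a n * (h + Y - n) := by
      have : ∑ n ∈ Finset.Ioc Y (⌊h⌋₊ + Y), (-(l * h)) ≤
          ∑ n ∈ Finset.Ioc Y (⌊h⌋₊ + Y), a n * (h + Y - n) := by
        refine Finset.sum_le_sum fun n hn => ?_
        rw [Finset.mem_Ioc] at hn
        have n1 : (Y : ℝ) ≤ n := by exact_mod_cast hn.1.le
        have n2 : (n : ℝ) ≤ ⌊h⌋₊ + Y := by exact_mod_cast hn.2
        have := hl n (by omega) (by linarith)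
        nlinarith
      rw [Finset.sum_const, Nat.card_Ioc, nsmul_eq_mul, Nat.add_sub_cancel] at this
      have := mul_le_mul_of_nonneg_right hf (mul_nonneg hl0 hh.le)
      linarith
    have h3 : ∑ n ∈ Finset.Icc 1 Y, a n * (h + Y - n) =
        ∑ n ∈ Finset.Icc 1 Y, a n * (Y - n) + E * h := by
      rw [hE, Finset.sum_mul, ← Finset.sum_add_distrib]
      exact Finset.sum_congr rfl fun n _ => by ring
    linarith
  have low : -(2 * Q + (h + 1) * (l * h)) ≤ E * h := by
    have h1 := abs_le.mp (hD (Y - h) (by linarith))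
    set Z := ⌊(Y : ℝ) - h⌋₊ with hZ
    have hZY : Z ≤ Y := by
      have := Nat.floor_le_floor (by linarith : (Y : ℝ) - h ≤ Y)
      rwa [Nat.floor_natCast] at this
    have hZ1 : (Y : ℝ) - h < Z + 1 := Nat.lt_floor_add_one _
    have h2 : ∑ n ∈ Finset.Ioc Z Y, a n * (Y - h - n) ≤ (h + 1) * (l * h) := by
      have : ∑ n ∈ Finset.Ioc Z Y, a n * (Y - h - n) ≤ ∑ n ∈ Finset.Ioc Z Y, (l * h) := by
        refine Finset.sum_le_sum fun n hn => ?_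
        rw [Finset.mem_Ioc] at hn
        have n1 : (Z : ℝ) + 1 ≤ n := by exact_mod_cast hn.1
        have n2 : (n : ℝ) ≤ Y := by exact_mod_cast hn.2
        have := hl n (by omega) (by linarith)
        nlinarith
      rw [Finset.sum_const, Nat.card_Ioc, nsmul_eq_mul, Nat.cast_sub hZY] at this
      refine this.trans (mul_le_mul_of_nonneg_right (by linarith) (by positivity))
    have h3 := hsplit (fun n => a n * ((Y : ℝ) - h - n)) hZY
    have h4 : ∑ n ∈ Finset.Icc 1 Y, a n * (Y - h - n) =
        ∑ n ∈ Finset.Icc 1 Y, a n * (Y - n) - E * h := by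
      rw [hE, Finset.sum_mul, ← Finset.sum_sub_distrib]
      exact Finset.sum_congr rfl fun n _ => by ring
    linarith
  rw [abs_le]
  have e : 2 * Q / h + (h + 1) * l = (2 * Q + (h + 1) * (l * h)) / h := by field_simp
  rw [e]
  constructor
  · rw [← neg_div, div_le_iff₀ hh]; exact low
  · rw [le_div_iff₀ hh]; nlinarith [mul_nonneg hl0 hh.le]

lemma abs_sum_mul_antitone_le {f g : ℕ → ℝ} {T : ℝ} (hg : Antitone g) (hg0 : ∀ n, 0 ≤ g n)
    {n : ℕ} (hT : ∀ m ≤ n, |∑ i ∈ Finset.range m, f i| ≤ T) :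
    |∑ i ∈ Finset.range n, f i * g i| ≤ g 0 * T := by
  have key : ∀ m ≤ n, |∑ i ∈ Finset.range m, f i * g i - g m * ∑ i ∈ Finset.range m, f i| ≤
      (g 0 - g m) * T := by
    intro m
    induction m with
    | zero => simp
    | succ m ih =>
      intro hm
      have e : ∑ i ∈ Finset.range (m + 1), f i * g i -
          g (m + 1) * ∑ i ∈ Finset.range (m + 1), f i =
          (∑ i ∈ Finset.range m, f i * g i - g m * ∑ i ∈ Finset.range m, f i) +
          (g m - g (m + 1)) * ∑ i ∈ Finset.range (m + 1), f i := by
        rw [Finset.sum_range_succ, Finset.sum_range_succ]; ring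
      rw [e]
      have h0 : 0 ≤ g m - g (m + 1) := sub_nonneg.mpr (hg m.le_succ)
      refine (abs_add_le _ _).trans ?_
      rw [abs_mul, abs_of_nonneg h0]
      have := mul_le_mul_of_nonneg_left (hT (m + 1) hm) h0
      linarith [ih (by omega)]
  have h1 := mul_le_mul_of_nonneg_left (hT n le_rfl) (hg0 n)
  have h2 := abs_add_le (∑ i ∈ Finset.range n, f i * g i - g n * ∑ i ∈ Finset.range n, f i)
    (g n * ∑ i ∈ Finset.range n, f i)
  rw [sub_add_cancel, abs_mul (g n), abs_of_nonneg (hg0 n)] at h2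
  linarith [key n le_rfl]

end

section

open ArithmeticFunction (vonMangoldt vonMangoldt_nonneg vonMangoldt_le_log)

lemma one_le_log_of_three_le {x : ℝ} (hx : 3 ≤ x) : 1 ≤ Real.log x := by
  rw [Real.le_log_iff_exp_le (by linarith)]
  linarith [Real.exp_one_lt_d9]

lemma exists_log_pow_le_mul_sqrt (m : ℕ) :
    ∃ c : ℝ, 0 < c ∧ ∀ x : ℝ, 3 ≤ x → Real.log x ^ m ≤ c * √x := by
  refine ⟨(2 * (m + 1)) ^ (m + 1), by positivity, fun x hx => ?_⟩
  have hx0 : 0 < x := by linarith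
  have hL := one_le_log_of_three_le hx
  set ε : ℝ := 1 / (2 * (m + 1)) with hε
  have hε0 : 0 < ε := by positivity
  calc Real.log x ^ m ≤ Real.log x ^ (m + 1) := pow_le_pow_right₀ hL m.le_succ
    _ ≤ (x ^ ε / ε) ^ (m + 1) := by gcongr; exact Real.log_le_rpow_div hx0.le hε0
    _ = (1 / ε) ^ (m + 1) * (x ^ ε) ^ (m + 1) := by rw [← mul_pow]; ring
    _ = _ := by
        rw [← Real.rpow_natCast (x ^ ε), ← Real.rpow_mul hx0.le, Real.sqrt_eq_rpow, hε]
        push_cast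
        congr 2
        · field_simp
        · field_simp

lemma abs_progressionCoeff_le {q : ℕ} (a : ZMod q) {n : ℕ} {X : ℝ} (hn : 1 ≤ n) (hX : n ≤ X) :
    |progressionCoeff a n| ≤ q * Real.log X + 1 := by
  have h0 : (0 : ℝ) < n := by exact_mod_cast hn
  have h1 : vonMangoldt n ≤ Real.log X :=
    vonMangoldt_le_log.trans (Real.log_le_log h0 hX)
  have hφ : (q.totient : ℝ) ≤ q := by exact_mod_cast Nat.totient_le q
  have h2 := vonMangoldt_nonneg (n := n)
  have h3 : (q.totient : ℝ) * vonMangoldt n ≤ q * Real.log X := by gcongr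
  have h4 : 0 ≤ (q.totient : ℝ) * vonMangoldt n := by positivity
  rw [progressionCoeff]
  split_ifs <;> rw [abs_le] <;> constructor <;> linarith

lemma neg_one_le_progressionCoeff {q : ℕ} (a : ZMod q) (n : ℕ) : -1 ≤ progressionCoeff a n := by
  have h2 := vonMangoldt_nonneg (n := n)
  have h4 : 0 ≤ (q.totient : ℝ) * vonMangoldt n := by positivity
  rw [progressionCoeff]
  split_ifs <;> linarith

lemma exists_abs_sum_progressionCoeff_mul_log_pow_le (N : ℕ) :
    ∃ C : ℝ, 0 < C ∧ ∀ X : ℝ, 3 ≤ X → ∀ (q : ℕ) [NeZero q], q ≤ Real.log X ^ N →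
      ∀ a : ZMod q, IsUnit a → ∀ Y : ℕ, Y ≤ X →
        |∑ n ∈ Finset.Icc 1 Y, progressionCoeff a n * Real.log n ^ (4 * N)| ≤
          C * X * Real.log X ^ (3 * N) := by
  obtain ⟨C, hC, h⟩ := exists_abs_sum_progressionCoeff_mul_log_pow_mul_sub_le (4 * N)
  obtain ⟨c, hc, hlog⟩ := exists_log_pow_le_mul_sqrt N
  refine ⟨8 * C + (1 + c) * 2 ^ (4 * N), by positivity, fun X hX q _ hq a ha Y hY => ?_⟩
  have hX0 : 0 < X := by linarith
  set L := Real.log X with hL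
  have hL1 : 1 ≤ L := one_le_log_of_three_le hX
  have hLc : L ^ N ≤ c * X := (hlog X hX).trans (by
    gcongr
    exact Real.sqrt_le_iff.mpr ⟨hX0.le, by nlinarith⟩)
  have h2X : Real.log (2 * X) ≤ 2 * L := by
    rw [Real.log_mul two_ne_zero hX0.ne']
    linarith [Real.log_two_lt_d9]
  have h2X0 : 0 ≤ Real.log (2 * X) := Real.log_nonneg (by linarith)
  have key := abs_sum_le_of_smoothed (a := fun n => progressionCoeff a n * Real.log n ^ (4 * N))
    (Q := C * q ^ 2 * (2 * X) ^ 2) (l := Real.log (2 * X) ^ (4 * N)) (X := X) (h := X / L ^ N)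
    (by positivity) (by positivity) (div_le_self hX0.le (one_le_pow₀ hL1)) (fun n hn hn2 => ?_)
    (fun z hz => h q a ha (2 * X) (by linarith) z hz) hY
  · refine key.trans ?_
    have e1 : 2 * (C * (q : ℝ) ^ 2 * (2 * X) ^ 2) / (X / L ^ N) ≤ 8 * C * X * L ^ (3 * N) := by
      rw [div_le_iff₀ (by positivity)]
      calc 2 * (C * (q : ℝ) ^ 2 * (2 * X) ^ 2) ≤ 2 * (C * (L ^ N) ^ 2 * (2 * X) ^ 2) := by gcongr
        _ = _ := by rw [mul_comm 3 N, pow_mul]; field_simp; ring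
    have e2 : (X / L ^ N + 1) * Real.log (2 * X) ^ (4 * N) ≤
        (1 + c) * 2 ^ (4 * N) * X * L ^ (3 * N) := by
      have e3 : 1 ≤ c * X / L ^ N := (one_le_div (by positivity)).mpr hLc
      calc _ ≤ (X / L ^ N + c * X / L ^ N) * (2 * L) ^ (4 * N) := by gcongr
        _ = (1 + c) * 2 ^ (4 * N) * X * L ^ (3 * N) := by
          rw [mul_pow, show 4 * N = 3 * N + N by ring, pow_add L]; field_simp
    calc _ ≤ _ := add_le_add e1 e2
      _ = _ := by ring
  · have hn0 : (0 : ℝ) < n := by exact_mod_cast hn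
    have h1 : 0 ≤ Real.log n := Real.log_nonneg (by exact_mod_cast hn)
    have h2 : Real.log n ^ (4 * N) ≤ Real.log (2 * X) ^ (4 * N) :=
      pow_le_pow_left₀ h1 (Real.log_le_log hn0 hn2) _
    have h3 := mul_le_mul_of_nonneg_right (neg_one_le_progressionCoeff a n) (pow_nonneg h1 (4 * N))
    linarith

theorem siegelWalfisz (N : ℕ) :
    ∃ C : ℝ, 0 < C ∧ ∀ X : ℝ, 3 ≤ X → ∀ (q : ℕ) [NeZero q], q ≤ Real.log X ^ N →
      ∀ a : ZMod q, IsUnit a → ∀ Y : ℕ, Y ≤ X →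
        |∑ n ∈ Finset.Icc 1 Y, (if a = n then vonMangoldt n else 0) - Y / q.totient| ≤
          C * X / Real.log X ^ N := by
  obtain ⟨C, hC, h⟩ := exists_abs_sum_progressionCoeff_mul_log_pow_le N
  obtain ⟨c, hc, hlog⟩ := exists_log_pow_le_mul_sqrt (2 * N + 1)
  refine ⟨2 * c + 2 ^ (4 * N) * (2 * C), by positivity, fun X hX q _ hq a ha Y hY => ?_⟩
  have hX0 : 0 < X := by linarith
  set L := Real.log X with hL
  have hL1 : 1 ≤ L := one_le_log_of_three_le hX
  have hφ : (1 : ℝ) ≤ q.totient := by exact_mod_cast Nat.totient_pos.mpr (NeZero.pos q)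
  have hS : ∑ n ∈ Finset.Icc 1 Y, (if a = n then vonMangoldt n else 0) - Y / q.totient =
      (∑ n ∈ Finset.Icc 1 Y, progressionCoeff a n) / q.totient := by
    simp only [progressionCoeff, Finset.sum_sub_distrib, Finset.sum_const, Nat.card_Icc]
    rw [sub_div, Finset.sum_div]
    congr 1
    · refine Finset.sum_congr rfl fun n _ => ?_
      split_ifs
      · field_simp
      · simp
    · simp
  rw [hS, abs_div, abs_of_pos (zero_lt_one.trans_le hφ)]
  refine (div_le_self (abs_nonneg _) hφ).trans ?_
  set Z := ⌊√X⌋₊ with hZ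
  have hsq : √X * √X = X := Real.mul_self_sqrt hX0.le
  have hsq1 : 1 ≤ √X := Real.one_le_sqrt.mpr (by linarith)
  have hZX : (Z : ℝ) ≤ √X := Nat.floor_le (Real.sqrt_nonneg X)
  have hsqX : √X ≤ X := Real.sqrt_le_iff.mpr ⟨hX0.le, by nlinarith⟩
  have hsmall : ∀ W : ℕ, W ≤ Z → |∑ n ∈ Finset.Icc 1 W, progressionCoeff a n| ≤
      2 * c * X / L ^ N := by
    intro W hW
    have hWZ : (W : ℝ) ≤ √X := (Nat.cast_le.mpr hW).trans hZX
    calc _ ≤ ∑ n ∈ Finset.Icc 1 W, (q * L + 1) := by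
          refine (Finset.abs_sum_le_sum_abs _ _).trans (Finset.sum_le_sum fun n hn => ?_)
          rw [Finset.mem_Icc] at hn
          exact abs_progressionCoeff_le a hn.1
            ((Nat.cast_le.mpr hn.2).trans (hWZ.trans hsqX))
      _ = W * (q * L + 1) := by simp [mul_add]
      _ ≤ √X * (L ^ N * L + L ^ N * L) := by
          gcongr
          exact one_le_mul_of_one_le_of_one_le (one_le_pow₀ hL1) hL1
      _ = 2 * √X * L ^ (2 * N + 1) / L ^ N := by
          rw [eq_div_iff (by positivity)]; ring
      _ ≤ 2 * √X * (c * √X) / L ^ N := by gcongr; exact hlog X hX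
      _ = 2 * c * (√X * √X) / L ^ N := by ring
      _ = _ := by rw [hsq]
  rcases le_or_gt Y Z with hYZ | hYZ
  · refine (hsmall Y hYZ).trans ?_
    have : 0 ≤ 2 ^ (4 * N) * (2 * C) := by positivity
    gcongr
    linarith
  · obtain ⟨d, rfl⟩ : ∃ d, Y = Z + d := ⟨Y - Z, by omega⟩
    have hsplit : ∀ (g : ℕ → ℝ) (m : ℕ), ∑ n ∈ Finset.Icc 1 (Z + m), g n =
        ∑ n ∈ Finset.Icc 1 Z, g n + ∑ i ∈ Finset.range m, g (Z + 1 + i) := by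
      intro g m
      induction m with
      | zero => simp
      | succ m ih =>
        rw [← add_assoc, Finset.sum_Icc_succ_top (by omega), ih, Finset.sum_range_succ, add_assoc,
          add_right_comm Z m 1]
    have hZ1 : √X < Z + 1 := Nat.lt_floor_add_one _
    have hlogpos : ∀ i : ℕ, L / 2 ≤ Real.log ((Z + 1 + i : ℕ) : ℝ) := by
      intro i
      rw [hL, ← Real.log_sqrt hX0.le]
      refine Real.log_le_log (by linarith) ?_
      push_cast
      have : (0 : ℝ) ≤ i := by positivity
      linarith
    set g : ℕ → ℝ := fun i => (Real.log ((Z + 1 + i : ℕ) : ℝ) ^ (4 * N))⁻¹ with hg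
    have hganti : Antitone g := by
      intro i j hij
      have h1 := hlogpos i
      simp only [hg]
      have h2 : Real.log ((Z + 1 + i : ℕ) : ℝ) ≤ Real.log ((Z + 1 + j : ℕ) : ℝ) :=
        Real.log_le_log (by positivity) (by exact_mod_cast (by omega : Z + 1 + i ≤ Z + 1 + j))
      have h3 : 0 < Real.log ((Z + 1 + i : ℕ) : ℝ) := by linarith
      gcongr
    have hg0 : ∀ n, 0 ≤ g n := fun n => by
      have h1 := hlogpos n
      have h3 : 0 < Real.log ((Z + 1 + n : ℕ) : ℝ) := by linarith
      simp only [hg]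
      positivity
    have hT : ∀ m ≤ d, |∑ i ∈ Finset.range m, progressionCoeff a (Z + 1 + i) *
        Real.log ((Z + 1 + i : ℕ) : ℝ) ^ (4 * N)| ≤ 2 * C * X * L ^ (3 * N) := by
      intro m hm
      have h1 := abs_le.mp (h X hX q hq a ha Z (hZX.trans hsqX))
      have h2 := abs_le.mp (h X hX q hq a ha (Z + m)
        ((Nat.cast_le.mpr (by omega : Z + m ≤ Z + d)).trans hY))
      rw [hsplit] at h2
      rw [abs_le]
      constructor <;> linarith
    have hmain := abs_sum_mul_antitone_le hganti hg0 hT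
    have he : ∑ i ∈ Finset.range d, progressionCoeff a (Z + 1 + i) *
        Real.log ((Z + 1 + i : ℕ) : ℝ) ^ (4 * N) * g i =
        ∑ i ∈ Finset.range d, progressionCoeff a (Z + 1 + i) := by
      refine Finset.sum_congr rfl fun i _ => ?_
      have h1 := hlogpos i
      have h3 : 0 < Real.log ((Z + 1 + i : ℕ) : ℝ) := by linarith
      simp only [hg]
      rw [mul_assoc, mul_inv_cancel₀ (by positivity), mul_one]
    rw [he] at hmain
    have hg00 : g 0 ≤ 2 ^ (4 * N) / L ^ (4 * N) := by
      have h1 := hlogpos 0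
      simp only [hg]
      calc _ ≤ ((L / 2) ^ (4 * N))⁻¹ := by gcongr
        _ = _ := by rw [div_pow, inv_div]
    have hbig : |∑ i ∈ Finset.range d, progressionCoeff a (Z + 1 + i)| ≤
        2 ^ (4 * N) * (2 * C) * X / L ^ N := by
      refine hmain.trans ?_
      calc _ ≤ 2 ^ (4 * N) / L ^ (4 * N) * (2 * C * X * L ^ (3 * N)) := by gcongr
        _ = _ := by
          rw [show 4 * N = 3 * N + N by ring, pow_add L]; field_simp
    rw [hsplit]
    refine (abs_add_le _ _).trans ((add_le_add (hsmall Z le_rfl) hbig).trans (le_of_eq ?_))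
    ring

end

section

open ArithmeticFunction (moebius IsMultiplicative)

lemma moebius_eq_prod_primeFactors {n : ℕ} (hn : Squarefree n) :
    (moebius n : ℝ) = ∏ _p ∈ n.primeFactors, (-1 : ℝ) := by
  have h := ArithmeticFunction.isMultiplicative_moebius.map_prod_of_subset_primeFactors
        n _ subset_rfl
  rw [Nat.prod_primeFactors_of_squarefree hn] at h
  rw [h, Int.cast_prod]
  refine Finset.prod_congr rfl fun p hp => ?_
  rw [ArithmeticFunction.moebius_apply_prime (Nat.prime_of_mem_primeFactors hp)]
  simp

lemma totient_eq_prod_primeFactors {n : ℕ} (hn : Squarefree n) :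
    (n.totient : ℝ) = ∏ p ∈ n.primeFactors, ((p : ℝ) - 1) := by
  have h := Nat.totient_mul_prod_primeFactors n
  rw [Nat.prod_primeFactors_of_squarefree hn, mul_comm] at h
  rw [Nat.eq_of_mul_eq_mul_left (Nat.pos_of_ne_zero hn.ne_zero) h, Nat.cast_prod]
  refine Finset.prod_congr rfl fun p hp => ?_
  rw [Nat.cast_sub (Nat.prime_of_mem_primeFactors hp).one_le, Nat.cast_one]

lemma moebius_mul_totient {n : ℕ} (hn : Squarefree n) :
    (moebius n : ℝ) * n.totient = ∑ d ∈ n.divisors, (moebius d : ℝ) * d := by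
  have h := IsMultiplicative.prodPrimeFactors_one_sub_of_squarefree
    (ArithmeticFunction.id : ArithmeticFunction ℝ)
    (ArithmeticFunction.isMultiplicative_id.natCast) hn
  simp only [ArithmeticFunction.natCoe_apply, ArithmeticFunction.id_apply] at h
  rw [← h, moebius_eq_prod_primeFactors hn, totient_eq_prod_primeFactors hn,
    ← Finset.prod_mul_distrib]
  exact Finset.prod_congr rfl fun p _ => by ring

lemma moebius_gcd_mul_totient_gcd {r : ℕ} (hr : Squarefree r) (n : ℕ) :
    (moebius (r.gcd n) : ℝ) * (r.gcd n).totient =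
      ∑ d ∈ r.divisors, if d ∣ n then (moebius d : ℝ) * d else 0 := by
  rw [moebius_mul_totient (hr.squarefree_of_dvd (Nat.gcd_dvd_left r n)), ← Finset.sum_filter]
  congr 1
  ext d
  simp only [Nat.mem_divisors, Finset.mem_filter, Nat.dvd_gcd_iff]
  have := hr.ne_zero
  have : r.gcd n ≠ 0 := by simp [this]
  tauto

/-- The weight `μ(r)² / φ(r)`. -/
noncomputable def totientWeight (r : ℕ) : ℝ := (moebius r : ℝ) ^ 2 / r.totient

lemma totientWeight_nonneg (r : ℕ) : 0 ≤ totientWeight r := by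
  unfold totientWeight; positivity

lemma totientWeight_of_squarefree {r : ℕ} (hr : Squarefree r) :
    totientWeight r = 1 / r.totient := by
  have h : (moebius r : ℝ) ^ 2 = 1 := by
    exact_mod_cast ArithmeticFunction.moebius_sq_eq_one_of_squarefree hr
  rw [totientWeight, h]

lemma totientWeight_of_not_squarefree {r : ℕ} (hr : ¬ Squarefree r) : totientWeight r = 0 := by
  simp [totientWeight, ArithmeticFunction.moebius_eq_zero_of_not_squarefree hr]

lemma FR_natCast (R : ℝ) (n : ℕ) :
    FR R n = ∑ r ∈ Finset.Icc 1 ⌊R⌋₊, totientWeight r *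
      ∑ d ∈ r.divisors, if d ∣ n then (moebius d : ℝ) * d else 0 := by
  refine Finset.sum_congr rfl fun r _ => ?_
  rw [Int.gcd_natCast_natCast]
  by_cases hr : Squarefree r
  · rw [← moebius_gcd_mul_totient_gcd hr, totientWeight]; ring
  · simp [totientWeight_of_not_squarefree hr,
        ArithmeticFunction.moebius_eq_zero_of_not_squarefree hr]

/-- `d ↦ gcd(d, m)` restricted to those `d` with `gcd(d, m) ∣ c`: the density in a residue class
`c` modulo `m` of the multiples of `d`, times `d`. -/
noncomputable def gcdDensity (m c : ℕ) : ArithmeticFunction ℝ :=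
  ⟨fun d => if d = 0 then 0 else if d.gcd m ∣ c then (d.gcd m : ℝ) else 0, by simp⟩

lemma gcdDensity_apply (m c : ℕ) {d : ℕ} (hd : d ≠ 0) :
    gcdDensity m c d = if d.gcd m ∣ c then (d.gcd m : ℝ) else 0 := by
  simp [gcdDensity, hd]

lemma isMultiplicative_gcdDensity (m c : ℕ) : (gcdDensity m c).IsMultiplicative := by
  rw [IsMultiplicative.iff_ne_zero]
  refine ⟨by simp [gcdDensity_apply], fun {a b} ha hb hab => ?_⟩
  rw [gcdDensity_apply _ _ ha, gcdDensity_apply _ _ hb, gcdDensity_apply _ _ (mul_ne_zero ha hb)]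
  have h : (a * b).gcd m = a.gcd m * b.gcd m := by
    rw [Nat.gcd_comm, Nat.Coprime.gcd_mul m hab, Nat.gcd_comm m a, Nat.gcd_comm m b]
  have hc : (a.gcd m).Coprime (b.gcd m) :=
    (hab.coprime_dvd_left (Nat.gcd_dvd_left a m)).coprime_dvd_right (Nat.gcd_dvd_left b m)
  have h2 : a.gcd m * b.gcd m ∣ c ↔ a.gcd m ∣ c ∧ b.gcd m ∣ c :=
    ⟨fun h => ⟨(dvd_mul_right _ _).trans h, (dvd_mul_left _ _).trans h⟩,
      fun h => hc.mul_dvd_of_dvd_of_dvd h.1 h.2⟩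
  rw [h]
  simp only [h2]
  by_cases h3 : a.gcd m ∣ c <;> by_cases h4 : b.gcd m ∣ c <;> simp [h3, h4]

lemma abs_card_Ioc_filter_modEq_sub_le {u v r : ℕ} (huv : u ≤ v) (hr : 0 < r) (c : ℕ) :
    |((Finset.Ioc u v).filter (fun n => n ≡ c [MOD r])).card - ((v : ℝ) - u) / r| ≤ 1 := by
  have h := Nat.Ioc_filter_modEq_card u v hr c
  have hr' : (0 : ℚ) < r := by exact_mod_cast hr
  have hle : ((u : ℚ) - c) / r ≤ (v - c) / r := by gcongr
  rw [max_eq_left (sub_nonneg.2 (Int.floor_le_floor hle))] at h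
  have hq : |(((Finset.Ioc u v).filter (fun n => n ≡ c [MOD r])).card : ℚ) - ((v : ℚ) - u) / r|
      ≤ 1 := by
    have h' : (((Finset.Ioc u v).filter (fun n => n ≡ c [MOD r])).card : ℚ) =
      ⌊((v : ℚ) - c) / r⌋ - ⌊((u : ℚ) - c) / r⌋ := by exact_mod_cast h
    have h1 := Int.floor_le (((v : ℚ) - c) / r)
    have h2 := Int.lt_floor_add_one (((v : ℚ) - c) / r)
    have h3 := Int.floor_le (((u : ℚ) - c) / r)
    have h4 := Int.lt_floor_add_one (((u : ℚ) - c) / r)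
    have h5 : ((v : ℚ) - u) / r = (v - c) / r - (u - c) / r := by ring
    rw [h', h5, abs_le]
    constructor <;> linarith
  have h := (Rat.cast_le (K := ℝ)).2 hq
  push_cast at h
  exact h

lemma abs_card_filter_modEq_dvd_sub_le {u v m d : ℕ} (huv : u ≤ v) (hm : 0 < m) (hd : 0 < d)
    (c : ℕ) :
    |((Finset.Ioc u v).filter (fun n => n ≡ c [MOD m] ∧ d ∣ n)).card -
      ((v : ℝ) - u) / (m * d) * gcdDensity m c d| ≤ 1 := by
  rw [gcdDensity_apply _ _ hd.ne']
  split_ifs with h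
  · have hcr : 0 ≡ c [MOD d.gcd m] := (Nat.modEq_zero_iff_dvd.2 h).symm
    obtain ⟨k, hk1, hk2⟩ := Nat.chineseRemainder' hcr
    have hfil : (Finset.Ioc u v).filter (fun n => n ≡ c [MOD m] ∧ d ∣ n) =
        (Finset.Ioc u v).filter (fun n => n ≡ k [MOD d.lcm m]) := by
      refine Finset.filter_congr fun n _ => ⟨fun hn => Nat.mod_lcm ?_ ?_, fun hn => ⟨?_, ?_⟩⟩
      · exact (Nat.modEq_zero_iff_dvd.2 hn.2).trans hk1.symm
      · exact hn.1.trans hk2.symm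
      · exact (hn.of_dvd (Nat.dvd_lcm_right d m)).trans hk2
      · exact Nat.modEq_zero_iff_dvd.1 ((hn.of_dvd (Nat.dvd_lcm_left d m)).trans hk1)
    rw [hfil]
    convert abs_card_Ioc_filter_modEq_sub_le huv (Nat.lcm_pos hd hm) k using 3
    have hgl : ((d.gcd m : ℕ) : ℝ) * (d.lcm m : ℕ) = d * m := by
      exact_mod_cast Nat.gcd_mul_lcm d m
    have h1 : (d.lcm m : ℝ) ≠ 0 := by exact_mod_cast (Nat.lcm_pos hd hm).ne'
    have h2 : (d : ℝ) ≠ 0 := by exact_mod_cast hd.ne'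
    have h3 : (m : ℝ) ≠ 0 := by exact_mod_cast hm.ne'
    field_simp
    linear_combination ((v : ℝ) - u) * hgl
  · have hfil : (Finset.Ioc u v).filter (fun n => n ≡ c [MOD m] ∧ d ∣ n) = ∅ := by
      refine Finset.filter_eq_empty_iff.2 fun n _ hn => h ?_
      have h1 : n ≡ c [MOD d.gcd m] := hn.1.of_dvd (Nat.gcd_dvd_right d m)
      exact Nat.modEq_zero_iff_dvd.1
        (h1.symm.trans (Nat.modEq_zero_iff_dvd.2 ((Nat.gcd_dvd_left d m).trans hn.2)))
    simp [hfil]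

/-- The singular series of `F_R` in the residue class `c` modulo `m`. -/
noncomputable def singularSeries (R : ℝ) (m c : ℕ) : ℝ :=
  ∑ r ∈ Finset.Icc 1 ⌊R⌋₊, totientWeight r *
    ∑ d ∈ r.divisors, (moebius d : ℝ) * gcdDensity m c d

lemma abs_sum_FR_sub_le {u v m : ℕ} (huv : u ≤ v) (hm : 0 < m) (c : ℕ) (R : ℝ) :
    |∑ n ∈ (Finset.Ioc u v).filter (fun n => n ≡ c [MOD m]), FR R n -
      ((v : ℝ) - u) / m * singularSeries R m c| ≤
      ∑ r ∈ Finset.Icc 1 ⌊R⌋₊, totientWeight r * ∑ d ∈ r.divisors, (d : ℝ) := by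
  have h1 : ∑ n ∈ (Finset.Ioc u v).filter (fun n => n ≡ c [MOD m]), FR R n =
      ∑ r ∈ Finset.Icc 1 ⌊R⌋₊, totientWeight r * ∑ d ∈ r.divisors, (moebius d : ℝ) * d *
        ((Finset.Ioc u v).filter (fun n => n ≡ c [MOD m] ∧ d ∣ n)).card := by
    simp only [FR_natCast]
    rw [Finset.sum_comm]
    refine Finset.sum_congr rfl fun r _ => ?_
    rw [← Finset.mul_sum, Finset.sum_comm]
    congr 1
    refine Finset.sum_congr rfl fun d _ => ?_
    rw [← Finset.sum_filter, Finset.filter_filter, Finset.sum_const, nsmul_eq_mul, mul_comm]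
  rw [h1, singularSeries, Finset.mul_sum, ← Finset.sum_sub_distrib]
  refine (Finset.abs_sum_le_sum_abs _ _).trans (Finset.sum_le_sum fun r _ => ?_)
  rw [mul_left_comm, ← mul_sub, abs_mul, abs_of_nonneg (totientWeight_nonneg r), Finset.mul_sum,
    ← Finset.sum_sub_distrib]
  refine mul_le_mul_of_nonneg_left ?_ (totientWeight_nonneg r)
  refine (Finset.abs_sum_le_sum_abs _ _).trans (Finset.sum_le_sum fun d hd => ?_)
  have hd0 : 0 < d := Nat.pos_of_mem_divisors hd
  have hd' : (d : ℝ) ≠ 0 := by exact_mod_cast hd0.ne'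
  have hm' : (m : ℝ) ≠ 0 := by exact_mod_cast hm.ne'
  have hμ : |(moebius d : ℝ)| ≤ 1 := by exact_mod_cast ArithmeticFunction.abs_moebius_le_one
  calc _ = |(moebius d : ℝ)| * d * |((Finset.Ioc u v).filter
        (fun n => n ≡ c [MOD m] ∧ d ∣ n)).card - ((v : ℝ) - u) / (m * d) * gcdDensity m c d| := by
        rw [← abs_of_nonneg (Nat.cast_nonneg (α := ℝ) d), ← abs_mul, ← abs_mul, mul_sub,
          abs_of_nonneg (Nat.cast_nonneg (α := ℝ) d)]
        congr 2
        field_simp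
    _ ≤ 1 * d * 1 := by
        gcongr
        exact abs_card_filter_modEq_dvd_sub_le huv hm hd0 c
    _ = d := by ring

end

section

open ArithmeticFunction (moebius IsMultiplicative)
open UniqueFactorizationMonoid (radical)

lemma sum_moebius_mul_gcdDensity (m c : ℕ) {r : ℕ} (hr : Squarefree r) :
    ∑ d ∈ r.divisors, (moebius d : ℝ) * gcdDensity m c d =
      ∏ p ∈ r.primeFactors, (1 - gcdDensity m c p) :=
  (IsMultiplicative.prodPrimeFactors_one_sub_of_squarefree _
    (isMultiplicative_gcdDensity m c) hr).symm

lemma gcdDensity_prime_of_not_dvd {m p : ℕ} (c : ℕ) (hp : p.Prime) (h : ¬ p ∣ m) :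
    gcdDensity m c p = 1 := by
  rw [gcdDensity_apply _ _ hp.ne_zero, (hp.coprime_iff_not_dvd.2 h).gcd_eq_one]
  simp

lemma gcdDensity_prime_of_dvd {m p : ℕ} (c : ℕ) (hp : p.Prime) (h : p ∣ m) :
    gcdDensity m c p = if p ∣ c then (p : ℝ) else 0 := by
  rw [gcdDensity_apply _ _ hp.ne_zero, Nat.gcd_eq_left h]

lemma totientWeight_mul_sum_eq_zero {m r : ℕ} (c : ℕ) (h : ¬ r ∣ radical m) (hm : 0 < m) :
    totientWeight r * ∑ d ∈ r.divisors, (moebius d : ℝ) * gcdDensity m c d = 0 := by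
  by_cases hr : Squarefree r
  · rw [sum_moebius_mul_gcdDensity m c hr]
    have hrm : ¬ r ∣ m := fun hrm => h
          ((UniqueFactorizationMonoid.dvd_radical_iff hr.isRadical hm.ne').2 hrm)
    obtain ⟨p, hp, hpm⟩ : ∃ p ∈ r.primeFactors, ¬ p ∣ m := by
      by_contra! hall
      refine hrm ?_
      rw [← Nat.prod_primeFactors_of_squarefree hr]
      exact Finset.prod_primes_dvd _ (fun p hp => (Nat.prime_of_mem_primeFactors hp).prime)
        hall
    rw [Finset.prod_eq_zero hp, mul_zero]
    rw [gcdDensity_prime_of_not_dvd c (Nat.prime_of_mem_primeFactors hp) hpm, sub_self]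
  · rw [totientWeight_of_not_squarefree hr, zero_mul]

lemma totientWeight_mul_sum_eq {m r : ℕ} (c : ℕ) (hr : Squarefree r) :
    totientWeight r * ∑ d ∈ r.divisors, (moebius d : ℝ) * gcdDensity m c d =
      ∏ p ∈ r.primeFactors, (1 - gcdDensity m c p) / ((p : ℝ) - 1) := by
  rw [sum_moebius_mul_gcdDensity m c hr, totientWeight_of_squarefree hr,
    totient_eq_prod_primeFactors hr, Finset.prod_div_distrib]
  ring

lemma abs_totientWeight_mul_sum_le {m r : ℕ} (c : ℕ) (hm : 0 < m) :
    |totientWeight r * ∑ d ∈ r.divisors, (moebius d : ℝ) * gcdDensity m c d| ≤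
      if r ∣ m then 1 else 0 := by
  by_cases h : r ∣ radical m
  · have hrm : r ∣ m := h.trans (UniqueFactorizationMonoid.radical_dvd_self)
    have hr : Squarefree r := UniqueFactorizationMonoid.squarefree_radical.squarefree_of_dvd h
    rw [if_pos hrm, totientWeight_mul_sum_eq c hr, Finset.abs_prod]
    refine Finset.prod_le_one (fun _ _ => abs_nonneg _) fun p hp => ?_
    have hpp := Nat.prime_of_mem_primeFactors hp
    have h2 : (2 : ℝ) ≤ p := by exact_mod_cast hpp.two_le
    rw [gcdDensity_prime_of_dvd c hpp ((Nat.dvd_of_mem_primeFactors hp).trans hrm), abs_div,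
      abs_of_pos (by linarith : (0 : ℝ) < (p : ℝ) - 1), div_le_one (by linarith)]
    split_ifs
    · rw [abs_sub_comm, abs_of_pos (by linarith)]
    · rw [sub_zero, abs_one]; linarith
  · rw [totientWeight_mul_sum_eq_zero c h hm, abs_zero]
    split_ifs <;> norm_num

lemma abs_singularSeries_le (R : ℝ) {m : ℕ} (c : ℕ) (hm : 0 < m) :
    |singularSeries R m c| ≤ m := by
  refine (Finset.abs_sum_le_sum_abs _ _).trans ?_
  refine (Finset.sum_le_sum fun r _ => abs_totientWeight_mul_sum_le c hm).trans ?_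
  rw [← Finset.sum_filter, Finset.sum_const, nsmul_eq_mul, mul_one]
  have h : (Finset.Icc 1 ⌊R⌋₊).filter (fun r => r ∣ m) ⊆ Finset.Icc 1 m := by
    intro r hr
    simp only [Finset.mem_filter, Finset.mem_Icc] at hr ⊢
    exact ⟨hr.1.1, Nat.le_of_dvd hm hr.2⟩
  have h2 := Finset.card_le_card h
  rw [Nat.card_Icc, Nat.add_sub_cancel] at h2
  exact_mod_cast h2

lemma singularSeries_eq_prod {R : ℝ} {m : ℕ} (c : ℕ) (hm : 0 < m) (hR : m ≤ R) :
    singularSeries R m c =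
      ∏ p ∈ m.primeFactors, (if p ∣ c then 0 else (p : ℝ) / ((p : ℝ) - 1)) := by
  have hrad : Squarefree (radical m) := UniqueFactorizationMonoid.squarefree_radical
  have hle : radical m ≤ m := Nat.le_of_dvd hm UniqueFactorizationMonoid.radical_dvd_self
  have hsub : (radical m).divisors ⊆ Finset.Icc 1 ⌊R⌋₊ := by
    intro r hr
    rw [Finset.mem_Icc]
    exact ⟨Nat.pos_of_mem_divisors hr,
      (Nat.divisor_le hr).trans (hle.trans (Nat.le_floor hR))⟩
  set h : ℕ → ℝ := fun p => (1 - gcdDensity m c p) / ((p : ℝ) - 1)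
  have hsum : singularSeries R m c =
      ∑ r ∈ (radical m).divisors, ArithmeticFunction.prodPrimeFactors h r := by
    rw [singularSeries, ← Finset.sum_subset hsub]
    · refine Finset.sum_congr rfl fun r hr => ?_
      have hr' := Nat.mem_divisors.1 hr
      rw [totientWeight_mul_sum_eq c (hrad.squarefree_of_dvd hr'.1),
        ArithmeticFunction.prodPrimeFactors_apply (Nat.pos_of_mem_divisors hr).ne']
    · intro r _ hr
      exact totientWeight_mul_sum_eq_zero c
        (fun h => hr (Nat.mem_divisors.2 ⟨h, hrad.ne_zero⟩)) hm
  rw [hsum, ← IsMultiplicative.prodPrimeFactors_one_add_of_squarefree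
    (IsMultiplicative.prodPrimeFactors h) hrad, Nat.primeFactors_radical]
  refine Finset.prod_congr rfl fun p hp => ?_
  have hpp := Nat.prime_of_mem_primeFactors hp
  have h2 : (2 : ℝ) ≤ p := by exact_mod_cast hpp.two_le
  have h3 : (p : ℝ) - 1 ≠ 0 := by linarith
  rw [ArithmeticFunction.prodPrimeFactors_apply hpp.ne_zero, hpp.primeFactors,
    Finset.prod_singleton]
  simp only [gcdDensity_prime_of_dvd c hpp (Nat.dvd_of_mem_primeFactors hp)]
  split_ifs <;> field_simp <;> ring

lemma singularSeries_of_coprime {R : ℝ} {m c : ℕ} (hm : 0 < m) (hR : m ≤ R) (hc : c.Coprime m) :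
    singularSeries R m c = m / m.totient := by
  rw [singularSeries_eq_prod c hm hR]
  have h1 : ∀ p ∈ m.primeFactors, (if p ∣ c then 0 else (p : ℝ) / ((p : ℝ) - 1)) =
      (p : ℝ) / (p - 1 : ℕ) := by
    intro p hp
    have hpp := Nat.prime_of_mem_primeFactors hp
    rw [if_neg fun h => Nat.not_coprime_of_dvd_of_dvd hpp.one_lt h
      (Nat.dvd_of_mem_primeFactors hp) hc, Nat.cast_sub hpp.one_le, Nat.cast_one]
  rw [Finset.prod_congr rfl h1, Finset.prod_div_distrib, div_eq_div_iff]
  · have := Nat.totient_mul_prod_primeFactors m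
    rw [← Nat.cast_prod, ← Nat.cast_prod, mul_comm]
    exact_mod_cast this
  · refine Finset.prod_ne_zero_iff.2 fun p hp => ?_
    have := (Nat.prime_of_mem_primeFactors hp).two_le
    exact_mod_cast (by omega : p - 1 ≠ 0)
  · exact_mod_cast (Nat.totient_pos.2 hm).ne'

lemma singularSeries_of_not_coprime {R : ℝ} {m c : ℕ} (hm : 0 < m) (hR : m ≤ R)
    (hc : ¬ c.Coprime m) : singularSeries R m c = 0 := by
  obtain ⟨p, hp, hpc, hpm⟩ := Nat.Prime.not_coprime_iff_dvd.1 hc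
  rw [singularSeries_eq_prod c hm hR]
  exact Finset.prod_eq_zero (Nat.mem_primeFactors.2 ⟨hp, hpm, hm.ne'⟩) (if_pos hpc)

lemma prod_add_one_div_sub_one_le (s : Finset ℕ) (hs : ∀ p ∈ s, 2 ≤ p) :
    ∏ p ∈ s, ((p : ℝ) + 1) / (p - 1) ≤ (s.card + 1) * (s.card + 2) / 2 ∧
      ∀ p ∈ s, (∀ q ∈ s, q ≤ p) → s.card + 1 ≤ p := by
  induction s using Finset.induction_on_max with
  | empty => simp
  | insert p s hlt ih =>
    obtain ⟨ih1, ih2⟩ := ih fun q hq => hs q (Finset.mem_insert_of_mem hq)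
    have hps : p ∉ s := fun h => (hlt p h).false
    have hp2 : 2 ≤ p := hs p (Finset.mem_insert_self p s)
    have hp : s.card + 2 ≤ p := by
      rcases s.eq_empty_or_nonempty with rfl | hne
      · simpa using hp2
      · have h1 := ih2 _ (s.max'_mem hne) fun q hq => s.le_max' q hq
        have h2 := hlt _ (s.max'_mem hne)
        omega
    rw [Finset.card_insert_of_notMem hps, Finset.prod_insert hps]
    refine ⟨?_, fun q hq hmax => ?_⟩
    · have hp' : (s.card : ℝ) + 2 ≤ p := by exact_mod_cast hp
      have hk : (0 : ℝ) ≤ s.card := by positivity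
      have h1 : ((p : ℝ) + 1) / (p - 1) ≤ (s.card + 3) / (s.card + 1) := by
        rw [div_le_div_iff₀ (by linarith) (by linarith)]
        nlinarith
      calc _ ≤ ((s.card : ℝ) + 3) / (s.card + 1) * ((s.card + 1) * (s.card + 2) / 2) := by
            refine mul_le_mul h1 ih1 (Finset.prod_nonneg fun q hq => ?_) (by positivity)
            have h2 : (2 : ℝ) ≤ q := by exact_mod_cast hs q (Finset.mem_insert_of_mem hq)
            exact div_nonneg (by linarith) (by linarith)
        _ = _ := by push_cast; field_simp; ring
    · exact le_trans (by omega) (hmax p (Finset.mem_insert_self p s))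

lemma totientWeight_mul_sum_divisors_le (r : ℕ) :
    totientWeight r * ∑ d ∈ r.divisors, (d : ℝ) ≤ (r.primeFactors.card + 1) ^ 2 := by
  by_cases hr : Squarefree r
  · have h := IsMultiplicative.prodPrimeFactors_one_add_of_squarefree
      (f := (ArithmeticFunction.id : ArithmeticFunction ℝ))
      (ArithmeticFunction.isMultiplicative_id.natCast) hr
    simp only [ArithmeticFunction.natCoe_apply, ArithmeticFunction.id_apply] at h
    rw [totientWeight_of_squarefree hr, ← h, totient_eq_prod_primeFactors hr, one_div,
      mul_comm, ← div_eq_mul_inv, ← Finset.prod_div_distrib]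
    have h1 := (prod_add_one_div_sub_one_le r.primeFactors
      fun p hp => (Nat.prime_of_mem_primeFactors hp).two_le).1
    have hk : (0 : ℝ) ≤ r.primeFactors.card := by positivity
    calc _ = ∏ p ∈ r.primeFactors, ((p : ℝ) + 1) / (p - 1) :=
          Finset.prod_congr rfl fun p _ => by rw [add_comm]
      _ ≤ _ := h1
      _ ≤ _ := by nlinarith
  · rw [totientWeight_of_not_squarefree hr, zero_mul]
    positivity

lemma card_primeFactors_le_two_mul_log {r : ℕ} (hr : 1 ≤ r) :
    (r.primeFactors.card : ℝ) ≤ 2 * Real.log r := by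
  have h1 : 2 ^ r.primeFactors.card ≤ r := by
    calc 2 ^ r.primeFactors.card ≤ ∏ p ∈ r.primeFactors, p :=
          Finset.pow_card_le_prod _ _ _ fun p hp => (Nat.prime_of_mem_primeFactors hp).two_le
      _ ≤ r := Nat.le_of_dvd hr (Nat.prod_primeFactors_dvd r)
  have h2 : Real.log ((2 : ℝ) ^ r.primeFactors.card) ≤ Real.log r :=
    Real.log_le_log (by positivity) (by exact_mod_cast h1)
  rw [Real.log_pow] at h2
  have h3 := Real.log_two_gt_d9
  have h4 : (0 : ℝ) ≤ r.primeFactors.card := by positivity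
  nlinarith

lemma sum_totientWeight_mul_sum_divisors_le {x R : ℝ} (hx : 3 ≤ x) (hR0 : 0 ≤ R) (hR : R ≤ √x) :
    ∑ r ∈ Finset.Icc 1 ⌊R⌋₊, totientWeight r * ∑ d ∈ r.divisors, (d : ℝ) ≤
      4 * R * Real.log x ^ 2 := by
  have hL := one_le_log_of_three_le hx
  have hr : ∀ r ∈ Finset.Icc 1 ⌊R⌋₊, totientWeight r * ∑ d ∈ r.divisors, (d : ℝ) ≤
      4 * Real.log x ^ 2 := by
    intro r hr
    rw [Finset.mem_Icc] at hr
    have hrR : (r : ℝ) ≤ √x := ((Nat.le_floor_iff hR0).1 hr.2).trans hR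
    have h1 : Real.log r ≤ Real.log x / 2 := by
      rw [← Real.log_sqrt (by linarith)]
      exact Real.log_le_log (by exact_mod_cast hr.1) hrR
    have h2 := card_primeFactors_le_two_mul_log hr.1
    calc _ ≤ ((r.primeFactors.card : ℝ) + 1) ^ 2 := totientWeight_mul_sum_divisors_le r
      _ ≤ (2 * Real.log x) ^ 2 := by gcongr; linarith
      _ = _ := by ring
  refine (Finset.sum_le_sum hr).trans ?_
  rw [Finset.sum_const, Nat.card_Icc, Nat.add_sub_cancel, nsmul_eq_mul]
  have := Nat.floor_le hR0
  calc _ ≤ R * (4 * Real.log x ^ 2) := by gcongr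
    _ = _ := by ring

end

section

open ArithmeticFunction (vonMangoldt vonMangoldt_nonneg vonMangoldt_le_log)

lemma sum_filter_modEq_vonMangoldt_eq {u v m : ℕ} (huv : u ≤ v) (c : ℕ) :
    ∑ n ∈ (Finset.Ioc u v).filter (fun n => n ≡ c [MOD m]), vonMangoldt n =
      ∑ n ∈ Finset.Icc 1 v, (if (c : ZMod m) = n then vonMangoldt n else 0) -
        ∑ n ∈ Finset.Icc 1 u, (if (c : ZMod m) = n then vonMangoldt n else 0) := by
  have h : ∀ w : ℕ, Finset.Icc 1 w = Finset.Ioc 0 w := fun w => by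
    ext; simp only [Finset.mem_Icc, Finset.mem_Ioc]; omega
  rw [h, h, ← Finset.sum_Ioc_consecutive _ (Nat.zero_le u) huv, add_sub_cancel_left,
    Finset.sum_filter]
  refine Finset.sum_congr rfl fun n _ => ?_
  congr 1
  rw [ZMod.natCast_eq_natCast_iff]
  exact propext ⟨Nat.ModEq.symm, Nat.ModEq.symm⟩

lemma sum_not_coprime_vonMangoldt_eq (m Y : ℕ) [NeZero m] :
    ∑ n ∈ (Finset.Icc 1 Y).filter (fun n => ¬ n.Coprime m), vonMangoldt n =
      ∑ n ∈ Finset.Icc 1 Y, vonMangoldt n -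
        ∑ b : (ZMod m)ˣ, ∑ n ∈ Finset.Icc 1 Y, if (b : ZMod m) = n then vonMangoldt n else 0 := by
  rw [Finset.sum_comm, ← Finset.sum_sub_distrib, Finset.sum_filter]
  refine Finset.sum_congr rfl fun n _ => ?_
  by_cases hn : n.Coprime m
  · obtain ⟨b, hb⟩ := (ZMod.isUnit_iff_coprime n m).2 hn
    rw [if_neg (not_not.2 hn), Finset.sum_eq_single b, if_pos hb, sub_self]
    · intro b' _ hb'
      rw [if_neg]
      intro h
      exact hb' (Units.ext (h.trans hb.symm))
    · simp
  · rw [if_pos hn, Finset.sum_eq_zero, sub_zero]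
    intro b _
    rw [if_neg]
    intro h
    exact hn ((ZMod.isUnit_iff_coprime n m).1 (h ▸ b.isUnit))

lemma exists_sum_not_coprime_vonMangoldt_le (N : ℕ) :
    ∃ C : ℝ, 0 < C ∧ ∀ x : ℝ, 3 ≤ x → ∀ m : ℕ, 1 ≤ m → m ≤ Real.log x ^ N → ∀ Y : ℕ, Y ≤ x →
      ∑ n ∈ (Finset.Icc 1 Y).filter (fun n => ¬ n.Coprime m), vonMangoldt n ≤
        C * m * x / Real.log x ^ N := by
  obtain ⟨C, hC, h⟩ := siegelWalfisz N
  refine ⟨2 * C, by positivity, fun x hx m hm hmL Y hY => ?_⟩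
  have hL := one_le_log_of_three_le hx
  have : NeZero m := ⟨by omega⟩
  have hm1 : (1 : ℝ) ≤ m := by exact_mod_cast hm
  set E := C * x / Real.log x ^ N with hE
  have hE0 : 0 ≤ E := by positivity
  have h1 := h x hx 1 (by simpa using one_le_pow₀ hL) 1 isUnit_one Y hY
  have h1' : ∑ n ∈ Finset.Icc 1 Y, vonMangoldt n ≤ Y + E := by
    have h2 := (abs_le.1 h1).2
    have h3 : ∀ n ∈ Finset.Icc 1 Y, (if (1 : ZMod 1) = (n : ℕ) then vonMangoldt n else 0) =
        vonMangoldt n := fun n _ => if_pos (Subsingleton.elim _ _)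
    rw [Finset.sum_congr rfl h3, Nat.totient_one, Nat.cast_one, div_one] at h2
    linarith
  have h2 : (Y : ℝ) - m.totient * E ≤
      ∑ b : (ZMod m)ˣ, ∑ n ∈ Finset.Icc 1 Y, if (b : ZMod m) = n then vonMangoldt n else 0 := by
    have h3 : ∀ b ∈ (Finset.univ : Finset (ZMod m)ˣ), (Y : ℝ) / m.totient - E ≤
        ∑ n ∈ Finset.Icc 1 Y, if (b : ZMod m) = n then vonMangoldt n else 0 := fun b _ => by
      have := (abs_le.1 (h x hx m hmL b b.isUnit Y hY)).1
      linarith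
    refine le_trans (le_of_eq ?_) (Finset.sum_le_sum h3)
    have h4 : (m.totient : ℝ) ≠ 0 := by exact_mod_cast (Nat.totient_pos.2 hm).ne'
    rw [Finset.sum_const, Finset.card_univ, ZMod.card_units_eq_totient, nsmul_eq_mul]
    field_simp
  have h5 : (m.totient : ℝ) ≤ m := by exact_mod_cast Nat.totient_le m
  rw [sum_not_coprime_vonMangoldt_eq]
  calc _ ≤ (Y + E) - (Y - m.totient * E) := sub_le_sub h1' h2
    _ = E + m.totient * E := by ring
    _ ≤ m * E + m * E := by gcongr; nlinarith
    _ = _ := by rw [hE]; ring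

lemma abs_sum_modEq_FR_sub_le {x R : ℝ} (hx : 3 ≤ x) (hR0 : 0 ≤ R) (hR : R ≤ √x) {u v m : ℕ}
    (huv : u ≤ v) (hm : 0 < m) (c : ℕ) :
    |∑ n ∈ (Finset.Ioc u v).filter (fun n => n ≡ c [MOD m]), FR R n -
      ((v : ℝ) - u) / m * singularSeries R m c| ≤ 4 * R * Real.log x ^ 2 :=
  (abs_sum_FR_sub_le huv hm c R).trans (sum_totientWeight_mul_sum_divisors_le hx hR0 hR)

theorem exists_abs_sum_modEq_vonMangoldt_sub_FR_le (N : ℕ) :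
    ∃ C : ℝ, 0 < C ∧ ∀ x : ℝ, 3 ≤ x → ∀ m : ℕ, 1 ≤ m → m ≤ Real.log x ^ N →
      ∀ R : ℝ, m ≤ R → R ≤ √x → ∀ c u v : ℕ, u ≤ v → v ≤ x →
        |∑ n ∈ (Finset.Ioc u v).filter (fun n => n ≡ c [MOD m]), (vonMangoldt n - FR R n)| ≤
          C * m * x / Real.log x ^ N + 4 * R * Real.log x ^ 2 := by
  obtain ⟨C₁, hC₁, h₁⟩ := siegelWalfisz N
  obtain ⟨C₂, hC₂, h₂⟩ := exists_sum_not_coprime_vonMangoldt_le N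
  refine ⟨2 * C₁ + C₂, by positivity, fun x hx m hm hmL R hmR hR c u v huv hv => ?_⟩
  have hL := one_le_log_of_three_le hx
  have : NeZero m := ⟨by omega⟩
  have hm1 : (1 : ℝ) ≤ m := by exact_mod_cast hm
  have hR0 : 0 ≤ R := by linarith
  have huv' : (u : ℝ) ≤ v := by exact_mod_cast huv
  set E := x / Real.log x ^ N with hE
  have hE0 : 0 ≤ E := by positivity
  have hFR := abs_sum_modEq_FR_sub_le hx hR0 hR huv hm c
  have hmain : |∑ n ∈ (Finset.Ioc u v).filter (fun n => n ≡ c [MOD m]), vonMangoldt n -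
      ((v : ℝ) - u) / m * singularSeries R m c| ≤ (2 * C₁ + C₂) * m * E := by
    by_cases hc : c.Coprime m
    · rw [singularSeries_of_coprime hm hmR hc, sum_filter_modEq_vonMangoldt_eq huv]
      have hu := (ZMod.isUnit_iff_coprime c m).2 hc
      have hv1 := h₁ x hx m hmL c hu v hv
      have hu1 := h₁ x hx m hmL c hu u (huv'.trans hv)
      have h4 : (m.totient : ℝ) ≠ 0 := by exact_mod_cast (Nat.totient_pos.2 hm).ne'
      have heq : ((v : ℝ) - u) / m * (m / m.totient) = v / m.totient - u / m.totient := by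
        field_simp
      rw [heq, sub_sub_sub_comm]
      refine (abs_sub _ _).trans ((add_le_add hv1 hu1).trans ?_)
      rw [mul_div_assoc, ← hE]
      have : 0 ≤ C₁ * E := by positivity
      have : 0 ≤ C₂ * m * E := by positivity
      nlinarith
    · rw [singularSeries_of_not_coprime hm hmR hc, mul_zero, sub_zero,
        abs_of_nonneg (Finset.sum_nonneg fun n _ => vonMangoldt_nonneg)]
      have hsub : (Finset.Ioc u v).filter (fun n => n ≡ c [MOD m]) ⊆
          (Finset.Icc 1 v).filter (fun n => ¬ n.Coprime m) := by
        intro n hn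
        simp only [Finset.mem_filter, Finset.mem_Ioc, Finset.mem_Icc] at hn ⊢
        refine ⟨⟨by omega, hn.1.2⟩, fun h => hc ?_⟩
        rw [Nat.Coprime, ← hn.2.gcd_eq]
        exact h
      calc _ ≤ _ := Finset.sum_le_sum_of_subset_of_nonneg hsub fun n _ _ => vonMangoldt_nonneg
        _ ≤ C₂ * m * x / Real.log x ^ N := h₂ x hx m hm hmL v hv
        _ = C₂ * m * E := by rw [hE]; ring
        _ ≤ _ := by gcongr; linarith
  rw [Finset.sum_sub_distrib]
  calc _ ≤ _ := abs_sub_le _ (((v : ℝ) - u) / m * singularSeries R m c) _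
    _ ≤ (2 * C₁ + C₂) * m * E + 4 * R * Real.log x ^ 2 := by
        rw [abs_sub_comm (((v : ℝ) - u) / m * singularSeries R m c)]
        exact add_le_add hmain hFR
    _ = _ := by rw [hE]; ring

theorem abs_sum_modEq_vonMangoldt_sub_FR_le_trivial {x R : ℝ} (hx : 3 ≤ x) (hR0 : 0 ≤ R)
    (hR : R ≤ √x) {u v m : ℕ} (huv : u ≤ v) (hv : v ≤ x) (hm : 0 < m) (c : ℕ) :
    |∑ n ∈ (Finset.Ioc u v).filter (fun n => n ≡ c [MOD m]), (vonMangoldt n - FR R n)| ≤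
      ((v : ℝ) - u) * (Real.log x + 1) + 4 * R * Real.log x ^ 2 := by
  have hL := one_le_log_of_three_le hx
  have huv' : (u : ℝ) ≤ v := by exact_mod_cast huv
  have hm1 : (1 : ℝ) ≤ m := by exact_mod_cast hm
  have hFR := abs_sum_modEq_FR_sub_le hx hR0 hR huv hm c
  have hΛ : ∑ n ∈ (Finset.Ioc u v).filter (fun n => n ≡ c [MOD m]), vonMangoldt n ≤
      ((v : ℝ) - u) * Real.log x := by
    calc _ ≤ ∑ n ∈ Finset.Ioc u v, vonMangoldt n :=
          Finset.sum_le_sum_of_subset_of_nonneg (Finset.filter_subset _ _)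
            fun n _ _ => vonMangoldt_nonneg
      _ ≤ ∑ n ∈ Finset.Ioc u v, Real.log x := by
          refine Finset.sum_le_sum fun n hn => vonMangoldt_le_log.trans ?_
          rw [Finset.mem_Ioc] at hn
          have h1 : (0 : ℝ) < n := by exact_mod_cast (by omega : 0 < n)
          have h2 : (n : ℝ) ≤ v := by exact_mod_cast hn.2
          exact Real.log_le_log h1 (h2.trans hv)
      _ = _ := by
          rw [Finset.sum_const, Nat.card_Ioc, nsmul_eq_mul, Nat.cast_sub huv]
  have hΛ0 : 0 ≤ ∑ n ∈ (Finset.Ioc u v).filter (fun n => n ≡ c [MOD m]), vonMangoldt n :=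
    Finset.sum_nonneg fun n _ => vonMangoldt_nonneg
  have hS : |((v : ℝ) - u) / m * singularSeries R m c| ≤ (v : ℝ) - u := by
    have h0 : 0 ≤ ((v : ℝ) - u) / m := div_nonneg (by linarith) (by linarith)
    rw [abs_mul, abs_of_nonneg h0]
    calc _ ≤ ((v : ℝ) - u) / m * m := by gcongr; exact abs_singularSeries_le R c hm
      _ = _ := by field_simp
  rw [Finset.sum_sub_distrib]
  rw [abs_le] at hFR hS ⊢
  constructor <;> linarith

end

section

lemma card_filter_dvd_Ioc_eq {t Q₀ Q₁ K : ℕ} (ht : 0 < t) (hK : t < (K + 1) * (Q₀ + 1)) :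
    ((Finset.Ioc Q₀ Q₁).filter (fun q => q ∣ t)).card =
      ((Finset.Icc 1 K).filter (fun m => m * Q₀ < t ∧ t ≤ m * Q₁ ∧ m ∣ t)).card := by
  have hdiv : ∀ {q : ℕ}, q ∣ t → 0 < q ∧ 0 < t / q ∧ t / q * q = t := fun {q} h =>
    ⟨Nat.pos_of_dvd_of_pos h ht, Nat.div_pos (Nat.le_of_dvd ht h) (Nat.pos_of_dvd_of_pos h ht),
      Nat.div_mul_cancel h⟩
  refine Finset.card_bij' (fun q _ => t / q) (fun m _ => t / m) ?_ ?_ ?_ ?_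
  · intro q hq
    simp only [Finset.mem_filter, Finset.mem_Ioc, Finset.mem_Icc] at hq ⊢
    obtain ⟨h1, h2, h3⟩ := hdiv hq.2
    refine ⟨⟨h2, ?_⟩, ?_, ?_, Nat.div_dvd_of_dvd hq.2⟩
    · by_contra! h
      have : (K + 1) * (Q₀ + 1) ≤ t / q * q := Nat.mul_le_mul h hq.1.1
      omega
    · calc t / q * Q₀ < t / q * q := Nat.mul_lt_mul_of_pos_left hq.1.1 h2
        _ = t := h3
    · calc t = t / q * q := h3.symm
        _ ≤ _ := Nat.mul_le_mul_left _ hq.1.2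
  · intro m hm
    simp only [Finset.mem_filter, Finset.mem_Ioc, Finset.mem_Icc] at hm ⊢
    obtain ⟨⟨_, _⟩, hm1, hm2, hmt⟩ := hm
    obtain ⟨h1, h2, h3⟩ := hdiv hmt
    refine ⟨⟨?_, ?_⟩, Nat.div_dvd_of_dvd hmt⟩
    · exact (Nat.lt_div_iff_mul_lt' hmt _).2 hm1
    · exact Nat.div_le_of_le_mul hm2
  · intro q hq
    exact Nat.div_div_self (Finset.mem_filter.1 hq).2 ht.ne'
  · intro m hm
    exact Nat.div_div_self (Finset.mem_filter.1 hm).2.2.2 ht.ne'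

lemma modEq_toNat_emod_iff {m n : ℕ} (hm : 0 < m) (a : ℤ) :
    n ≡ (a % m).toNat [MOD m] ↔ (m : ℤ) ∣ n - a := by
  rw [← Int.natCast_modEq_iff, Int.toNat_of_nonneg (Int.emod_nonneg _ (by omega)),
    ← Int.modEq_iff_dvd]
  exact ⟨fun h => (h.trans (Int.mod_modEq a m)).symm,
    fun h => (h.trans (by rfl)).symm.trans (Int.mod_modEq a m).symm⟩

/-- Switching from the modulus `q` to the complementary divisor `m = (n - a) / q`. -/
lemma sum_sum_dvd_sub_eq {N Q₀ Q₁ K : ℕ} {a : ℤ} (hK : (N : ℤ) - a < (K + 1) * (Q₀ + 1))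
    (f : ℕ → ℝ) :
    ∑ q ∈ Finset.Ioc Q₀ Q₁,
        ∑ n ∈ (Finset.Icc 1 N).filter (fun n : ℕ => a < (n : ℤ) ∧ (q : ℤ) ∣ (n : ℤ) - a), f n =
      ∑ m ∈ Finset.Icc 1 K,
        ∑ n ∈ (Finset.Ioc (min N (a + m * Q₀).toNat) (min N (a + m * Q₁).toNat)).filter
          (fun n => n ≡ (a % m).toNat [MOD m]), f n := by
  have hR : ∀ m ∈ Finset.Icc 1 K,
      (Finset.Ioc (min N (a + m * Q₀).toNat) (min N (a + m * Q₁).toNat)).filter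
          (fun n => n ≡ (a % m).toNat [MOD m]) =
        (Finset.Icc 1 N).filter (fun n : ℕ => a < (n : ℤ) ∧
          (m : ℤ) * Q₀ < n - a ∧ n - a ≤ (m : ℤ) * Q₁ ∧ (m : ℤ) ∣ n - a) := by
    intro m hm
    ext n
    have hm0 : 0 ≤ (m : ℤ) * Q₀ := by positivity
    simp only [Finset.mem_filter, Finset.mem_Ioc, Finset.mem_Icc,
      modEq_toNat_emod_iff (Finset.mem_Icc.1 hm).1 a]
    generalize (m : ℤ) * Q₀ = y at *
    generalize (m : ℤ) * Q₁ = z at *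
    constructor
    · rintro ⟨h1, h2⟩
      exact ⟨by omega, by omega, by omega, by omega, h2⟩
    · rintro ⟨h1, h2, h3, h4, h5⟩
      exact ⟨by omega, h5⟩
  refine Eq.trans ?_ (Finset.sum_congr rfl fun m hm => by rw [hR m hm]).symm
  simp only [Finset.sum_filter]
  rw [Finset.sum_comm, Finset.sum_comm (s := Finset.Icc 1 K)]
  refine Finset.sum_congr rfl fun n hn => ?_
  rw [Finset.mem_Icc] at hn
  rcases le_or_gt (n : ℤ) a with hna | hna
  · simp [not_lt.2 hna]
  · obtain ⟨t, ht⟩ := Int.eq_ofNat_of_zero_le (sub_nonneg.2 hna.le)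
    have ht0 : 0 < t := by omega
    have htK : t < (K + 1) * (Q₀ + 1) := by
      have : (t : ℤ) < (K + 1) * (Q₀ + 1) := by rw [← ht]; omega
      exact_mod_cast this
    have h := card_filter_dvd_Ioc_eq (Q₁ := Q₁) ht0 htK
    simp only [hna, true_and, ht]
    norm_cast
    rw [← Finset.sum_filter, ← Finset.sum_filter, Finset.sum_const, Finset.sum_const, h]

end

section

open ArithmeticFunction (vonMangoldt)

lemma two_le_log_pow_nine {x : ℝ} (hx : 3 ≤ x) : 2 ≤ Real.log x ^ 9 := by
  have h : (1.09 : ℝ) ≤ Real.log x :=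
    le_trans (by linarith [Real.log_three_gt_d9]) (Real.log_le_log (by norm_num) hx)
  calc (2 : ℝ) ≤ 1.09 ^ 9 := by norm_num
    _ ≤ _ := by gcongr

lemma min_toNat_sub_min_toNat_le {x M : ℝ} {a : ℤ} {m : ℕ} (hx : 0 ≤ x) (hM : 0 < M)
    (hMx : 2 * M ≤ x) (hm : 2 * M ≤ m) (w : ℕ) :
    ((min ⌊x⌋₊ w : ℕ) : ℝ) - (min ⌊x⌋₊ (a + m * ⌊x / (2 * M)⌋₊).toNat : ℕ) ≤
      |(a : ℝ)| + 2 * M := by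
  have hfl : (⌊x⌋₊ : ℝ) ≤ x := Nat.floor_le hx
  have h1 : ((min ⌊x⌋₊ w : ℕ) : ℝ) ≤ ⌊x⌋₊ := by exact_mod_cast min_le_left _ _
  have ha := neg_abs_le (a : ℝ)
  rcases le_total ⌊x⌋₊ (a + m * ⌊x / (2 * M)⌋₊).toNat with h | h
  · rw [min_eq_left h]
    have := abs_nonneg (a : ℝ)
    linarith
  · rw [min_eq_right h]
    have h2 : (a : ℝ) + m * ⌊x / (2 * M)⌋₊ ≤ (a + m * ⌊x / (2 * M)⌋₊).toNat := by
      exact_mod_cast Int.self_le_toNat (a + m * ⌊x / (2 * M)⌋₊)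
    have h3 : x / (2 * M) - 1 ≤ ⌊x / (2 * M)⌋₊ := (Nat.sub_one_lt_floor _).le
    have h4 : 0 ≤ x / (2 * M) - 1 := sub_nonneg.2 ((one_le_div (by linarith)).2 hMx)
    have h5 : x - 2 * M ≤ m * ⌊x / (2 * M)⌋₊ := by
      calc x - 2 * M = 2 * M * (x / (2 * M) - 1) := by field_simp
        _ ≤ m * ⌊x / (2 * M)⌋₊ := by gcongr
    linarith

lemma natFloor_sub_lt {x M : ℝ} {a : ℤ} (hx : 0 ≤ x) (hM : 0 < M) (ha : |(a : ℝ)| * M ≤ x) :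
    ((⌊x⌋₊ : ℕ) : ℤ) - a < ((⌊2 * M⌋₊ + 2 : ℕ) + 1) * (⌊x / (2 * M)⌋₊ + 1) := by
  have h1 : (⌊x⌋₊ : ℝ) ≤ x := Nat.floor_le hx
  have h2 : 2 * M < ⌊2 * M⌋₊ + 1 := Nat.lt_floor_add_one _
  have h3 : x / (2 * M) < ⌊x / (2 * M)⌋₊ + 1 := Nat.lt_floor_add_one _
  have h4 : |(a : ℝ)| ≤ x / M := (le_div_iff₀ hM).2 ha
  have h5 : (2 * M + 2) * (x / (2 * M)) = x + x / M := by field_simp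
  have h6 : 0 ≤ x / (2 * M) := by positivity
  have h7 := neg_abs_le (a : ℝ)
  have h8 : (2 * M + 2) * (x / (2 * M)) <
      ((⌊2 * M⌋₊ : ℝ) + 2 + 1) * (⌊x / (2 * M)⌋₊ + 1) :=
    mul_lt_mul'' (by linarith) h3 (by linarith) h6
  have h9 : (⌊x⌋₊ : ℝ) - a < ((⌊2 * M⌋₊ : ℝ) + 2 + 1) * (⌊x / (2 * M)⌋₊ + 1) := by linarith
  exact_mod_cast h9

lemma sum_psiStar_sub_rhoStar_eq {x M R : ℝ} {a : ℤ} (hx : 0 ≤ x) (hM : 0 < M)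
    (ha : |(a : ℝ)| * M ≤ x) :
    ∑ q ∈ Finset.Ioc ⌊x / (2 * M)⌋₊ ⌊x / M⌋₊, (psiStar x q a - rhoStar R x q a) =
      ∑ m ∈ Finset.Icc 1 (⌊2 * M⌋₊ + 2),
        ∑ n ∈ (Finset.Ioc (min ⌊x⌋₊ (a + m * ⌊x / (2 * M)⌋₊).toNat)
            (min ⌊x⌋₊ (a + m * ⌊x / M⌋₊).toNat)).filter
          (fun n => n ≡ (a % m).toNat [MOD m]), (vonMangoldt n - FR R n) := by
  rw [← sum_sum_dvd_sub_eq (natFloor_sub_lt hx hM ha)]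
  simp only [psiStar, rhoStar, Finset.sum_sub_distrib]

lemma exists_abs_sum_psiStar_sub_rhoStar_le (N : ℕ) :
    ∃ C : ℝ, 0 < C ∧ ∀ x : ℝ, 3 ≤ x → ∀ M R : ℝ, 1 ≤ M → 2 * M ≤ Real.log x ^ N →
      2 * M ≤ R → R ≤ √x → ∀ a : ℤ, |(a : ℝ)| * M ≤ x →
      |∑ q ∈ Finset.Ioc ⌊x / (2 * M)⌋₊ ⌊x / M⌋₊, (psiStar x q a - rhoStar R x q a)| ≤
        2 * M * (C * (2 * M) * x / Real.log x ^ N + 4 * √x * Real.log x ^ 2) +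
          2 * ((|(a : ℝ)| + 2 * M) * (Real.log x + 1) + 4 * √x * Real.log x ^ 2) := by
  obtain ⟨C, hC, h⟩ := exists_abs_sum_modEq_vonMangoldt_sub_FR_le N
  refine ⟨C, hC, fun x hx M R hM hML hMR hR a ha => ?_⟩
  have hx0 : 0 < x := by linarith
  have hL := one_le_log_of_three_le hx
  have hR0 : 0 ≤ R := by linarith
  have hMx : 2 * M ≤ x := (hMR.trans hR).trans (Real.sqrt_le_iff.2 ⟨hx0.le, by nlinarith⟩)
  let f : ℕ → ℝ := fun m => ∑ n ∈ (Finset.Ioc (min ⌊x⌋₊ (a + m * ⌊x / (2 * M)⌋₊).toNat)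
    (min ⌊x⌋₊ (a + m * ⌊x / M⌋₊).toNat)).filter
      (fun n => n ≡ (a % m).toNat [MOD m]), (vonMangoldt n - FR R n)
  have hfloor : ⌊x / (2 * M)⌋₊ ≤ ⌊x / M⌋₊ := by
    apply Nat.floor_le_floor
    gcongr
    linarith
  have huv : ∀ m : ℕ, min ⌊x⌋₊ (a + m * ⌊x / (2 * M)⌋₊).toNat ≤
      min ⌊x⌋₊ (a + m * ⌊x / M⌋₊).toNat := fun m =>
    min_le_min_left _ (Int.toNat_le_toNat (by gcongr))
  have hvx : ∀ w : ℕ, ((min ⌊x⌋₊ w : ℕ) : ℝ) ≤ x := fun w =>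
    le_trans (by exact_mod_cast min_le_left _ _) (Nat.floor_le hx0.le)
  have hsmall : ∀ m ∈ Finset.Icc 1 ⌊2 * M⌋₊, |f m| ≤
      C * (2 * M) * x / Real.log x ^ N + 4 * √x * Real.log x ^ 2 := by
    intro m hm
    rw [Finset.mem_Icc] at hm
    have hmM : (m : ℝ) ≤ 2 * M := (Nat.le_floor_iff (by linarith)).1 hm.2
    refine (h x hx m hm.1 (hmM.trans hML) R (hmM.trans hMR) hR _ _ _ (huv m) (hvx _)).trans ?_
    gcongr
  have hlarge : ∀ m : ℕ, ⌊2 * M⌋₊ + 1 ≤ m → |f m| ≤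
      (|(a : ℝ)| + 2 * M) * (Real.log x + 1) + 4 * √x * Real.log x ^ 2 := by
    intro m hm
    have hmM : 2 * M ≤ m := (Nat.lt_floor_add_one _).le.trans (by exact_mod_cast hm)
    refine (abs_sum_modEq_vonMangoldt_sub_FR_le_trivial hx hR0 hR (huv m) (hvx _)
      (by omega) _).trans ?_
    gcongr
    exact min_toNat_sub_min_toNat_le hx0.le (by linarith) hMx hmM _
  rw [sum_psiStar_sub_rhoStar_eq hx0.le (by linarith) ha, Finset.sum_Icc_succ_top (by omega),
    Finset.sum_Icc_succ_top (by omega)]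
  have h1 : |∑ m ∈ Finset.Icc 1 ⌊2 * M⌋₊, f m| ≤
      2 * M * (C * (2 * M) * x / Real.log x ^ N + 4 * √x * Real.log x ^ 2) := by
    refine (Finset.abs_sum_le_sum_abs _ _).trans ((Finset.sum_le_sum hsmall).trans ?_)
    rw [Finset.sum_const, Nat.card_Icc, Nat.add_sub_cancel, nsmul_eq_mul]
    gcongr
    exact Nat.floor_le (by linarith)
  have h2 := hlarge (⌊2 * M⌋₊ + 1) le_rfl
  have h3 := hlarge (⌊2 * M⌋₊ + 1 + 1) (by omega)
  refine (abs_add_three _ _ _).trans ?_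
  linarith

end

/-- dyadic first moment of `ψ* - ρ_R*` over all moduli. -/
theorem dyadic_average_all_moduli (A B : ℝ) (hA : 1 ≤ A) (hB : 1 ≤ B) :
    ∃ C : ℝ, 0 < C ∧ ∀ x : ℝ, 3 ≤ x → ∀ a : ℤ, a ≠ 0 →
      |(a : ℝ)| ≤ x / Real.log x ^ (A + B + 1) →
      ∀ M : ℝ, 1 ≤ M → M ≤ Real.log x ^ A →
      ∀ R : ℝ, 2 * M ≤ R → R ≤ x ^ ((1 : ℝ) / 2) →
      |(1 / (x / (2 * M))) *
          ∑ q ∈ Finset.Ioc ⌊x / (2 * M)⌋₊ ⌊x / M⌋₊, (psiStar x q a - rhoStar R x q a)|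
        ≤ C / Real.log x ^ B := by
  obtain ⟨C, hC, hsum⟩ := exists_abs_sum_psiStar_sub_rhoStar_le (⌈3 * A + B⌉₊ + 9)
  obtain ⟨c, hc, hlog⟩ := exists_log_pow_le_mul_sqrt ⌈2 * A + B + 2⌉₊
  refine ⟨8 * C + 8 + 48 * c, by positivity, fun x hx a _ ha M hM hMA R hMR hR => ?_⟩
  rw [← Real.sqrt_eq_rpow] at hR
  have hx0 : 0 < x := by linarith
  have hL := one_le_log_of_three_le hx
  have h9 := two_le_log_pow_nine hx
  set L := Real.log x with hLdef
  have hL0 : 0 < L := by linarith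
  set P := L ^ A with hP
  set D := L ^ B with hD
  have hP1 : 1 ≤ P := Real.one_le_rpow hL (by linarith)
  have hD1 : 1 ≤ D := Real.one_le_rpow hL (by linarith)
  have hPD : L ^ (A + B + 1) = P * D * L := by
    rw [Real.rpow_add hL0, Real.rpow_add hL0, Real.rpow_one]
  have hN : P ^ 3 * D ≤ L ^ ⌈3 * A + B⌉₊ := by
    calc P ^ 3 * D = L ^ (3 * A + B) := by
          rw [Real.rpow_add hL0, mul_comm 3 A, Real.rpow_mul hL0.le]
          norm_cast
      _ ≤ L ^ ((⌈3 * A + B⌉₊ : ℕ) : ℝ) :=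
          Real.rpow_le_rpow_of_exponent_le hL (Nat.le_ceil _)
      _ = _ := Real.rpow_natCast _ _
  have hE : P ^ 2 * D * L ^ 2 ≤ c * √x := by
    calc P ^ 2 * D * L ^ 2 = L ^ (2 * A + B + 2) := by
          rw [Real.rpow_add hL0, Real.rpow_add hL0, mul_comm 2 A, Real.rpow_mul hL0.le]
          norm_cast
      _ ≤ L ^ ((⌈2 * A + B + 2⌉₊ : ℕ) : ℝ) :=
          Real.rpow_le_rpow_of_exponent_le hL (Nat.le_ceil _)
      _ ≤ _ := by rw [Real.rpow_natCast]; exact hlog x hx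
  have hN9 : 2 * (P ^ 3 * D) ≤ L ^ (⌈3 * A + B⌉₊ + 9) := by
    rw [pow_add, mul_comm]
    gcongr
  rw [hPD, le_div_iff₀ (by positivity)] at ha
  have ha0 := abs_nonneg (a : ℝ)
  have hPP : P ≤ P ^ 3 * D := by
    calc P ≤ P ^ 3 := le_self_pow₀ hP1 (by norm_num)
      _ ≤ P ^ 3 * D := le_mul_of_one_le_right (by positivity) hD1
  have haM : |(a : ℝ)| * M ≤ x := by
    refine le_trans ?_ ha
    have : P ≤ P * D * L := by
      rw [mul_assoc]; exact le_mul_of_one_le_right (by linarith)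
            (one_le_mul_of_one_le_of_one_le hD1 hL)
    gcongr
    exact hMA.trans this
  have hS := hsum x hx M R hM (by linarith) hMR hR a haM
  rw [abs_mul, abs_of_pos (by positivity), one_div_div]
  set s := √x with hs
  have hsx : s * s = x := Real.mul_self_sqrt hx0.le
  have hs1 : 1 ≤ s := Real.one_le_sqrt.2 (by linarith)
  set W := L ^ (⌈3 * A + B⌉₊ + 9) with hW
  have hW0 : 0 < W := by positivity
  have hWb : M ^ 3 * D / W ≤ 1 := by
    rw [div_le_one hW0]
    have : M ^ 3 * D ≤ P ^ 3 * D := by gcongr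
    have : 0 ≤ P ^ 3 * D := by positivity
    linarith
  have hsb : M ^ 2 * L ^ 2 * D / s ≤ c := by
    rw [div_le_iff₀ (by linarith)]
    calc _ ≤ P ^ 2 * L ^ 2 * D := by gcongr
      _ = P ^ 2 * D * L ^ 2 := by ring
      _ ≤ _ := hE
  have hab : M * |(a : ℝ)| * L * D / x ≤ 1 := by
    rw [div_le_one hx0]
    calc _ ≤ P * |(a : ℝ)| * L * D := by gcongr
      _ = |(a : ℝ)| * (P * D * L) := by ring
      _ ≤ _ := ha
  rw [le_div_iff₀ (by positivity)]
  have hxs : M ^ 2 * L * D / x ≤ M ^ 2 * L ^ 2 * D / s := by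
    have h1 : L ≤ L ^ 2 := le_self_pow₀ hL (by norm_num)
    have h2 : s ≤ x := hsx ▸ le_mul_of_one_le_right (by linarith) hs1
    gcongr
  have hMs : M * L ^ 2 * D / s ≤ M ^ 2 * L ^ 2 * D / s := by
    have h1 : M ≤ M ^ 2 := le_self_pow₀ hM (by norm_num)
    gcongr
  calc _ ≤ 2 * M / x * (2 * M * (C * (2 * M) * x / W + 4 * s * L ^ 2) +
          2 * ((|(a : ℝ)| + 2 * M) * (L + L) + 4 * s * L ^ 2)) * D := by
        gcongr
        refine hS.trans ?_
        gcongr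
    _ = 8 * C * (M ^ 3 * D / W) + 16 * (M ^ 2 * L ^ 2 * D / s) + 8 * (M * |(a : ℝ)| * L * D / x) +
          16 * (M ^ 2 * L * D / x) + 16 * (M * L ^ 2 * D / s) := by
        rw [← hsx]
        field_simp
        ring
    _ ≤ 8 * C * 1 + 16 * c + 8 * 1 + 16 * c + 16 * c := by
        gcongr
        · exact hxs.trans hsb
        · exact hMs.trans hsb
    _ = _ := by ring
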